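/- Let, for every natural number n, (X_{n,t})_{t≥1} be a strictly stationary sequence of real random variables satisfying the absolute regularity (β-mixing) condition with coefficients β_n(t), and let {f_{n;j_1,…,j_r} : j_1,…,j_r ∈ {1,…,n}} be measurable kernels with |f_{n;j_1,…,j_r}| < F, where F is a constant not depending on n (for all sufficiently large n). Define V_n = Σ_{j_1,…,j_r = 1}^{n} f_{n;j_1,…,j_r}(X_{n,j_1},…,X_{n,j_r}) and V_n* = (V_n − E V_n)/√(Var V_n). Suppose there is a positive function h with h(t) → ∞ as t → ∞ such that β_n(t) ≤ t^{−h(t)} for all n and t, and there are constants C > 0 and κ > 0 such that Var V_n ≥ C n^{2(r−1)+κ}. Then all moments of V_n* converge to the corresponding moments of the standard normal law, and the distribution function of V_n* converges pointwise to the standard normal distribution function. -/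

import Mathlib

open MeasureTheory ProbabilityTheory Filter

noncomputable section

/-- The σ-algebra generated by the random variables `X i`, `i ∈ s`. -/
def sigmaGen {Ω : Type*} (X : ℕ → Ω → ℝ) (s : Set ℕ) : MeasurableSpace Ω :=
  ⨆ i ∈ s, MeasurableSpace.comap (X i) inferInstance

/-- The absolute regularity (β-mixing) coefficient of the sequence `(X t)_{t ≥ 1}`:
`β(m) = sup_{t ≥ 1} sup (1/2) ∑_{i,j} |P(A i ∩ B j) - P(A i) P(B j)|`, the inner supremum
being over finite partitions `{A i}` measurable w.r.t. `σ(X 1, …, X t)` and finite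
partitions `{B j}` measurable w.r.t. `σ(X s : s ≥ t + m)`. -/
def betaMixing {Ω : Type*} [MeasurableSpace Ω] (μ : Measure Ω) (X : ℕ → Ω → ℝ)
    (m : ℕ) : ℝ :=
  ⨆ t : ℕ, sSup {c : ℝ |
    ∃ (K L : ℕ) (A : Fin K → Set Ω) (B : Fin L → Set Ω),
      (∀ i, MeasurableSet[sigmaGen X (Set.Icc 1 (t + 1))] (A i)) ∧
      (∀ j, MeasurableSet[sigmaGen X (Set.Ici (t + 1 + m))] (B j)) ∧
      Pairwise (Function.onFun Disjoint A) ∧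
      Pairwise (Function.onFun Disjoint B) ∧
      (⋃ i, A i) = Set.univ ∧ (⋃ j, B j) = Set.univ ∧
      c = (1 / 2) * ∑ i : Fin K, ∑ j : Fin L,
        |(μ (A i ∩ B j)).toReal - (μ (A i)).toReal * (μ (B j)).toReal|}

/-- A sequence of real random variables is strictly stationary if all its
finite-dimensional distributions are invariant under index shifts. -/
def IsStrictlyStationary {Ω : Type*} [MeasurableSpace Ω] (μ : Measure Ω)
    (X : ℕ → Ω → ℝ) : Prop :=
  ∀ (τ k : ℕ) (t : Fin k → ℕ), (∀ i, 1 ≤ t i) →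
    μ.map (fun ω i => X (t i + τ) ω) = μ.map (fun ω i => X (t i) ω)

/-- The `V`-statistic `V_n = ∑_{j_1,…,j_r = 1}^{n} f_{j_1,…,j_r}(X_{j_1},…,X_{j_r})`. -/
def Vstat {Ω : Type*} (r n : ℕ) (f : (Fin r → ℕ) → (Fin r → ℝ) → ℝ)
    (X : ℕ → Ω → ℝ) (ω : Ω) : ℝ :=
  ∑ j ∈ Fintype.piFinset (fun _ : Fin r => Finset.Icc 1 n), f j fun k => X (j k) ω

lemma measureReal_rect_sub_le {S T : Type*} [MeasurableSpace S] [MeasurableSpace T]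
    {ρ₁ ρ₂ : Measure (S × T)} [IsFiniteMeasure ρ₁] [IsFiniteMeasure ρ₂] {a : S → ℕ} {b : T → ℕ} {K L : ℕ} {β : ℝ}
    (ha : Measurable a) (hb : Measurable b) (haK : ∀ x, a x < K) (hbL : ∀ y, b y < L)
    (h : ∑ i ∈ Finset.range K, ∑ j ∈ Finset.range L,
      |ρ₁.real ((a ⁻¹' {i}) ×ˢ (b ⁻¹' {j})) - ρ₂.real ((a ⁻¹' {i}) ×ˢ (b ⁻¹' {j}))| ≤ β)
    (U : ℕ → ℕ → Prop) :
    |ρ₁.real {z | U (a z.1) (b z.2)} - ρ₂.real {z | U (a z.1) (b z.2)}| ≤ β := by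
  classical
  have key : ∀ ρ : Measure (S × T), IsFiniteMeasure ρ → ρ.real {z | U (a z.1) (b z.2)} =
      ∑ p ∈ Finset.range K ×ˢ Finset.range L with U p.1 p.2,
        ρ.real ((a ⁻¹' {p.1}) ×ˢ (b ⁻¹' {p.2})) := by
    intro ρ _
    rw [← measureReal_biUnion_finset]
    · congr 1
      ext z
      simp only [Set.mem_ofPred_eq, Finset.mem_filter, Finset.mem_product, Finset.mem_range,
        Set.mem_iUnion, Set.mem_prod, Set.mem_preimage, Set.mem_singleton_iff, exists_prop]
      constructor
      · intro hz
        exact ⟨(a z.1, b z.2), ⟨⟨haK _, hbL _⟩, hz⟩, rfl, rfl⟩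
      · rintro ⟨p, ⟨_, hp⟩, h1, h2⟩
        rw [h1, h2]; exact hp
    · rintro p _ q _ hpq
      refine Set.disjoint_left.2 fun z hz hz' => hpq ?_
      simp only [Set.mem_prod, Set.mem_preimage, Set.mem_singleton_iff] at hz hz'
      exact Prod.ext (hz.1.symm.trans hz'.1) (hz.2.symm.trans hz'.2)
    · intro p _
      exact (ha (measurableSet_singleton _)).prod (hb (measurableSet_singleton _))
  rw [key ρ₁ inferInstance, key ρ₂ inferInstance, ← Finset.sum_sub_distrib]
  refine (Finset.abs_sum_le_sum_abs _ _).trans (le_trans ?_ h)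
  rw [← Finset.sum_product']
  exact Finset.sum_le_sum_of_subset_of_nonneg (Finset.filter_subset _ _) fun _ _ _ => abs_nonneg _

/-- If two finite measures on a product are `β`-close on all finite grids of rectangles, then they
are `β`-close on all measurable sets. -/
lemma measureReal_sub_le_of_grid {S T : Type*} [MeasurableSpace S] [MeasurableSpace T]
    {ρ₁ ρ₂ : Measure (S × T)} [IsFiniteMeasure ρ₁] [IsFiniteMeasure ρ₂] {β : ℝ}
    (h : ∀ (a : S → ℕ) (b : T → ℕ) (K L : ℕ), Measurable a → Measurable b →
      (∀ x, a x < K) → (∀ y, b y < L) → ∑ i ∈ Finset.range K, ∑ j ∈ Finset.range L,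
      |ρ₁.real ((a ⁻¹' {i}) ×ˢ (b ⁻¹' {j})) - ρ₂.real ((a ⁻¹' {i}) ×ˢ (b ⁻¹' {j}))| ≤ β)
    {E : Set (S × T)} (hE : MeasurableSet E) : |ρ₁.real E - ρ₂.real E| ≤ β := by
  classical
  let 𝒞 : Set (Set (S × T)) := {E | ∃ (a : S → ℕ) (b : T → ℕ) (K L : ℕ) (U : ℕ → ℕ → Prop),
    Measurable a ∧ Measurable b ∧ (∀ x, a x < K) ∧ (∀ y, b y < L) ∧
      E = {z | U (a z.1) (b z.2)}}
  have hcomb : ∀ (f : Prop → Prop → Prop) (s t : Set (S × T)), s ∈ 𝒞 → t ∈ 𝒞 →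
      {z | f (z ∈ s) (z ∈ t)} ∈ 𝒞 := by
    rintro f s t ⟨a, b, K, L, U, ha, hb, haK, hbL, rfl⟩ ⟨a', b', K', L', U', ha', hb', haK', hbL', rfl⟩
    refine ⟨fun x => Nat.pair (a x) (a' x), fun x => Nat.pair (b x) (b' x),
      (K + K' + 1) ^ 2, (L + L' + 1) ^ 2,
      fun i j => f (U i.unpair.1 j.unpair.1) (U' i.unpair.2 j.unpair.2), ?_, ?_, ?_, ?_, ?_⟩
    · exact (Measurable.of_discrete (f := fun p : ℕ × ℕ => Nat.pair p.1 p.2)).comp (ha.prodMk ha')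
    · exact (Measurable.of_discrete (f := fun p : ℕ × ℕ => Nat.pair p.1 p.2)).comp (hb.prodMk hb')
    · intro x
      have h1 := haK x
      have h2 := haK' x
      exact (Nat.pair_lt_max_add_one_sq _ _).trans_le (Nat.pow_le_pow_left (by omega) 2)
    · intro x
      have h1 := hbL x
      have h2 := hbL' x
      exact (Nat.pair_lt_max_add_one_sq _ _).trans_le (Nat.pow_le_pow_left (by omega) 2)
    · ext z; simp
  have hrect : ∀ (s : Set S) (t : Set T), MeasurableSet s → MeasurableSet t → s ×ˢ t ∈ 𝒞 := by
    intro s t hs ht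
    refine ⟨s.indicator fun _ => 1, t.indicator fun _ => 1, 2, 2, fun i j => i = 1 ∧ j = 1,
      measurable_const.indicator hs, measurable_const.indicator ht, ?_, ?_, ?_⟩
    · intro x; by_cases hx : x ∈ s <;> simp [hx]
    · intro x; by_cases hx : x ∈ t <;> simp [hx]
    · ext z; by_cases h1 : z.1 ∈ s <;> by_cases h2 : z.2 ∈ t <;> simp [h1, h2]
  have hring : IsSetRing 𝒞 := by
    refine ⟨?_, ?_, ?_⟩
    · simpa using hrect ∅ ∅ .empty .empty
    · intro s t hs ht
      exact hcomb Or s t hs ht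
    · intro s t hs ht
      exact hcomb (fun p q => p ∧ ¬ q) s t hs ht
  have hgen : (Prod.instMeasurableSpace : MeasurableSpace (S × T)) = MeasurableSpace.generateFrom 𝒞 := by
    apply le_antisymm
    · rw [← generateFrom_prod]
      apply MeasurableSpace.generateFrom_mono
      rintro _ ⟨s, hs, t, ht, rfl⟩
      exact hrect s t hs ht
    · apply MeasurableSpace.generateFrom_le
      rintro _ ⟨a, b, K, L, U, ha, hb, haK, hbL, rfl⟩
      exact (measurableSet_setOfPred.2 (Measurable.of_discrete (f := fun p : ℕ × ℕ => U p.1 p.2))).preimage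
        ((ha.comp measurable_fst).prodMk (hb.comp measurable_snd))
  refine le_of_forall_pos_le_add fun ε hε => ?_
  obtain ⟨t, ⟨a, b, K, L, U, ha, hb, haK, hbL, rfl⟩, ht⟩ :=
    exists_measure_symmDiff_lt_of_generateFrom_isSetRing (μ := ρ₁ + ρ₂) hring
      ⟨{Set.univ}, by simp, by simpa using hrect Set.univ Set.univ .univ .univ, by simp⟩ hgen hE
      (ENNReal.ofReal_pos.2 (half_pos hε))
  set t : Set (S × T) := {z | U (a z.1) (b z.2)}
  have h0 := measureReal_rect_sub_le ha hb haK hbL (h a b K L ha hb haK hbL) U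
  rw [Measure.add_apply] at ht
  have e1 : ρ₁.real (symmDiff t E) ≤ ε / 2 := by
    refine ENNReal.toReal_le_of_le_ofReal (by positivity) ((le_add_right le_rfl).trans ht.le)
  have e2 : ρ₂.real (symmDiff t E) ≤ ε / 2 := by
    refine ENNReal.toReal_le_of_le_ofReal (by positivity) ((le_add_left le_rfl).trans ht.le)
  have htm : MeasurableSet t :=
    (measurableSet_setOfPred.2 (Measurable.of_discrete (f := fun p : ℕ × ℕ => U p.1 p.2))).preimage
        ((ha.comp measurable_fst).prodMk (hb.comp measurable_snd))
  have d1 := abs_measureReal_sub_le_measureReal_symmDiff (μ := ρ₁) htm.nullMeasurableSet hE.nullMeasurableSet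
  have d2 := abs_measureReal_sub_le_measureReal_symmDiff (μ := ρ₂) htm.nullMeasurableSet hE.nullMeasurableSet
  rw [abs_le] at h0 d1 d2 ⊢
  constructor <;> linarith

lemma integral_sub_le_of_measureReal_sub_le {S : Type*} [MeasurableSpace S]
    {ρ₁ ρ₂ : Measure S} [IsProbabilityMeasure ρ₁] [IsProbabilityMeasure ρ₂] {β : ℝ}
    (h : ∀ E, MeasurableSet E → |ρ₁.real E - ρ₂.real E| ≤ β) {φ : S → ℝ}
    (hφ : Measurable φ) (hb : ∀ x, |φ x| ≤ 1) :
    |∫ x, φ x ∂ρ₁ - ∫ x, φ x ∂ρ₂| ≤ 2 * β := by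
  have hint : ∀ ρ : Measure S, IsProbabilityMeasure ρ → Integrable φ ρ := fun ρ _ =>
    Integrable.of_bound hφ.aestronglyMeasurable 1 (.of_forall hb)
  have key : ∀ ρ : Measure S, IsProbabilityMeasure ρ →
      ∫ x, φ x ∂ρ + 1 = ∫ t in (0 : ℝ)..2, ρ.real {x | t ≤ φ x + 1} := by
    intro ρ _
    have h1 := ((hint ρ inferInstance).add (integrable_const (1 : ℝ))).integral_eq_integral_Ioc_meas_le (M := 2)
      (.of_forall fun x => by have := (abs_le.1 (hb x)).1; simp; linarith)
      (.of_forall fun x => by have := (abs_le.1 (hb x)).2; simp; linarith)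
    simp only [Pi.add_apply] at h1
    rw [integral_add (hint ρ inferInstance) (integrable_const _)] at h1
    rw [intervalIntegral.integral_of_le (by norm_num), ← h1]; simp
  have hii : ∀ ρ : Measure S, IsProbabilityMeasure ρ →
      IntervalIntegrable (fun t : ℝ => ρ.real {x | t ≤ φ x + 1}) volume 0 2 := by
    intro ρ _
    apply Antitone.intervalIntegrable
    intro s t hst
    exact measureReal_mono (fun x hx => le_trans hst hx)
  have : ∫ x, φ x ∂ρ₁ - ∫ x, φ x ∂ρ₂ = ∫ t in (0 : ℝ)..2,
      (ρ₁.real {x | t ≤ φ x + 1} - ρ₂.real {x | t ≤ φ x + 1}) := by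
    rw [intervalIntegral.integral_sub (hii _ inferInstance) (hii _ inferInstance), ← key ρ₁ inferInstance, ← key ρ₂ inferInstance]
    ring
  rw [this]
  have := intervalIntegral.norm_integral_le_of_norm_le_const (a := (0:ℝ)) (b := 2) (C := β)
    (f := fun t => ρ₁.real {x | t ≤ φ x + 1} - ρ₂.real {x | t ≤ φ x + 1})
    (fun t _ => h _ (measurableSet_le measurable_const (hφ.add_const 1)))
  rw [Real.norm_eq_abs] at this
  refine this.trans (le_of_eq ?_)
  norm_num; ring

lemma sum_abs_le_betaMixing {Ω : Type*} [MeasurableSpace Ω] (μ : Measure Ω) [IsProbabilityMeasure μ]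
    {X : ℕ → Ω → ℝ} (hX : ∀ t, Measurable (X t)) (t m K L : ℕ)
    (A : Fin K → Set Ω) (B : Fin L → Set Ω)
    (hA : ∀ i, MeasurableSet[sigmaGen X (Set.Icc 1 (t + 1))] (A i))
    (hB : ∀ j, MeasurableSet[sigmaGen X (Set.Ici (t + 1 + m))] (B j))
    (hAd : Pairwise (Function.onFun Disjoint A)) (hBd : Pairwise (Function.onFun Disjoint B))
    (hAu : (⋃ i, A i) = Set.univ) (hBu : (⋃ j, B j) = Set.univ) :
    (1 / 2) * ∑ i : Fin K, ∑ j : Fin L,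
        |(μ (A i ∩ B j)).toReal - (μ (A i)).toReal * (μ (B j)).toReal| ≤ betaMixing μ X m := by
  have hle : ∀ s, sigmaGen X s ≤ (inferInstance : MeasurableSpace Ω) := fun s =>
    iSup₂_le fun i _ => (hX i).comap_le
  have hsum : ∀ (K : ℕ) (A : Fin K → Set Ω), (∀ i, MeasurableSet (A i)) →
      Pairwise (Function.onFun Disjoint A) → ∀ E, MeasurableSet E → (⋃ i, A i) = Set.univ →
      ∑ i, μ.real (A i ∩ E) = μ.real E := by
    intro K A hA hd E hE hu
    rw [← measureReal_iUnion_fintype]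
    · rw [← Set.iUnion_inter, hu, Set.univ_inter]
    · intro i j hij
      exact (hd hij).mono Set.inter_subset_left Set.inter_subset_left
    · exact fun i => (hA i).inter hE
  have hbdd : ∀ (t : ℕ) (c : ℝ), (∃ (K L : ℕ) (A : Fin K → Set Ω) (B : Fin L → Set Ω),
      (∀ i, MeasurableSet[sigmaGen X (Set.Icc 1 (t + 1))] (A i)) ∧
      (∀ j, MeasurableSet[sigmaGen X (Set.Ici (t + 1 + m))] (B j)) ∧
      Pairwise (Function.onFun Disjoint A) ∧
      Pairwise (Function.onFun Disjoint B) ∧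
      (⋃ i, A i) = Set.univ ∧ (⋃ j, B j) = Set.univ ∧
      c = (1 / 2) * ∑ i : Fin K, ∑ j : Fin L,
        |(μ (A i ∩ B j)).toReal - (μ (A i)).toReal * (μ (B j)).toReal|) → c ≤ 1 := by
    rintro t c ⟨K, L, A, B, hA, hB, hAd, hBd, hAu, hBu, rfl⟩
    have hA' := fun i => hle _ _ (hA i)
    have hB' := fun i => hle _ _ (hB i)
    have h1 : ∀ i j, |μ.real (A i ∩ B j) - μ.real (A i) * μ.real (B j)| ≤
        μ.real (A i ∩ B j) + μ.real (A i) * μ.real (B j) := by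
      intro i j
      have a1 : 0 ≤ μ.real (A i ∩ B j) := measureReal_nonneg
      have a2 : 0 ≤ μ.real (A i) * μ.real (B j) := by positivity
      rw [abs_le]; constructor <;> linarith
    have h2 : ∑ i, ∑ j, (μ.real (A i ∩ B j) + μ.real (A i) * μ.real (B j)) = 2 := by
      have e1 : ∑ i, μ.real (A i) = 1 := by
        have := hsum K A hA' hAd Set.univ .univ hAu
        simpa using this
      have e2 : ∑ i, μ.real (B i) = 1 := by
        have := hsum L B hB' hBd Set.univ .univ hBu
        simpa using this
      have e3 : ∀ i, ∑ j, μ.real (A i ∩ B j) = μ.real (A i) := by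
        intro i
        rw [← hsum L B hB' hBd (A i) (hA' i) hBu]
        simp_rw [Set.inter_comm]
      simp_rw [Finset.sum_add_distrib, e3, ← Finset.mul_sum, e2, mul_one, e1]
      norm_num
    have h3 := Finset.sum_le_sum fun i (_ : i ∈ Finset.univ) =>
      Finset.sum_le_sum fun j (_ : j ∈ Finset.univ) => h1 i j
    rw [h2] at h3
    change (1 / 2) * ∑ i : Fin K, ∑ j : Fin L,
        |μ.real (A i ∩ B j) - μ.real (A i) * μ.real (B j)| ≤ 1
    linarith
  unfold betaMixing
  have hbd : BddAbove (Set.range fun t : ℕ => sSup {c : ℝ |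
    ∃ (K L : ℕ) (A : Fin K → Set Ω) (B : Fin L → Set Ω),
      (∀ i, MeasurableSet[sigmaGen X (Set.Icc 1 (t + 1))] (A i)) ∧
      (∀ j, MeasurableSet[sigmaGen X (Set.Ici (t + 1 + m))] (B j)) ∧
      Pairwise (Function.onFun Disjoint A) ∧
      Pairwise (Function.onFun Disjoint B) ∧
      (⋃ i, A i) = Set.univ ∧ (⋃ j, B j) = Set.univ ∧
      c = (1 / 2) * ∑ i : Fin K, ∑ j : Fin L,
        |(μ (A i ∩ B j)).toReal - (μ (A i)).toReal * (μ (B j)).toReal|}) :=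
    ⟨1, by rintro _ ⟨t, rfl⟩; exact Real.sSup_le (hbdd t) zero_le_one⟩
  refine le_trans ?_ (le_ciSup hbd t)
  exact le_csSup ⟨1, hbdd t⟩ ⟨K, L, A, B, hA, hB, hAd, hBd, hAu, hBu, rfl⟩

lemma measurable_indicator_sigmaGen {Ω : Type*} [MeasurableSpace Ω] (X : ℕ → Ω → ℝ) (s : Set ℕ) :
    Measurable[sigmaGen X s] fun ω => s.indicator fun i => X i ω := by
  classical
  refine @measurable_pi_lambda _ _ _ (sigmaGen X s) _ _ fun i => ?_
  by_cases hi : i ∈ s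
  · simp only [Set.indicator_of_mem hi]
    exact Measurable.mono (comap_measurable (X i)) (le_iSup₂_of_le i hi le_rfl) le_rfl
  · simp only [Set.indicator_of_notMem hi]
    exact measurable_const

lemma measurable_indicator_path (s : Set ℕ) :
    Measurable fun x : ℕ → ℝ => s.indicator x := by
  classical
  refine measurable_pi_lambda _ fun i => ?_
  by_cases hi : i ∈ s
  · simp only [Set.indicator_of_mem hi]; exact measurable_pi_apply i
  · simp only [Set.indicator_of_notMem hi]; exact measurable_const

/-- The path that follows `x` up to time `t` and `y` afterwards. -/
def splice (t : ℕ) (x y : ℕ → ℝ) : ℕ → ℝ := fun i => if i ≤ t then x i else y i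

lemma measurable_splice (t : ℕ) : Measurable fun p : (ℕ → ℝ) × (ℕ → ℝ) => splice t p.1 p.2 := by
  refine measurable_pi_lambda _ fun i => ?_
  unfold splice
  split_ifs <;> fun_prop

/-- The law `P` of a path is `δ`-close, on bounded functions of the coordinates in `[1, t]` and
`[t + m, ∞)`, to the law of the path whose past and future are made independent. -/
def Decoupled (P : Measure (ℕ → ℝ)) (m : ℕ) (δ : ℝ) : Prop :=
  ∀ (t : ℕ) (φ : (ℕ → ℝ) → ℝ), Measurable φ → (∀ x, |φ x| ≤ 1) →
    DependsOn φ (Set.Icc 1 t ∪ Set.Ici (t + m)) →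
    |∫ x, φ x ∂P - ∫ x, ∫ y, φ (splice t x y) ∂P ∂P| ≤ δ

lemma decoupled_betaMixing {Ω : Type*} [MeasurableSpace Ω] (μ : Measure Ω) [IsProbabilityMeasure μ]
    {X : ℕ → Ω → ℝ} (hX : ∀ t, Measurable (X t)) {m : ℕ} (hm : 1 ≤ m) :
    Decoupled (μ.map fun ω t => X t ω) m (4 * betaMixing μ X m) := by
  have hXm : Measurable fun ω t => X t ω := measurable_pi_lambda _ hX
  have hβ0 : 0 ≤ betaMixing μ X m := by
    refine le_trans ?_ (sum_abs_le_betaMixing μ hX 0 m 1 1 (fun _ => Set.univ) (fun _ => Set.univ)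
      (fun _ => .univ) (fun _ => .univ) (fun i j h => (h (Subsingleton.elim _ _)).elim)
      (fun i j h => (h (Subsingleton.elim _ _)).elim) (Set.iUnion_const _) (Set.iUnion_const _))
    positivity
  set P := μ.map fun ω t => X t ω with hP
  have : IsProbabilityMeasure P := Measure.isProbabilityMeasure_map hXm.aemeasurable
  intro t φ hφ hφ1 hdep
  rcases Nat.eq_zero_or_pos t with rfl | ht
  · have : ∀ x y, φ (splice 0 x y) = φ y := by
      intro x y
      apply hdep
      intro i hi
      simp only [Set.mem_union, Set.mem_Icc, Set.mem_Ici] at hi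
      have : ¬ i ≤ 0 := by omega
      simp [splice, this]
    simp [this, hβ0]
  obtain ⟨s, rfl⟩ : ∃ s, t = s + 1 := ⟨t - 1, by omega⟩
  set u : (ℕ → ℝ) → (ℕ → ℝ) := fun x => (Set.Icc 1 (s + 1)).indicator x with hu
  set w : (ℕ → ℝ) → (ℕ → ℝ) := fun x => (Set.Ici (s + 1 + m)).indicator x with hw
  have hum : Measurable u := measurable_indicator_path _
  have hwm : Measurable w := measurable_indicator_path _
  have : IsProbabilityMeasure (P.map u) := Measure.isProbabilityMeasure_map hum.aemeasurable
  have : IsProbabilityMeasure (P.map w) := Measure.isProbabilityMeasure_map hwm.aemeasurable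
  have : IsProbabilityMeasure (P.map fun x => (u x, w x)) :=
    Measure.isProbabilityMeasure_map (hum.prodMk hwm).aemeasurable
  have hgrid : ∀ E, MeasurableSet E → |(P.map fun x => (u x, w x)).real E -
      ((P.map u).prod (P.map w)).real E| ≤ 2 * betaMixing μ X m := by
    intro E hE
    refine measureReal_sub_le_of_grid (fun a b K L ha hb haK hbL => ?_) hE
    have := sum_abs_le_betaMixing μ hX s m K L
      (fun i => (fun ω => u fun t => X t ω) ⁻¹' (a ⁻¹' {(i : ℕ)}))
      (fun j => (fun ω => w fun t => X t ω) ⁻¹' (b ⁻¹' {(j : ℕ)}))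
      (fun i => measurable_indicator_sigmaGen X _ (ha (measurableSet_singleton _)))
      (fun j => measurable_indicator_sigmaGen X _ (hb (measurableSet_singleton _)))
      (fun i j hij => Set.disjoint_left.2 fun ω h1 h2 => hij (Fin.ext (h1.symm.trans h2)))
      (fun i j hij => Set.disjoint_left.2 fun ω h1 h2 => hij (Fin.ext (h1.symm.trans h2)))
      (Set.eq_univ_of_forall fun ω => Set.mem_iUnion.2 ⟨⟨_, haK _⟩, rfl⟩)
      (Set.eq_univ_of_forall fun ω => Set.mem_iUnion.2 ⟨⟨_, hbL _⟩, rfl⟩)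
    have e : ∑ i ∈ Finset.range K, ∑ j ∈ Finset.range L,
        |(P.map fun x => (u x, w x)).real ((a ⁻¹' {i}) ×ˢ (b ⁻¹' {j})) -
          ((P.map u).prod (P.map w)).real ((a ⁻¹' {i}) ×ˢ (b ⁻¹' {j}))| =
        ∑ i : Fin K, ∑ j : Fin L,
        |(μ ((fun ω => u fun t => X t ω) ⁻¹' (a ⁻¹' {(i : ℕ)}) ∩
          (fun ω => w fun t => X t ω) ⁻¹' (b ⁻¹' {(j : ℕ)}))).toReal -
          (μ ((fun ω => u fun t => X t ω) ⁻¹' (a ⁻¹' {(i : ℕ)}))).toReal *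
          (μ ((fun ω => w fun t => X t ω) ⁻¹' (b ⁻¹' {(j : ℕ)}))).toReal| := by
      rw [Finset.sum_range]
      refine Finset.sum_congr rfl fun i _ => ?_
      rw [Finset.sum_range]
      refine Finset.sum_congr rfl fun j _ => ?_
      have ma := ha (measurableSet_singleton (i : ℕ))
      have mb := hb (measurableSet_singleton (j : ℕ))
      rw [measureReal_def, measureReal_def, Measure.prod_prod, ENNReal.toReal_mul,
        Measure.map_apply (hum.prodMk hwm) (ma.prod mb), Measure.map_apply hum ma,
        Measure.map_apply hwm mb, hP, Measure.map_apply hXm, Measure.map_apply hXm (hum ma),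
        Measure.map_apply hXm (hwm mb)]
      · rfl
      · exact (hum.prodMk hwm) (ma.prod mb)
    rw [e]; linarith
  have hΦ : Measurable fun p : (ℕ → ℝ) × (ℕ → ℝ) => φ (splice (s + 1) p.1 p.2) :=
    hφ.comp (measurable_splice _)
  have main := integral_sub_le_of_measureReal_sub_le hgrid hΦ fun p => hφ1 _
  have hsp : ∀ x y, φ (splice (s + 1) (u x) (w y)) = φ (splice (s + 1) x y) := by
    intro x y
    apply hdep
    intro i hi
    simp only [Set.mem_union, Set.mem_Icc, Set.mem_Ici] at hi
    unfold splice
    split_ifs with h1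
    · exact Set.indicator_of_mem (s := Set.Icc 1 (s + 1)) ⟨by omega, h1⟩ x
    · exact Set.indicator_of_mem (s := Set.Ici (s + 1 + m)) (Set.mem_Ici.2 (by omega)) y
  have hself : ∀ x : ℕ → ℝ, splice (s + 1) x x = x := fun x => by
    funext i; simp [splice]
  rw [integral_map (hum.prodMk hwm).aemeasurable hΦ.aestronglyMeasurable,
    integral_prod _ (Integrable.of_bound hΦ.aestronglyMeasurable 1 (.of_forall fun p => hφ1 _)),
    integral_map hum.aemeasurable] at main
  · simp only [hsp, hself] at main
    have e : ∀ x, ∫ y, φ (splice (s + 1) (u x) y) ∂(P.map w) = ∫ y, φ (splice (s + 1) x y) ∂P := by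
      intro x
      rw [integral_map hwm.aemeasurable]
      · simp only [hsp]
      · exact (hΦ.comp measurable_prodMk_left).aestronglyMeasurable
    simp only [e] at main
    linarith
  · exact hΦ.stronglyMeasurable.integral_prod_right.aestronglyMeasurable

lemma integrable_of_abs_le {S : Type*} [MeasurableSpace S] {ρ : Measure S} [IsFiniteMeasure ρ]
    {φ : S → ℝ} (hφ : Measurable φ) {M : ℝ} (hb : ∀ x, |φ x| ≤ M) : Integrable φ ρ :=
  Integrable.of_bound hφ.aestronglyMeasurable M (.of_forall hb)

lemma abs_integral_le_of_abs_le {S : Type*} [MeasurableSpace S] {ρ : Measure S}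
    [IsProbabilityMeasure ρ] {φ : S → ℝ} {M : ℝ} (hb : ∀ x, |φ x| ≤ M) : |∫ x, φ x ∂ρ| ≤ M := by
  simpa using norm_integral_le_of_norm_le_const (μ := ρ) (f := φ) (C := M) (.of_forall hb)

lemma abs_integral_sub_integral_le {S : Type*} [MeasurableSpace S] {ρ : Measure S}
    [IsProbabilityMeasure ρ] {f g : S → ℝ} (hf : Integrable f ρ) (hg : Integrable g ρ) {δ : ℝ}
    (h : ∀ x, |f x - g x| ≤ δ) : |∫ x, f x ∂ρ - ∫ x, g x ∂ρ| ≤ δ := by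
  rw [← integral_sub hf hg]
  exact abs_integral_le_of_abs_le h

lemma integral_swap_of_abs_le {S T : Type*} [MeasurableSpace S] [MeasurableSpace T]
    {ρ : Measure S} {τ : Measure T} [IsProbabilityMeasure ρ] [IsProbabilityMeasure τ]
    {F : S → T → ℝ} (hF : Measurable (Function.uncurry F)) {M : ℝ} (hb : ∀ x y, |F x y| ≤ M) :
    ∫ x, ∫ y, F x y ∂τ ∂ρ = ∫ y, ∫ x, F x y ∂ρ ∂τ :=
  integral_integral_swap (integrable_of_abs_le hF fun p => hb p.1 p.2)

lemma measurable_integral_right {S T : Type*} [MeasurableSpace S] [MeasurableSpace T]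
    {τ : Measure T} [IsProbabilityMeasure τ]
    {F : S → T → ℝ} (hF : Measurable (Function.uncurry F)) : Measurable fun x => ∫ y, F x y ∂τ :=
  (hF.stronglyMeasurable.integral_prod_right (ν := τ)).measurable

lemma Decoupled.bound {P : Measure (ℕ → ℝ)} {m : ℕ} {δ : ℝ} (h : Decoupled P m δ) (t : ℕ)
    {φ : (ℕ → ℝ) → ℝ} (hφ : Measurable φ) {M : ℝ} (hb : ∀ x, |φ x| ≤ M)
    (hdep : DependsOn φ (Set.Icc 1 t ∪ Set.Ici (t + m))) :
    |∫ x, φ x ∂P - ∫ x, ∫ y, φ (splice t x y) ∂P ∂P| ≤ M * δ := by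
  have hM : 0 ≤ M := (abs_nonneg _).trans (hb 0)
  rcases hM.eq_or_lt with rfl | hM
  · have : ∀ x, φ x = 0 := fun x => by simpa using hb x
    simp [this]
  · have := h t (fun x => φ x / M) (hφ.div_const M)
      (fun x => by rw [abs_div, abs_of_pos hM]; exact (div_le_one hM).2 (hb x))
      (fun x y hxy => by simp only [hdep hxy])
    simp only [integral_div] at this
    rwa [← sub_div, abs_div, abs_of_pos hM, div_le_iff₀ hM, mul_comm δ] at this

lemma Decoupled.abs_integral_mul_sub_le {P : Measure (ℕ → ℝ)} [IsProbabilityMeasure P] {m : ℕ}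
    {δ : ℝ} (hm : 1 ≤ m) (h : Decoupled P m δ) (t : ℕ)
    {ξ η : (ℕ → ℝ) → ℝ} (hξ : Measurable ξ) (hη : Measurable η) {M₁ M₂ : ℝ}
    (hb₁ : ∀ x, |ξ x| ≤ M₁) (hb₂ : ∀ x, |η x| ≤ M₂)
    (hd₁ : DependsOn ξ (Set.Icc 1 t)) (hd₂ : DependsOn η (Set.Ici (t + m))) :
    |∫ x, ξ x * η x ∂P - (∫ x, ξ x ∂P) * ∫ x, η x ∂P| ≤ M₁ * M₂ * δ := by
  have hM : 0 ≤ M₁ := (abs_nonneg _).trans (hb₁ 0)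
  have := h.bound t (hξ.mul hη) (M := M₁ * M₂)
    (fun x => by
      rw [Pi.mul_apply, abs_mul]
      exact mul_le_mul (hb₁ x) (hb₂ x) (abs_nonneg _) hM)
    (fun x y hxy => by
      rw [Pi.mul_apply, Pi.mul_apply, hd₁ fun i hi => hxy i (Or.inl hi),
        hd₂ fun i hi => hxy i (Or.inr hi)])
  have e : ∀ x y, (ξ * η) (splice t x y) = ξ x * η y := by
    intro x y
    rw [Pi.mul_apply]
    congr 1
    · apply hd₁; intro i hi; exact if_pos hi.2
    · apply hd₂; intro i hi
      have : ¬ i ≤ t := by have := Set.mem_Ici.1 hi; omega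
      exact if_neg this
  simp only [e, integral_const_mul, integral_mul_const] at this
  exact this

lemma Decoupled.norm_integral_mul_sub_le {P : Measure (ℕ → ℝ)} [IsProbabilityMeasure P] {m : ℕ}
    {δ : ℝ} (hm : 1 ≤ m) (h : Decoupled P m δ) (t : ℕ)
    {ξ η : (ℕ → ℝ) → ℂ} (hξ : Measurable ξ) (hη : Measurable η)
    (hb₁ : ∀ x, ‖ξ x‖ ≤ 1) (hb₂ : ∀ x, ‖η x‖ ≤ 1)
    (hd₁ : DependsOn ξ (Set.Icc 1 t)) (hd₂ : DependsOn η (Set.Ici (t + m))) :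
    ‖∫ x, ξ x * η x ∂P - (∫ x, ξ x ∂P) * ∫ x, η x ∂P‖ ≤ 4 * δ := by
  have hre : Measurable fun x => (ξ x).re := Complex.measurable_re.comp hξ
  have him : Measurable fun x => (ξ x).im := Complex.measurable_im.comp hξ
  have hre' : Measurable fun x => (η x).re := Complex.measurable_re.comp hη
  have him' : Measurable fun x => (η x).im := Complex.measurable_im.comp hη
  have b1 : ∀ x, |(ξ x).re| ≤ 1 := fun x => (Complex.abs_re_le_norm _).trans (hb₁ x)
  have b2 : ∀ x, |(ξ x).im| ≤ 1 := fun x => (Complex.abs_im_le_norm _).trans (hb₁ x)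
  have b3 : ∀ x, |(η x).re| ≤ 1 := fun x => (Complex.abs_re_le_norm _).trans (hb₂ x)
  have b4 : ∀ x, |(η x).im| ≤ 1 := fun x => (Complex.abs_im_le_norm _).trans (hb₂ x)
  have d1 : DependsOn (fun x => (ξ x).re) (Set.Icc 1 t) := fun x y h => by simp only [hd₁ h]
  have d2 : DependsOn (fun x => (ξ x).im) (Set.Icc 1 t) := fun x y h => by simp only [hd₁ h]
  have d3 : DependsOn (fun x => (η x).re) (Set.Ici (t + m)) := fun x y h => by simp only [hd₂ h]
  have d4 : DependsOn (fun x => (η x).im) (Set.Ici (t + m)) := fun x y h => by simp only [hd₂ h]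
  have h13 := h.abs_integral_mul_sub_le hm t hre hre' b1 b3 d1 d3
  have h14 := h.abs_integral_mul_sub_le hm t hre him' b1 b4 d1 d4
  have h23 := h.abs_integral_mul_sub_le hm t him hre' b2 b3 d2 d3
  have h24 := h.abs_integral_mul_sub_le hm t him him' b2 b4 d2 d4
  have iξ : Integrable ξ P := Integrable.of_bound hξ.aestronglyMeasurable 1 (.of_forall hb₁)
  have iη : Integrable η P := Integrable.of_bound hη.aestronglyMeasurable 1 (.of_forall hb₂)
  have iξη : Integrable (fun x => ξ x * η x) P :=
    Integrable.of_bound (hξ.mul hη).aestronglyMeasurable 1 (.of_forall fun x => by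
      rw [norm_mul]; exact mul_le_one₀ (hb₁ x) (norm_nonneg _) (hb₂ x))
  have re_int : ∀ f : (ℕ → ℝ) → ℂ, Integrable f P → (∫ x, f x ∂P).re = ∫ x, (f x).re ∂P :=
    fun f hf => (integral_re hf).symm
  have im_int : ∀ f : (ℕ → ℝ) → ℂ, Integrable f P → (∫ x, f x ∂P).im = ∫ x, (f x).im ∂P :=
    fun f hf => (integral_im hf).symm
  have I : ∀ {u v : (ℕ → ℝ) → ℝ}, Measurable u → Measurable v → (∀ x, |u x| ≤ 1) →
      (∀ x, |v x| ≤ 1) → Integrable (fun x => u x * v x) P := fun hu hv bu bv =>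
    integrable_of_abs_le (hu.mul hv) (M := 1) fun x => by
      rw [abs_mul]; exact mul_le_one₀ (bu x) (abs_nonneg _) (bv x)
  refine (Complex.norm_le_abs_re_add_abs_im _).trans ?_
  rw [Complex.sub_re, Complex.sub_im, Complex.mul_re, Complex.mul_im, re_int _ iξη, im_int _ iξη,
    re_int _ iξ, re_int _ iη, im_int _ iξ, im_int _ iη]
  simp only [Complex.mul_re, Complex.mul_im]
  rw [integral_sub (I hre hre' b1 b3) (I him him' b2 b4),
    integral_add (I hre him' b1 b4) (I him hre' b2 b3)]
  have t1 := abs_sub (∫ x, (ξ x).re * (η x).re ∂P - (∫ x, (ξ x).re ∂P) * ∫ x, (η x).re ∂P)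
    (∫ x, (ξ x).im * (η x).im ∂P - (∫ x, (ξ x).im ∂P) * ∫ x, (η x).im ∂P)
  have t2 := abs_add_le (∫ x, (ξ x).re * (η x).im ∂P - (∫ x, (ξ x).re ∂P) * ∫ x, (η x).im ∂P)
    (∫ x, (ξ x).im * (η x).re ∂P - (∫ x, (ξ x).im ∂P) * ∫ x, (η x).re ∂P)
  ring_nf at t1 t2 h13 h14 h23 h24 ⊢
  linarith

/-- A coordinate which is `m`-far from all other relevant coordinates can be resampled. -/
lemma Decoupled.resample {P : Measure (ℕ → ℝ)} [IsProbabilityMeasure P] {m : ℕ} {δ : ℝ}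
    (hm : 1 ≤ m) (hδ : 0 ≤ δ) (h : Decoupled P m δ) {I : Set ℕ} (hI : ∀ s ∈ I, 1 ≤ s) {t : ℕ}
    (htI : t ∈ I) (hiso : ∀ s ∈ I, s ≠ t → s + m ≤ t ∨ t + m ≤ s)
    {φ : (ℕ → ℝ) → ℝ} (hφ : Measurable φ) {M : ℝ} (hb : ∀ x, |φ x| ≤ M) (hdep : DependsOn φ I) :
    |∫ x, φ x ∂P - ∫ x, ∫ z, φ (Function.update x t (z t)) ∂P ∂P| ≤ 3 * M * δ := by
  have hM : 0 ≤ M := (abs_nonneg _).trans (hb 0)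
  have hMδ : 0 ≤ M * δ := mul_nonneg hM hδ
  have mupd : Measurable fun p : (ℕ → ℝ) × (ℕ → ℝ) => Function.update p.1 t (p.2 t) := by
    refine measurable_pi_lambda _ fun i => ?_
    by_cases hi : i = t
    · subst hi; simp only [Function.update_self]; fun_prop
    · simp only [Function.update_of_ne hi]; fun_prop
  have hF : Measurable (Function.uncurry fun x z : ℕ → ℝ => φ (Function.update x t (z t))) := hφ.comp mupd
  rw [integral_swap_of_abs_le hF fun x y => hb _]
  have hAB := h.bound t hφ hb (fun x y hxy => hdep fun i hi => hxy i (by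
    have h1 := hI i hi
    by_cases hit : i = t
    · subst hit; exact Or.inl ⟨h1, le_rfl⟩
    · rcases hiso i hi hit with h2 | h2
      · exact Or.inl ⟨h1, by omega⟩
      · exact Or.inr h2))
  have hS : Measurable (Function.uncurry fun x y : ℕ → ℝ => φ (splice t x y)) := hφ.comp (measurable_splice t)
  rw [integral_swap_of_abs_le hS fun x y => hb _] at hAB
  by_cases htm : t < m
  · have e : ∀ y x, φ (splice t x y) = φ (Function.update y t (x t)) := by
      intro y x
      refine hdep fun i hi => ?_
      by_cases hit : i = t
      · subst hit; simp [splice]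
      · have h1 := hI i hi
        have : ¬ i ≤ t := by have := hiso i hi hit; omega
        simp [splice, this, hit]
    simp only [e] at hAB
    rw [integral_swap_of_abs_le hF fun x y => hb _] at hAB
    linarith
  push Not at htm
  set t' := t - m with ht'
  have hspl : ∀ (a : ℕ), Measurable (Function.uncurry fun x y : ℕ → ℝ => splice a x y) :=
    measurable_splice
  have mG : Measurable fun p : (ℕ → ℝ) × (ℕ → ℝ) × (ℕ → ℝ) =>
      φ (splice t (splice t' p.1 p.2.1) p.2.2) :=
    hφ.comp ((hspl t).comp
      (((hspl t').comp (measurable_fst.prodMk (measurable_fst.comp measurable_snd))).prodMk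
        (measurable_snd.comp measurable_snd)))
  have hBC : |∫ y, ∫ x, φ (splice t x y) ∂P ∂P -
      ∫ y, ∫ x, ∫ z, φ (splice t (splice t' x z) y) ∂P ∂P ∂P| ≤ M * δ := by
    refine abs_integral_sub_integral_le
      (integrable_of_abs_le (M := M) (measurable_integral_right
        (F := fun y x => φ (splice t x y)) (hS.comp measurable_swap))
        fun y => abs_integral_le_of_abs_le fun x => hb _)
      (integrable_of_abs_le (M := M) (measurable_integral_right
        (F := fun y x => ∫ z, φ (splice t (splice t' x z) y) ∂P)
        (measurable_integral_right (F := fun (p : (ℕ → ℝ) × (ℕ → ℝ)) z =>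
          φ (splice t (splice t' p.2 z) p.1)) (mG.comp
          ((measurable_snd.comp measurable_fst).prodMk (measurable_snd.prodMk
            (measurable_fst.comp measurable_fst))))))
        fun y => abs_integral_le_of_abs_le fun x => abs_integral_le_of_abs_le fun z => hb _) ?_
    intro y
    refine h.bound t' (φ := fun x => φ (splice t x y)) (hS.comp measurable_prodMk_right)
      (fun x => hb _) (fun x x' hx => hdep fun i hi => ?_)
    unfold splice
    split_ifs with hit
    · refine hx i ?_
      by_cases hit' : i = t
      · exact Or.inr (Set.mem_Ici.2 (by omega))
      · have := hiso i hi hit'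
        exact Or.inl ⟨hI i hi, by omega⟩
    · rfl
  have hDE : |∫ z, ∫ x, φ (Function.update x t (z t)) ∂P ∂P -
      ∫ z, ∫ x, ∫ y, φ (splice t (splice t' x z) y) ∂P ∂P ∂P| ≤ M * δ := by
    refine abs_integral_sub_integral_le
      (integrable_of_abs_le (M := M) (measurable_integral_right
        (F := fun (z x : ℕ → ℝ) => φ (Function.update x t (z t))) (hF.comp measurable_swap))
        fun y => abs_integral_le_of_abs_le fun x => hb _)
      (integrable_of_abs_le (M := M) (measurable_integral_right
        (F := fun z x => ∫ y, φ (splice t (splice t' x z) y) ∂P)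
        (measurable_integral_right (F := fun (p : (ℕ → ℝ) × (ℕ → ℝ)) y =>
          φ (splice t (splice t' p.2 p.1) y)) (mG.comp
          ((measurable_snd.comp measurable_fst).prodMk
            ((measurable_fst.comp measurable_fst).prodMk measurable_snd)))))
        fun y => abs_integral_le_of_abs_le fun x => abs_integral_le_of_abs_le fun z => hb _) ?_
    intro z
    have h3 := h.bound t' (φ := fun x => φ (Function.update x t (z t)))
      (hF.comp measurable_prodMk_right)
      (fun x => hb _) (fun x x' hx => hdep fun i hi => by
        by_cases hit : i = t
        · subst hit; simp
        · simp only [Function.update_of_ne hit]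
          refine hx i ?_
          rcases hiso i hi hit with h2 | h2
          · exact Or.inl ⟨hI i hi, by omega⟩
          · exact Or.inr (Set.mem_Ici.2 (by omega)))
    have e : ∀ x y, φ (splice t (splice t' x z) y) =
        φ (Function.update (splice t' x y) t (z t)) := by
      intro x y
      refine hdep fun i hi => ?_
      by_cases hit : i = t
      · subst hit
        have : ¬ i ≤ t' := by omega
        simp [splice, this]
      · rw [Function.update_of_ne hit]
        unfold splice
        rcases hiso i hi hit with h2 | h2
        · have a1 : i ≤ t := by omega
          have a2 : i ≤ t' := by omega
          simp [a1, a2]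
        · have a1 : ¬ i ≤ t := by omega
          have a2 : ¬ i ≤ t' := by omega
          simp [a1, a2]
    simp only [e]
    exact h3
  have hCE : ∫ y, ∫ x, ∫ z, φ (splice t (splice t' x z) y) ∂P ∂P ∂P =
      ∫ z, ∫ x, ∫ y, φ (splice t (splice t' x z) y) ∂P ∂P ∂P := by
    rw [integral_swap_of_abs_le (F := fun y x => ∫ z, φ (splice t (splice t' x z) y) ∂P) (M := M),
      integral_swap_of_abs_le (F := fun z x => ∫ y, φ (splice t (splice t' x z) y) ∂P) (M := M)]
    · congr 1
      funext x
      rw [integral_swap_of_abs_le (F := fun y z => φ (splice t (splice t' x z) y)) (M := M)]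
      · exact mG.comp (measurable_const.prodMk (measurable_snd.prodMk measurable_fst))
      · exact fun _ _ => hb _
    · exact (measurable_integral_right (F := fun (p : (ℕ → ℝ) × (ℕ → ℝ)) y =>
          φ (splice t (splice t' p.2 p.1) y)) (mG.comp
          ((measurable_snd.comp measurable_fst).prodMk
            ((measurable_fst.comp measurable_fst).prodMk measurable_snd))))
    · exact fun _ _ => abs_integral_le_of_abs_le fun z => hb _
    · exact (measurable_integral_right (F := fun (p : (ℕ → ℝ) × (ℕ → ℝ)) z =>
          φ (splice t (splice t' p.2 z) p.1)) (mG.comp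
          ((measurable_snd.comp measurable_fst).prodMk (measurable_snd.prodMk
            (measurable_fst.comp measurable_fst)))))
    · exact fun _ _ => abs_integral_le_of_abs_le fun z => hb _
  rw [hCE] at hBC
  rw [abs_le] at *
  constructor <;> linarith [hAB.1, hAB.2, hBC.1, hBC.2, hDE.1, hDE.2]

/-- The law of a sequence of independent variables with the same marginals as `P`. -/
def indepLaw (P : Measure (ℕ → ℝ)) : Measure (ℕ → ℝ) :=
  Measure.infinitePi fun i => P.map fun x => x i

lemma isProbabilityMeasure_map_coord (P : Measure (ℕ → ℝ)) [IsProbabilityMeasure P] (i : ℕ) :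
    IsProbabilityMeasure (P.map fun x => x i) :=
  Measure.isProbabilityMeasure_map (measurable_pi_apply i).aemeasurable

instance (P : Measure (ℕ → ℝ)) [IsProbabilityMeasure P] : IsProbabilityMeasure (indepLaw P) := by
  have := isProbabilityMeasure_map_coord P
  unfold indepLaw
  infer_instance

lemma integral_coord_indepLaw (P : Measure (ℕ → ℝ)) [IsProbabilityMeasure P] (t : ℕ)
    {u : ℝ → ℝ} (hu : Measurable u) : ∫ y, u (y t) ∂indepLaw P = ∫ x, u (x t) ∂P := by
  have := isProbabilityMeasure_map_coord P
  have h := Measure.infinitePi_map_eval (fun i => P.map fun x => x i) t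
  rw [← integral_map (μ := indepLaw P) (φ := fun y => y t) (measurable_pi_apply t).aemeasurable
      hu.aestronglyMeasurable,
    ← integral_map (μ := P) (φ := fun y => y t) (measurable_pi_apply t).aemeasurable
      hu.aestronglyMeasurable, ← h]
  rfl

lemma measurable_update_coord (t : ℕ) :
    Measurable fun p : (ℕ → ℝ) × (ℕ → ℝ) => Function.update p.2 t (p.1 t) := by
  refine measurable_pi_lambda _ fun i => ?_
  by_cases hi : i = t
  · subst hi; simp only [Function.update_self]; fun_prop
  · simp only [Function.update_of_ne hi]; fun_prop

lemma map_update_indepLaw (P : Measure (ℕ → ℝ)) [IsProbabilityMeasure P] (t : ℕ) :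
    (P.prod (indepLaw P)).map (fun p => Function.update p.2 t (p.1 t)) = indepLaw P := by
  have := isProbabilityMeasure_map_coord P
  refine Measure.eq_infinitePi _ fun s T hT => ?_
  rw [Measure.map_apply (measurable_update_coord t)
    (MeasurableSet.pi s.countable_toSet fun i _ => hT i)]
  by_cases hts : t ∈ s
  · have : (fun p : (ℕ → ℝ) × (ℕ → ℝ) => Function.update p.2 t (p.1 t)) ⁻¹' (Set.pi s T) =
        {x : ℕ → ℝ | x t ∈ T t} ×ˢ (Set.pi (s.erase t : Finset ℕ) T) := by
      ext ⟨x, y⟩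
      simp only [Set.mem_preimage, Set.mem_pi, Finset.mem_coe, Set.mem_prod, Set.mem_ofPred_eq,
        Finset.mem_erase]
      constructor
      · intro h
        refine ⟨by simpa using h t hts, fun i hi => by simpa [hi.1] using h i hi.2⟩
      · rintro ⟨h1, h2⟩ i hi
        by_cases hit : i = t
        · subst hit; simpa using h1
        · simpa [hit] using h2 i ⟨hit, hi⟩
    rw [this, Measure.prod_prod, indepLaw, Measure.infinitePi_pi _ fun i _ => hT i,
      ← Finset.mul_prod_erase s _ hts, Measure.map_apply (measurable_pi_apply t) (hT t)]
    rfl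
  · have : (fun p : (ℕ → ℝ) × (ℕ → ℝ) => Function.update p.2 t (p.1 t)) ⁻¹' (Set.pi s T) =
        Set.univ ×ˢ (Set.pi s T) := by
      ext ⟨x, y⟩
      simp only [Set.mem_preimage, Set.mem_pi, Finset.mem_coe, Set.mem_prod, Set.mem_univ, true_and]
      refine forall₂_congr fun i hi => ?_
      have : i ≠ t := fun h => hts (h ▸ hi)
      simp [this]
    rw [this, Measure.prod_prod, indepLaw, Measure.infinitePi_pi _ fun i _ => hT i, measure_univ,
      one_mul]

lemma integral_update_indepLaw (P : Measure (ℕ → ℝ)) [IsProbabilityMeasure P] (t : ℕ)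
    {φ : (ℕ → ℝ) → ℝ} (hφ : Measurable φ) {M : ℝ} (hb : ∀ x, |φ x| ≤ M) :
    ∫ z, ∫ y, φ (Function.update y t (z t)) ∂indepLaw P ∂P = ∫ y, φ y ∂indepLaw P := by
  conv_rhs => rw [← map_update_indepLaw P t]
  rw [integral_map (measurable_update_coord t).aemeasurable hφ.aestronglyMeasurable,
    integral_prod]
  exact integrable_of_abs_le (hφ.comp (measurable_update_coord t)) fun x => hb _

lemma measurable_piecewise_path (A : Finset ℕ) :
    Measurable fun p : (ℕ → ℝ) × (ℕ → ℝ) => A.piecewise p.2 p.1 := by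
  refine measurable_pi_lambda _ fun i => ?_
  by_cases hi : i ∈ A
  · simp only [hi, Finset.piecewise_eq_of_mem]; fun_prop
  · simp only [hi, not_false_eq_true, Finset.piecewise_eq_of_notMem]; fun_prop

lemma Decoupled.resample_finset {P : Measure (ℕ → ℝ)} [IsProbabilityMeasure P] {m : ℕ} {δ : ℝ}
    (hm : 1 ≤ m) (hδ : 0 ≤ δ) (h : Decoupled P m δ) {I : Set ℕ} (hI : ∀ s ∈ I, 1 ≤ s)
    {φ : (ℕ → ℝ) → ℝ} (hφ : Measurable φ) {M : ℝ} (hb : ∀ x, |φ x| ≤ M) (hdep : DependsOn φ I)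
    (A : Finset ℕ) (hA : ∀ t ∈ A, t ∈ I ∧ ∀ s ∈ I, s ≠ t → s + m ≤ t ∨ t + m ≤ s) :
    |∫ x, φ x ∂P - ∫ x, ∫ y, φ (A.piecewise y x) ∂indepLaw P ∂P| ≤ 3 * A.card * M * δ := by
  induction A using Finset.induction_on with
  | empty => simp
  | insert t A htA ih =>
    have ih := ih fun s hs => hA s (Finset.mem_insert_of_mem hs)
    obtain ⟨htI, hiso⟩ := hA t (Finset.mem_insert_self _ _)
    have mφ' : Measurable fun x => ∫ y, φ (A.piecewise y x) ∂indepLaw P :=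
      measurable_integral_right (F := fun x y : ℕ → ℝ => φ (A.piecewise y x))
        (hφ.comp (measurable_piecewise_path A))
    have h1 := h.resample hm hδ hI htI hiso mφ' (fun x => abs_integral_le_of_abs_le fun y => hb _)
      (fun x x' hx => by
        refine integral_congr_ae (.of_forall fun y => ?_)
        refine hdep fun i hi => ?_
        by_cases hiA : i ∈ A
        · simp [hiA]
        · simp [hiA, hx i hi])
    have e : ∀ x, ∫ z, ∫ y, φ (A.piecewise y (Function.update x t (z t))) ∂indepLaw P ∂P =
        ∫ y, φ ((insert t A).piecewise y x) ∂indepLaw P := by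
      intro x
      rw [← integral_update_indepLaw P t (φ := fun y => φ ((insert t A).piecewise y x))
        (hφ.comp ((measurable_piecewise_path _).comp (measurable_const.prodMk measurable_id)))
        fun y => hb _]
      congr 1
      funext z
      congr 1
      funext y
      congr 1
      funext i
      by_cases hit : i = t
      · subst hit; simp [htA]
      · by_cases hiA : i ∈ A
        · simp [hiA, hit]
        · simp [hiA, hit]
    simp only [e] at h1
    rw [Finset.card_insert_of_notMem htA]
    push_cast
    rw [abs_le] at *
    constructor <;> linarith [ih.1, ih.2, h1.1, h1.2]

/-- The first-order projection of `F` on the coordinate `s`, under the independent law. -/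
def proj (P : Measure (ℕ → ℝ)) (F : (ℕ → ℝ) → ℝ) (s : ℕ) (x : ℕ → ℝ) : ℝ :=
  ∫ y, F (Function.update y s (x s)) ∂indepLaw P - ∫ y, F y ∂indepLaw P

/-- What remains of `F` after removing the mean and the first-order projections. -/
def projResid (P : Measure (ℕ → ℝ)) (F : (ℕ → ℝ) → ℝ) (J : Finset ℕ) (x : ℕ → ℝ) : ℝ :=
  F x - ∑ s ∈ J, proj P F s x - ∫ y, F y ∂indepLaw P

section Proj

variable {P : Measure (ℕ → ℝ)} {F : (ℕ → ℝ) → ℝ} {M : ℝ}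

lemma dependsOn_proj (P : Measure (ℕ → ℝ)) (F : (ℕ → ℝ) → ℝ) (s : ℕ) :
    DependsOn (proj P F s) {s} := by
  intro x y hxy
  simp only [proj, hxy s rfl]

lemma dependsOn_projResid {J : Finset ℕ} (hdep : DependsOn F J) :
    DependsOn (projResid P F J) J := by
  intro x y hxy
  unfold projResid
  rw [hdep hxy, Finset.sum_congr rfl fun s hs => dependsOn_proj P F s (x := x) (y := y)
    (fun i hi => by rw [Set.mem_singleton_iff.1 hi]; exact hxy s hs)]

variable [IsProbabilityMeasure P]

lemma measurable_proj (hF : Measurable F) (s : ℕ) : Measurable (proj P F s) :=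
  (measurable_integral_right (F := fun x y : ℕ → ℝ => F (Function.update y s (x s)))
    (hF.comp (measurable_update_coord s))).sub measurable_const

lemma abs_proj_le (hb : ∀ x, |F x| ≤ M) (s : ℕ) (x : ℕ → ℝ) : |proj P F s x| ≤ 2 * M := by
  have h1 : |∫ y, F (Function.update y s (x s)) ∂indepLaw P| ≤ M :=
    abs_integral_le_of_abs_le fun y => hb _
  have h2 : |∫ y, F y ∂indepLaw P| ≤ M := abs_integral_le_of_abs_le fun y => hb _
  have := abs_sub (∫ y, F (Function.update y s (x s)) ∂indepLaw P) (∫ y, F y ∂indepLaw P)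
  unfold proj
  linarith

lemma integral_proj (hF : Measurable F) (hb : ∀ x, |F x| ≤ M) (s : ℕ) :
    ∫ x, proj P F s x ∂P = 0 := by
  have hm : Measurable fun x : ℕ → ℝ => ∫ y, F (Function.update y s (x s)) ∂indepLaw P :=
    measurable_integral_right (F := fun x y : ℕ → ℝ => F (Function.update y s (x s)))
      (hF.comp (measurable_update_coord s))
  unfold proj
  rw [integral_sub (integrable_of_abs_le hm fun x => abs_integral_le_of_abs_le fun y => hb _)
    (integrable_const _), integral_update_indepLaw P s hF hb]
  simp

lemma integral_proj_indepLaw (hF : Measurable F) (hb : ∀ x, |F x| ≤ M) (s : ℕ) :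
    ∫ x, proj P F s x ∂indepLaw P = 0 := by
  have h := measurable_proj (P := P) hF s
  have e : ∀ x : ℕ → ℝ, proj P F s x = (fun u : ℝ => proj P F s fun _ => u) (x s) := fun x =>
    dependsOn_proj P F s (by simp)
  have hm : Measurable (fun u : ℝ => proj P F s fun _ => u) :=
    h.comp (measurable_pi_lambda _ fun _ => measurable_id)
  rw [integral_congr_ae (.of_forall e), integral_coord_indepLaw P s hm,
    ← integral_congr_ae (.of_forall e), integral_proj hF hb]

lemma measurable_projResid (hF : Measurable F) (J : Finset ℕ) : Measurable (projResid P F J) :=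
  (hF.sub (Finset.measurable_fun_sum J fun s _ => measurable_proj hF s)).sub measurable_const

lemma abs_projResid_le (hb : ∀ x, |F x| ≤ M) (J : Finset ℕ) (x : ℕ → ℝ) :
    |projResid P F J x| ≤ 2 * M * (J.card + 1) := by
  have h2 : |∫ y, F y ∂indepLaw P| ≤ M := abs_integral_le_of_abs_le fun y => hb _
  have h3 : |∑ s ∈ J, proj P F s x| ≤ J.card * (2 * M) :=
    (Finset.abs_sum_le_sum_abs _ _).trans (by
      simpa using Finset.sum_le_card_nsmul J _ _ fun s _ => abs_proj_le (P := P) hb s x)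
  have h1 := hb x
  unfold projResid
  rw [abs_le] at *
  constructor <;> linarith [h1.1, h1.2, h2.1, h2.2, h3.1, h3.2]

lemma integral_projResid_piecewise (hF : Measurable F) (hb : ∀ x, |F x| ≤ M) {J A : Finset ℕ}
    (hdep : DependsOn F J) (hAJ : A ⊆ J) (hcard : (J \ A).card ≤ 1) (x : ℕ → ℝ) :
    ∫ y, projResid P F J (A.piecewise y x) ∂indepLaw P = 0 := by
  have mpw : Measurable fun y : ℕ → ℝ => A.piecewise y x :=
    (measurable_piecewise_path A).comp (measurable_const.prodMk measurable_id)
  have ip : ∀ s, Integrable (fun y => proj P F s (A.piecewise y x)) (indepLaw P) := fun s =>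
    integrable_of_abs_le ((measurable_proj hF s).comp mpw) fun y => abs_proj_le hb _ _
  have iF : Integrable (fun y => F (A.piecewise y x)) (indepLaw P) :=
    integrable_of_abs_le (hF.comp mpw) fun y => hb _
  have hin : ∀ s ∈ A, ∫ y, proj P F s (A.piecewise y x) ∂indepLaw P = 0 := by
    intro s hs
    rw [← integral_proj_indepLaw (P := P) hF hb s]
    congr 1
    funext y
    exact dependsOn_proj P F s (by simp [hs])
  have hout : ∀ s ∉ A, ∫ y, proj P F s (A.piecewise y x) ∂indepLaw P = proj P F s x := by
    intro s hs
    have : ∀ y, proj P F s (A.piecewise y x) = proj P F s x := fun y =>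
      dependsOn_proj P F s (by simp [hs])
    simp [this]
  unfold projResid
  have iS : Integrable (fun y => ∑ s ∈ J, proj P F s (A.piecewise y x)) (indepLaw P) :=
    integrable_finsetSum _ fun s _ => ip s
  have iFS : Integrable (fun y => F (A.piecewise y x) - ∑ s ∈ J, proj P F s (A.piecewise y x))
      (indepLaw P) := iF.sub iS
  rw [integral_sub iFS (integrable_const _), integral_sub iF iS, integral_finsetSum _ fun s _ => ip s, ← Finset.sum_sdiff hAJ,
    Finset.sum_eq_zero hin, Finset.sum_congr rfl fun s hs => hout s (Finset.mem_sdiff.1 hs).2]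
  simp only [integral_const, probReal_univ, smul_eq_mul, one_mul, add_zero]
  rcases Nat.le_one_iff_eq_zero_or_eq_one.1 hcard with h0 | h1
  · rw [Finset.card_eq_zero] at h0
    have : ∀ y, F (A.piecewise y x) = F y := fun y => hdep fun i hi => by
      have : i ∈ A := Finset.sdiff_eq_empty_iff_subset.1 h0 hi
      simp [this]
    simp [h0, this]
  · obtain ⟨s, hs⟩ := Finset.card_eq_one.1 h1
    have hsA : s ∉ A := (Finset.mem_sdiff.1 (hs ▸ Finset.mem_singleton_self s)).2
    have : ∀ y, F (A.piecewise y x) = F (Function.update y s (x s)) := fun y => hdep fun i hi => by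
      by_cases his : i = s
      · subst his; simp [hsA]
      · have : i ∈ A := by
          by_contra hiA
          have : i ∈ J \ A := Finset.mem_sdiff.2 ⟨hi, hiA⟩
          rw [hs] at this
          exact his (Finset.mem_singleton.1 this)
        simp [this, his]
    simp only [hs, this, Finset.sum_singleton, proj]
    ring

/-- Testing a residual against a function which does not see the isolated coordinates `A`. -/
lemma Decoupled.abs_integral_mul_projResid_le {m : ℕ} {δ : ℝ} (hm : 1 ≤ m) (hδ : 0 ≤ δ)
    (h : Decoupled P m δ) (hF : Measurable F) (hb : ∀ x, |F x| ≤ M) {J A I : Finset ℕ}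
    (hI : ∀ s ∈ I ∪ J, 1 ≤ s) (hdep : DependsOn F J) (hAJ : A ⊆ J) (hcard : (J \ A).card ≤ 1)
    (hA : ∀ t ∈ A, t ∉ I ∧ ∀ s ∈ I ∪ J, s ≠ t → s + m ≤ t ∨ t + m ≤ s)
    {ψ : (ℕ → ℝ) → ℝ} (hψ : Measurable ψ) {K : ℝ} (hK : ∀ x, |ψ x| ≤ K) (hψd : DependsOn ψ I) :
    |∫ x, ψ x * projResid P F J x ∂P| ≤ 3 * A.card * (K * (2 * M * (J.card + 1))) * δ := by
  have hK0 : 0 ≤ K := (abs_nonneg _).trans (hK 0)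
  have := h.resample_finset hm hδ (I := (I ∪ J : Finset ℕ)) (fun s hs => hI s hs)
    (φ := fun x => ψ x * projResid P F J x) (hψ.mul (measurable_projResid hF J))
    (M := K * (2 * M * (J.card + 1)))
    (fun x => by
      rw [abs_mul]
      exact mul_le_mul (hK x) (abs_projResid_le hb J x) (abs_nonneg _) hK0)
    (fun x y hxy => by
      simp only [hψd fun i hi => hxy i (Finset.mem_coe.2 (Finset.mem_union_left _ hi)),
        dependsOn_projResid hdep fun i hi => hxy i (Finset.mem_coe.2 (Finset.mem_union_right _ hi))])
    A (fun t ht => ⟨Finset.mem_coe.2 (Finset.mem_union_right _ (hAJ ht)),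
      fun s hs => (hA t ht).2 s hs⟩)
  have e : ∀ x y : ℕ → ℝ, ψ (A.piecewise y x) = ψ x := fun x y => hψd fun i hi => by
    have : i ∉ A := fun hiA => (hA i hiA).1 hi
    simp [this]
  simpa only [e, integral_const_mul, integral_projResid_piecewise hF hb hdep hAJ hcard, mul_zero,
    integral_zero, sub_zero] using this

end Proj

open Classical in
/-- Ore's bound on dominating sets of a graph without isolated vertices. -/
lemma exists_dominating_two_mul_card_le {α : Type*} (A : Finset α)
    (N : α → α → Prop) (hsymm : ∀ a b, N a b → N b a)
    (h : ∀ a ∈ A, ∃ b ∈ A, b ≠ a ∧ N a b) :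
    ∃ D ⊆ A, 2 * D.card ≤ A.card ∧ ∀ a ∈ A, a ∈ D ∨ ∃ d ∈ D, N a d := by
  let dom : Finset α → Prop := fun D => ∀ a ∈ A, a ∈ D ∨ ∃ d ∈ D, N a d
  let S := A.powerset.filter dom
  have hS : S.Nonempty := ⟨A, Finset.mem_filter.2 ⟨by simp, fun a ha => Or.inl ha⟩⟩
  obtain ⟨D, hDS, hmin⟩ := Finset.exists_min_image S Finset.card hS
  obtain ⟨hDA, hD⟩ := Finset.mem_filter.1 hDS
  rw [Finset.mem_powerset] at hDA
  by_cases hc : 2 * D.card ≤ A.card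
  · exact ⟨D, hDA, hc, hD⟩
  refine ⟨A \ D, Finset.sdiff_subset, ?_, fun a ha => ?_⟩
  · rw [Finset.card_sdiff_of_subset hDA]; omega
  by_cases haD : a ∈ D
  · by_contra hcon
    push Not at hcon
    have hnb : ∀ b ∈ A, N a b → b ∈ D := fun b hb hab => by
      by_contra hbD
      exact hcon.2 b (Finset.mem_sdiff.2 ⟨hb, hbD⟩) hab
    have hmem : D.erase a ∈ S := by
      refine Finset.mem_filter.2
        ⟨Finset.mem_powerset.2 ((Finset.erase_subset _ _).trans hDA), fun b hb => ?_⟩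
      by_cases hba : b = a
      · subst hba
        obtain ⟨c, hcA, hcb, hN⟩ := h b hb
        exact Or.inr ⟨c, Finset.mem_erase.2 ⟨hcb, hnb c hcA hN⟩, hN⟩
      · by_cases hbD : b ∈ D
        · exact Or.inl (Finset.mem_erase.2 ⟨hba, hbD⟩)
        · rcases hD b hb with h1 | ⟨d, hdD, hN⟩
          · exact absurd h1 hbD
          · refine Or.inr ⟨d, Finset.mem_erase.2 ⟨?_, hdD⟩, hN⟩
            rintro rfl
            exact hbD (hnb b hb (hsymm _ _ hN))
    have := hmin _ hmem
    have := Finset.card_erase_lt_of_mem haD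
    omega
  · exact Or.inl (Finset.mem_sdiff.2 ⟨ha, haD⟩)

/-- The index `q` is `m`-close to some other index. -/
def NearOther {α : Type*} (m : ℕ) (J : α → ℕ) (q : α) : Prop :=
  ∃ q', q' ≠ q ∧ J q < J q' + m ∧ J q' < J q + m

open Classical in
lemma exists_representatives {α : Type*} [Fintype α] [DecidableEq α] {m : ℕ} (hm : 1 ≤ m) (J : α → ℕ) :
    ∃ rep : α → α, 2 * (Finset.univ.image rep).card +
        (Finset.univ.filter (NearOther m J)).card ≤ 2 * Fintype.card α ∧
      ∀ q, J q < J (rep q) + m ∧ J (rep q) < J q + m := by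
  set A := Finset.univ.filter (NearOther m J) with hA
  obtain ⟨D, hDA, hc, hD⟩ := exists_dominating_two_mul_card_le A
    (fun q q' => J q < J q' + m ∧ J q' < J q + m) (fun a b h => ⟨h.2, h.1⟩) (by
      intro a ha
      obtain ⟨b, hba, h1, h2⟩ := (Finset.mem_filter.1 ha).2
      exact ⟨b, Finset.mem_filter.2 ⟨Finset.mem_univ _, a, hba.symm, h2, h1⟩, hba, h1, h2⟩)
  have hex : ∀ q, ∃ q' ∈ (Finset.univ \ A) ∪ D, J q < J q' + m ∧ J q' < J q + m := by
    intro q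
    by_cases hq : q ∈ A
    · rcases hD q hq with h1 | ⟨d, hd, h1⟩
      · exact ⟨q, Finset.mem_union_right _ h1, by omega, by omega⟩
      · exact ⟨d, Finset.mem_union_right _ hd, h1⟩
    · exact ⟨q, Finset.mem_union_left _ (Finset.mem_sdiff.2 ⟨Finset.mem_univ _, hq⟩),
        by omega, by omega⟩
  choose rep hrep hclose using hex
  refine ⟨rep, ?_, hclose⟩
  have h1 : (Finset.univ.image rep).card ≤ ((Finset.univ \ A) ∪ D).card :=
    Finset.card_le_card (Finset.image_subset_iff.2 fun q _ => hrep q)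
  have h2 := Finset.card_union_le (Finset.univ \ A) D
  have h3 := Finset.card_sdiff_of_subset (Finset.subset_univ A)
  have h4 := Finset.card_le_card (Finset.subset_univ A)
  rw [Finset.card_univ] at h3 h4
  omega

open Classical in
lemma card_families_of_rep {α : Type*} [Fintype α] [DecidableEq α] (m n : ℕ) (rep : α → α) :
    ((Fintype.piFinset fun _ : α => Finset.Icc 1 n).filter fun J =>
      ∀ q, J q < J (rep q) + m ∧ J (rep q) < J q + m).card ≤
    n ^ (Finset.univ.image rep).card * (2 * m) ^ Fintype.card α := by
  have := Finset.card_le_card_of_injOn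
    (s := (Fintype.piFinset fun _ : α => Finset.Icc 1 n).filter fun J =>
      ∀ q, J q < J (rep q) + m ∧ J (rep q) < J q + m)
    (t := (Fintype.piFinset fun _ : (Finset.univ.image rep : Finset α) => Finset.Icc 1 n) ×ˢ
      (Fintype.piFinset fun _ : α => Finset.range (2 * m)))
    (fun J => (fun d => J d, fun q => J q + m - J (rep q)))
    (fun J hJ => by
      obtain ⟨h1, h2⟩ := Finset.mem_filter.1 (Finset.mem_coe.1 hJ)
      rw [Fintype.mem_piFinset] at h1
      rw [Finset.mem_coe, Finset.mem_product, Fintype.mem_piFinset, Fintype.mem_piFinset]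
      refine ⟨fun d => h1 _, fun q => Finset.mem_range.2 ?_⟩
      have := h2 q
      dsimp only
      omega)
    (fun J hJ J' hJ' he => by
      obtain ⟨h1, h2⟩ := Finset.mem_filter.1 (Finset.mem_coe.1 hJ)
      obtain ⟨h1', h2'⟩ := Finset.mem_filter.1 (Finset.mem_coe.1 hJ')
      simp only [Prod.mk.injEq] at he
      funext q
      have e1 : J (rep q) = J' (rep q) :=
        congrFun he.1 ⟨rep q, Finset.mem_image_of_mem _ (Finset.mem_univ _)⟩
      have e2 := congrFun he.2 q
      have := h2 q
      have := h2' q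
      omega)
  simpa [Fintype.card_piFinset] using this

open Classical in
lemma card_families_nearOther_le {α : Type*} [Fintype α] [DecidableEq α] {m n c : ℕ} (hm : 1 ≤ m) (hn : 1 ≤ n)
    (hc : c ≤ Fintype.card α) :
    ((Fintype.piFinset fun _ : α => Finset.Icc 1 n).filter fun J =>
      2 * c ≤ (Finset.univ.filter (NearOther m J)).card).card ≤
    Fintype.card α ^ Fintype.card α *
      (n ^ (Fintype.card α - c) * (2 * m) ^ Fintype.card α) := by
  set T := (Finset.univ : Finset (α → α)).filter fun rep =>
    (Finset.univ.image rep).card ≤ Fintype.card α - c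
  have hsub : ((Fintype.piFinset fun _ : α => Finset.Icc 1 n).filter fun J =>
      2 * c ≤ (Finset.univ.filter (NearOther m J)).card) ⊆ T.biUnion fun rep =>
      (Fintype.piFinset fun _ : α => Finset.Icc 1 n).filter fun J =>
      ∀ q, J q < J (rep q) + m ∧ J (rep q) < J q + m := by
    intro J hJ
    obtain ⟨h1, h2⟩ := Finset.mem_filter.1 hJ
    obtain ⟨rep, h3, h4⟩ := exists_representatives hm J
    exact Finset.mem_biUnion.2 ⟨rep, Finset.mem_filter.2 ⟨Finset.mem_univ _, by omega⟩,
      Finset.mem_filter.2 ⟨h1, h4⟩⟩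
  refine (Finset.card_le_card hsub).trans (Finset.card_biUnion_le.trans ?_)
  refine (Finset.sum_le_card_nsmul T _ (n ^ (Fintype.card α - c) * (2 * m) ^ Fintype.card α)
    fun rep hrep => (card_families_of_rep m n rep).trans ?_).trans ?_
  · have := (Finset.mem_filter.1 hrep).2
    gcongr
  · rw [smul_eq_mul]
    gcongr
    exact (Finset.card_le_univ T).trans (by simp)

/-- Bound on the moments of the sum of all second-order residuals. -/
lemma Decoupled.abs_integral_pow_sum_projResid_le {P : Measure (ℕ → ℝ)} [IsProbabilityMeasure P]
    {m : ℕ} {δ : ℝ} (hm : 1 ≤ m) (hδ : 0 ≤ δ) (h : Decoupled P m δ) {r n : ℕ} (hr : 1 ≤ r)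
    (hn : 1 ≤ n) {F : (Fin r → ℕ) → (ℕ → ℝ) → ℝ} (hF : ∀ j, Measurable (F j)) {M : ℝ}
    (hb : ∀ j x, |F j x| ≤ M) (hdep : ∀ j, DependsOn (F j) (Finset.univ.image j : Finset ℕ))
    (p : ℕ) :
    |∫ x, (∑ j ∈ Fintype.piFinset (fun _ : Fin r => Finset.Icc 1 n),
        projResid P (F j) (Finset.univ.image j) x) ^ p ∂P| ≤
      (2 * M * (r + 1)) ^ p * ((p * r : ℕ) ^ (p * r) * (n ^ (p * r - p) * (2 * m) ^ (p * r)) +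
        n ^ (p * r) * (3 * r * δ)) := by
  classical
  have hM : 0 ≤ M := (abs_nonneg _).trans (hb 0 0)
  set M' := 2 * M * ((r : ℝ) + 1) with hM'
  have hM'0 : 0 ≤ M' := by positivity
  set ρ : (Fin r → ℕ) → (ℕ → ℝ) → ℝ := fun j => projResid P (F j) (Finset.univ.image j) with hρ
  have hcard : ∀ j : Fin r → ℕ, (Finset.univ.image j).card ≤ r := fun j =>
    Finset.card_image_le.trans (by simp)
  have hcard' : ∀ j : Fin r → ℕ, ((Finset.univ.image j).card : ℝ) ≤ r := fun j => by
    exact_mod_cast hcard j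
  have hρm : ∀ j, Measurable (ρ j) := fun j => measurable_projResid (hF j) _
  have hρb : ∀ j x, |ρ j x| ≤ M' := fun j x =>
    (abs_projResid_le (hb j) _ x).trans (by rw [hM']; gcongr; exact hcard j)
  have hρd : ∀ j, DependsOn (ρ j) (Finset.univ.image j : Finset ℕ) := fun j =>
    dependsOn_projResid (hdep j)
  set U := Fintype.piFinset fun _ : Fin r => Finset.Icc 1 n with hU
  have hprodb : ∀ (s : Finset (Fin p)) (J : Fin p → Fin r → ℕ) x,
      |∏ i ∈ s, ρ (J i) x| ≤ M' ^ s.card := fun s J x => by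
    rw [Finset.abs_prod]
    refine (Finset.prod_le_prod (fun i _ => abs_nonneg _) fun i _ => hρb _ _).trans ?_
    simp
  have hprodm : ∀ (s : Finset (Fin p)) (J : Fin p → Fin r → ℕ),
      Measurable fun x => ∏ i ∈ s, ρ (J i) x := fun s J =>
    Finset.measurable_fun_prod s fun i _ => hρm _
  have hexp : ∀ x, (∑ j ∈ U, ρ j x) ^ p =
      ∑ J ∈ Fintype.piFinset fun _ : Fin p => U, ∏ i, ρ (J i) x := by
    intro x
    have := Finset.prod_univ_sum (fun _ : Fin p => U) (fun _ j => ρ j x)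
    simpa using this
  have hterm : ∀ J : Fin p → Fin r → ℕ, |∫ x, ∏ i, ρ (J i) x ∂P| ≤ M' ^ p := fun J =>
    abs_integral_le_of_abs_le fun x => by simpa using hprodb Finset.univ J x
  set bad : (Fin p → Fin r → ℕ) → Prop := fun J =>
    2 * p ≤ (Finset.univ.filter (NearOther m fun q : Fin p × Fin r => J q.1 q.2)).card with hbad
  have hgood : ∀ J ∈ Fintype.piFinset (fun _ : Fin p => U), ¬ bad J →
      |∫ x, ∏ i, ρ (J i) x ∂P| ≤ M' ^ p * (3 * r * δ) := by
    intro J hJ hbadJ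
    have hJ1 : ∀ i k, 1 ≤ J i k := fun i k => by
      have := Fintype.mem_piFinset.1 (Fintype.mem_piFinset.1 hJ i) k
      exact (Finset.mem_Icc.1 this).1
    have : ∃ i, (Finset.univ.filter fun k =>
        NearOther m (fun q : Fin p × Fin r => J q.1 q.2) (i, k)).card ≤ 1 := by
      by_contra hcon
      push Not at hcon
      apply hbadJ
      change 2 * p ≤ _
      rw [Finset.card_eq_sum_card_fiberwise (f := Prod.fst) (t := Finset.univ)
        (fun _ _ => Finset.mem_univ _)]
      have : ∀ i ∈ (Finset.univ : Finset (Fin p)), 2 ≤ ((Finset.univ.filter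
          (NearOther m fun q : Fin p × Fin r => J q.1 q.2)).filter fun q => q.1 = i).card := by
        intro i _
        refine Nat.le_trans (hcon i) (Finset.card_le_card_of_injOn (fun k => (i, k)) ?_ ?_)
        · intro k hk
          simpa using hk
        · intro k _ k' _ hkk
          simpa using hkk
      have := Finset.card_nsmul_le_sum _ _ _ this
      simpa [mul_comm] using this
    obtain ⟨i, hi⟩ := this
    set NI := Finset.univ.filter fun k => ¬ NearOther m (fun q : Fin p × Fin r => J q.1 q.2) (i, k)
    set A := NI.image (J i) with hA
    set I := (Finset.univ.erase i).biUnion fun i' => Finset.univ.image (J i') with hI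
    have hAJ : A ⊆ Finset.univ.image (J i) := Finset.image_subset_image (Finset.subset_univ _)
    have hAc : (Finset.univ.image (J i) \ A).card ≤ 1 := by
      refine le_trans ?_ hi
      refine le_trans (Finset.card_le_card ?_) (Finset.card_image_le (f := J i))
      intro s hs
      obtain ⟨h1, h2⟩ := Finset.mem_sdiff.1 hs
      obtain ⟨k, _, rfl⟩ := Finset.mem_image.1 h1
      refine Finset.mem_image_of_mem _ (Finset.mem_filter.2 ⟨Finset.mem_univ _, ?_⟩)
      by_contra hk
      exact h2 (Finset.mem_image_of_mem _ (Finset.mem_filter.2 ⟨Finset.mem_univ _, hk⟩))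
    have hfar : ∀ k ∈ NI, ∀ i' k', (i', k') ≠ (i, k) →
        J i' k' + m ≤ J i k ∨ J i k + m ≤ J i' k' := by
      intro k hk i' k' hne
      have := (Finset.mem_filter.1 hk).2
      unfold NearOther at this
      push Not at this
      have := this (i', k') hne
      dsimp only at this
      omega
    have key := h.abs_integral_mul_projResid_le hm hδ (hF (J i)) (hb (J i)) (J := Finset.univ.image (J i))
      (A := A) (I := I) (fun s hs => by
        rcases Finset.mem_union.1 hs with h1 | h1
        · obtain ⟨i', _, h2⟩ := Finset.mem_biUnion.1 h1
          obtain ⟨k, _, rfl⟩ := Finset.mem_image.1 h2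
          exact hJ1 _ _
        · obtain ⟨k, _, rfl⟩ := Finset.mem_image.1 h1
          exact hJ1 _ _) (hdep (J i)) hAJ hAc
      (fun t ht => by
        obtain ⟨k, hk, rfl⟩ := Finset.mem_image.1 ht
        constructor
        · intro h1
          obtain ⟨i', hi', h2⟩ := Finset.mem_biUnion.1 h1
          obtain ⟨k', _, h3⟩ := Finset.mem_image.1 h2
          have := hfar k hk i' k' (fun he => (Finset.mem_erase.1 hi').1 (Prod.mk.inj he).1)
          omega
        · intro s hs hne
          rcases Finset.mem_union.1 hs with h1 | h1
          · obtain ⟨i', hi', h2⟩ := Finset.mem_biUnion.1 h1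
            obtain ⟨k', _, rfl⟩ := Finset.mem_image.1 h2
            exact hfar k hk i' k' (fun he => (Finset.mem_erase.1 hi').1 (Prod.mk.inj he).1)
          · obtain ⟨k', _, rfl⟩ := Finset.mem_image.1 h1
            exact hfar k hk i k' (fun he => hne (by rw [(Prod.mk.inj he).2])))
      (hprodm (Finset.univ.erase i) J) (hprodb (Finset.univ.erase i) J)
      (fun x y hxy => Finset.prod_congr rfl fun i' hi' => hρd (J i') fun s hs =>
        hxy s (Finset.mem_coe.2 (Finset.mem_biUnion.2 ⟨i', hi', hs⟩)))
    have e : ∀ x, (∏ i' ∈ Finset.univ.erase i, ρ (J i') x) *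
        projResid P (F (J i)) (Finset.univ.image (J i)) x = ∏ i, ρ (J i) x := fun x =>
      Finset.prod_erase_mul _ _ (Finset.mem_univ i)
    simp only [e] at key
    refine key.trans ?_
    have hp : M' ^ p = M' ^ (Finset.univ.erase i).card * M' := by
      rw [← pow_succ, Finset.card_erase_of_mem (Finset.mem_univ i)]
      congr 1
      have := i.pos
      simp
      omega
    have hAr : (A.card : ℝ) ≤ r :=
      (Nat.cast_le.2 (Finset.card_le_card hAJ)).trans (hcard' _)
    have h1 : M' ^ (Finset.univ.erase i).card * (2 * M * ((Finset.univ.image (J i)).card + 1)) ≤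
        M' ^ p := by
      rw [hp, hM']
      gcongr
      exact hcard _
    calc 3 * (A.card : ℝ) * (M' ^ (Finset.univ.erase i).card *
          (2 * M * ((Finset.univ.image (J i)).card + 1))) * δ ≤ 3 * r * M' ^ p * δ := by
          gcongr
      _ = _ := by ring
  have hcount : (((Fintype.piFinset fun _ : Fin p => U).filter bad).card : ℝ) ≤
      (p * r : ℕ) ^ (p * r) * (n ^ (p * r - p) * (2 * m) ^ (p * r)) := by
    have h1 := card_families_nearOther_le (α := Fin p × Fin r) (c := p) hm hn
      (by simpa using Nat.le_mul_of_pos_right p hr)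
    rw [Fintype.card_prod, Fintype.card_fin, Fintype.card_fin] at h1
    have h2 : ((Fintype.piFinset fun _ : Fin p => U).filter bad).card ≤
        (p * r) ^ (p * r) * (n ^ (p * r - p) * (2 * m) ^ (p * r)) := by
      refine le_trans (Finset.card_le_card_of_injOn (fun J q => J q.1 q.2) ?_ ?_) h1
      · intro J hJ
        obtain ⟨h3, h4⟩ := Finset.mem_filter.1 (Finset.mem_coe.1 hJ)
        refine Finset.mem_coe.2 (Finset.mem_filter.2 ⟨Fintype.mem_piFinset.2 fun q => ?_, h4⟩)
        exact Fintype.mem_piFinset.1 (Fintype.mem_piFinset.1 h3 q.1) q.2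
      · intro J _ J' _ he
        funext i k
        exact congrFun he (i, k)
    exact_mod_cast h2
  have hcount' : ((Fintype.piFinset fun _ : Fin p => U).card : ℝ) = n ^ (p * r) := by
    rw [hU, Fintype.card_piFinset_const, Fintype.card_piFinset_const,
      Nat.card_Icc, Nat.add_sub_cancel, ← pow_mul, mul_comm r p, Nat.cast_pow]
  have hint : ∀ J : Fin p → Fin r → ℕ, Integrable (fun x => ∏ i, ρ (J i) x) P := fun J =>
    integrable_of_abs_le (hprodm _ J) (hprodb _ J)
  change |∫ x, (∑ j ∈ U, ρ j x) ^ p ∂P| ≤ _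
  simp only [hexp]
  rw [integral_finsetSum _ fun J _ => hint J]
  refine (Finset.abs_sum_le_sum_abs _ _).trans ?_
  rw [← Finset.sum_filter_add_sum_filter_not _ bad, mul_add]
  refine add_le_add ?_ ?_
  · refine (Finset.sum_le_card_nsmul _ _ _ fun J _ => hterm J).trans ?_
    rw [nsmul_eq_mul, mul_comm]
    gcongr
  · refine (Finset.sum_le_card_nsmul _ _ _ fun J hJ =>
      hgood J (Finset.mem_filter.1 hJ).1 (Finset.mem_filter.1 hJ).2).trans ?_
    rw [nsmul_eq_mul, ← hcount', mul_comm, mul_assoc, mul_comm (3 * (r : ℝ) * δ)]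
    gcongr
    exact Finset.filter_subset _ _

/-- A sequence of bounded centred functions of single coordinates on a decoupled path space. -/
structure CoordSystem (P : Measure (ℕ → ℝ)) (m : ℕ) (δ b : ℝ) (Y : ℕ → (ℕ → ℝ) → ℝ) : Prop where
  one_le : 1 ≤ m
  nonneg : 0 ≤ δ
  decoupled : Decoupled P m δ
  measurable : ∀ t, Measurable (Y t)
  dependsOn : ∀ t, DependsOn (Y t) {t}
  bound : ∀ t x, |Y t x| ≤ b
  integral_eq : ∀ t, ∫ x, Y t x ∂P = 0

/-- The sum of `Y t` over `a < t ≤ c`. -/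
def blockSum (Y : ℕ → (ℕ → ℝ) → ℝ) (a c : ℕ) (x : ℕ → ℝ) : ℝ := ∑ t ∈ Finset.Ioc a c, Y t x

/-- The second moment of `blockSum Y a c`. -/
def blockVar (P : Measure (ℕ → ℝ)) (Y : ℕ → (ℕ → ℝ) → ℝ) (a c : ℕ) : ℝ :=
  ∫ x, blockSum Y a c x ^ 2 ∂P

lemma blockSum_of_le (Y : ℕ → (ℕ → ℝ) → ℝ) {a c : ℕ} (h : c ≤ a) (x : ℕ → ℝ) :
    blockSum Y a c x = 0 := by
  simp [blockSum, Finset.Ioc_eq_empty_of_le h]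

lemma blockSum_add (Y : ℕ → (ℕ → ℝ) → ℝ) {a c e : ℕ} (h₁ : a ≤ c) (h₂ : c ≤ e) (x : ℕ → ℝ) :
    blockSum Y a e x = blockSum Y a c x + blockSum Y c e x :=
  (Finset.sum_Ioc_consecutive (fun t => Y t x) h₁ h₂).symm

lemma blockVar_nonneg (P : Measure (ℕ → ℝ)) (Y : ℕ → (ℕ → ℝ) → ℝ) (a c : ℕ) :
    0 ≤ blockVar P Y a c :=
  integral_nonneg fun _ => sq_nonneg _

lemma integral_abs_le_sqrt {P : Measure (ℕ → ℝ)} [IsProbabilityMeasure P] {S : (ℕ → ℝ) → ℝ}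
    (hS : Measurable S) {B : ℝ} (hb : ∀ x, |S x| ≤ B) :
    ∫ x, |S x| ∂P ≤ √(∫ x, S x ^ 2 ∂P) := by
  have hB : 0 ≤ B := (abs_nonneg _).trans (hb 0)
  have i1 : Integrable (fun x => |S x|) P :=
    integrable_of_abs_le (M := B) (by fun_prop) fun x => by rw [abs_abs]; exact hb x
  have i2 : Integrable (fun x => S x ^ 2) P :=
    integrable_of_abs_le (M := B ^ 2) (by fun_prop) fun x => by
      rw [abs_pow]; exact pow_le_pow_left₀ (abs_nonneg _) (hb x) 2
  set c := ∫ x, |S x| ∂P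
  refine Real.le_sqrt_of_sq_le ?_
  have h : 0 ≤ ∫ x, (|S x| - c) ^ 2 ∂P := integral_nonneg fun x => sq_nonneg _
  have e : ∀ x, (|S x| - c) ^ 2 = S x ^ 2 - 2 * c * |S x| + c ^ 2 := fun x => by
    rw [← sq_abs (S x)]; ring
  simp only [e] at h
  have i3 : Integrable (fun x => S x ^ 2 - 2 * c * |S x|) P := i2.sub (i1.const_mul _)
  rw [integral_add i3 (integrable_const _),
    integral_sub i2 (i1.const_mul _), integral_const_mul] at h
  simp only [integral_const, probReal_univ, smul_eq_mul, one_mul] at h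
  change 0 ≤ _ - 2 * c * c + c ^ 2 at h
  nlinarith

namespace CoordSystem

variable {P : Measure (ℕ → ℝ)} {m : ℕ} {δ b : ℝ} {Y : ℕ → (ℕ → ℝ) → ℝ}

lemma b_nonneg (h : CoordSystem P m δ b Y) : 0 ≤ b := (abs_nonneg _).trans (h.bound 0 0)

lemma measurable_blockSum (h : CoordSystem P m δ b Y) (a c : ℕ) : Measurable (blockSum Y a c) :=
  Finset.measurable_fun_sum _ fun t _ => h.measurable t

lemma dependsOn_blockSum (h : CoordSystem P m δ b Y) (a c : ℕ) :
    DependsOn (blockSum Y a c) (Set.Ioc a c) := fun x y hxy =>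
  Finset.sum_congr rfl fun t ht => h.dependsOn t fun i hi => by
    rw [Set.mem_singleton_iff.1 hi]
    exact hxy t (by simpa using ht)

lemma dependsOn_blockSum_left (h : CoordSystem P m δ b Y) {a c k : ℕ} (hck : c ≤ k) :
    DependsOn (blockSum Y a c) (Set.Icc 1 k) := fun _ _ hxy =>
  h.dependsOn_blockSum a c fun i hi => hxy i ⟨by have := hi.1; omega, hi.2.trans hck⟩

lemma dependsOn_blockSum_right (h : CoordSystem P m δ b Y) {a c k : ℕ} (hck : k ≤ a + 1) :
    DependsOn (blockSum Y a c) (Set.Ici k) := fun _ _ hxy =>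
  h.dependsOn_blockSum a c fun i hi => hxy i (Set.mem_Ici.2 (by have := hi.1; omega))

lemma abs_blockSum_le' (h : CoordSystem P m δ b Y) (a c : ℕ) (x : ℕ → ℝ) :
    |blockSum Y a c x| ≤ (c - a : ℕ) * b := by
  refine (Finset.abs_sum_le_sum_abs _ _).trans ?_
  simpa using Finset.sum_le_card_nsmul (Finset.Ioc a c) _ _ fun t _ => h.bound t x

lemma abs_blockSum_le (h : CoordSystem P m δ b Y) {a c k : ℕ} (hk : c ≤ a + k) (x : ℕ → ℝ) :
    |blockSum Y a c x| ≤ k * b := by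
  refine (h.abs_blockSum_le' a c x).trans ?_
  have := h.b_nonneg
  gcongr
  omega

lemma abs_blockSum_sub_le (h : CoordSystem P m δ b Y) (k c : ℕ) (x : ℕ → ℝ) :
    |blockSum Y k c x - blockSum Y (k + m) c x| ≤ m * b := by
  rcases le_total (k + m) c with h1 | h1
  · rw [blockSum_add Y (Nat.le_add_right k m) h1, add_sub_cancel_right]
    exact h.abs_blockSum_le le_rfl x
  · rw [blockSum_of_le Y h1, sub_zero]
    exact h.abs_blockSum_le h1 x

lemma integral_blockSum [IsProbabilityMeasure P] (h : CoordSystem P m δ b Y) (a c : ℕ) :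
    ∫ x, blockSum Y a c x ∂P = 0 := by
  unfold blockSum
  rw [integral_finsetSum _ fun t _ => integrable_of_abs_le (h.measurable t) (h.bound t)]
  exact Finset.sum_eq_zero fun t _ => h.integral_eq t

variable [IsProbabilityMeasure P]

lemma abs_integral_blockSum_mul_le (h : CoordSystem P m δ b Y) {a c c' e n : ℕ}
    (hc : c + m ≤ c' + 1) (hcn : c ≤ n) (hen : e ≤ n) :
    |∫ x, blockSum Y a c x * blockSum Y c' e x ∂P| ≤ (n * b) ^ 2 * δ := by
  have := h.decoupled.abs_integral_mul_sub_le h.one_le c (h.measurable_blockSum a c)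
    (h.measurable_blockSum c' e) (M₁ := n * b) (M₂ := n * b)
    (fun x => h.abs_blockSum_le (by omega) x) (fun x => h.abs_blockSum_le (by omega) x)
    (h.dependsOn_blockSum_left le_rfl) (h.dependsOn_blockSum_right hc)
  rw [h.integral_blockSum, zero_mul, sub_zero] at this
  rwa [sq]

lemma abs_integral_mul_small_le {S : (ℕ → ℝ) → ℝ} (hS : Measurable S) {B : ℝ}
    (hb : ∀ x, |S x| ≤ B) {R : (ℕ → ℝ) → ℝ} {K : ℝ}
    (hR : ∀ x, |R x| ≤ K) : |∫ x, S x * R x ∂P| ≤ √(∫ x, S x ^ 2 ∂P) * K := by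
  have hK : 0 ≤ K := (abs_nonneg _).trans (hR 0)
  have i1 : Integrable (fun x => |S x| * K) P :=
    (integrable_of_abs_le (M := B) (by fun_prop) fun x => by rw [abs_abs]; exact hb x).mul_const K
  refine (abs_integral_le_integral_abs).trans ?_
  calc ∫ x, |S x * R x| ∂P ≤ ∫ x, |S x| * K ∂P := by
        refine integral_mono_of_nonneg (.of_forall fun x => abs_nonneg _) i1 (.of_forall fun x => ?_)
        dsimp only
        rw [abs_mul]
        gcongr
        exact hR x
    _ = (∫ x, |S x| ∂P) * K := integral_mul_const _ _
    _ ≤ _ := by gcongr; exact integral_abs_le_sqrt hS hb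

lemma integrable_blockSum_mul (h : CoordSystem P m δ b Y) (a c a' c' : ℕ) :
    Integrable (fun x => blockSum Y a c x * blockSum Y a' c' x) P :=
  integrable_of_abs_le ((h.measurable_blockSum a c).mul (h.measurable_blockSum a' c'))
    (M := ((c - a : ℕ) * b) * ((c' - a' : ℕ) * b)) fun x => by
      rw [abs_mul]
      exact mul_le_mul (h.abs_blockSum_le' _ _ _) (h.abs_blockSum_le' _ _ _) (abs_nonneg _)
        (mul_nonneg (Nat.cast_nonneg _) h.b_nonneg)

lemma blockVar_add (h : CoordSystem P m δ b Y) {a c e : ℕ} (h₁ : a ≤ c) (h₂ : c ≤ e) :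
    blockVar P Y a e = blockVar P Y a c + blockVar P Y c e +
      2 * ∫ x, blockSum Y a c x * blockSum Y c e x ∂P := by
  have e1 : ∀ x, blockSum Y a e x ^ 2 = blockSum Y a c x * blockSum Y a c x +
      blockSum Y c e x * blockSum Y c e x + 2 * (blockSum Y a c x * blockSum Y c e x) := fun x => by
    rw [blockSum_add Y h₁ h₂]; ring
  unfold blockVar
  simp only [e1]
  have i1 : Integrable (fun x => blockSum Y a c x * blockSum Y a c x +
      blockSum Y c e x * blockSum Y c e x) P :=
    (h.integrable_blockSum_mul _ _ _ _).add (h.integrable_blockSum_mul _ _ _ _)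
  rw [integral_add i1 ((h.integrable_blockSum_mul _ _ _ _).const_mul 2),
    integral_add (h.integrable_blockSum_mul _ _ _ _) (h.integrable_blockSum_mul _ _ _ _),
    integral_const_mul]
  simp only [sq]

lemma abs_blockVar_sub_left (h : CoordSystem P m δ b Y) {a c e n : ℕ} (h₁ : a ≤ c) (h₂ : c ≤ e)
    (hn : e ≤ n) :
    |blockVar P Y a e - blockVar P Y a c - blockVar P Y c e| ≤
      2 * (√(blockVar P Y a c) * (m * b)) + 2 * ((n * b) ^ 2 * δ) := by
  rw [h.blockVar_add h₁ h₂]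
  have e1 : ∀ x, blockSum Y a c x * blockSum Y c e x =
      blockSum Y a c x * (blockSum Y c e x - blockSum Y (c + m) e x) +
      blockSum Y a c x * blockSum Y (c + m) e x := fun x => by ring
  have k1 := abs_integral_mul_small_le (P := P) (h.measurable_blockSum a c) (h.abs_blockSum_le' a c)
    (h.abs_blockSum_sub_le c e)
  have k2 := h.abs_integral_blockSum_mul_le (a := a) (c := c) (c' := c + m) (e := e) (n := n)
    (by omega) (by omega) hn
  have k3 : ∫ x, blockSum Y a c x * blockSum Y c e x ∂P =
      ∫ x, blockSum Y a c x * (blockSum Y c e x - blockSum Y (c + m) e x) ∂P +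
      ∫ x, blockSum Y a c x * blockSum Y (c + m) e x ∂P := by
    rw [← integral_add _ (h.integrable_blockSum_mul _ _ _ _)]
    · simp only [← e1]
    · simp only [mul_sub]
      exact (h.integrable_blockSum_mul _ _ _ _).sub (h.integrable_blockSum_mul _ _ _ _)
  have k4 := abs_add_le (∫ x, blockSum Y a c x * (blockSum Y c e x - blockSum Y (c + m) e x) ∂P)
    (∫ x, blockSum Y a c x * blockSum Y (c + m) e x ∂P)
  rw [← k3] at k4
  rw [show ∀ A B C : ℝ, A + B + 2 * C - A - B = 2 * C from fun A B C => by ring, abs_mul, abs_two]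
  unfold blockVar
  linarith

lemma abs_blockVar_sub_right (h : CoordSystem P m δ b Y) {a c e n : ℕ} (h₁ : a ≤ c) (h₂ : c ≤ e)
    (hn : e ≤ n) :
    |blockVar P Y a e - blockVar P Y a c - blockVar P Y c e| ≤
      2 * (√(blockVar P Y c e) * (m * b)) + 2 * ((n * b) ^ 2 * δ) := by
  rw [h.blockVar_add h₁ h₂]
  set c' := max a (c - m) with hc'
  have hac' : a ≤ c' := le_max_left _ _
  have hc'c : c' ≤ c := max_le h₁ (Nat.sub_le _ _)
  have k1 := abs_integral_mul_small_le (P := P) (h.measurable_blockSum c e) (h.abs_blockSum_le' c e)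
    (fun x => h.abs_blockSum_le (a := c') (c := c) (k := m) (by omega) x)
  have k2 : |∫ x, blockSum Y a c' x * blockSum Y c e x ∂P| ≤ (n * b) ^ 2 * δ := by
    by_cases hcm : a < c'
    · exact h.abs_integral_blockSum_mul_le (by omega) (by omega) hn
    · simp only [blockSum_of_le Y (not_lt.1 hcm), zero_mul, integral_zero, abs_zero]
      have := h.nonneg
      positivity
  have k3 : ∫ x, blockSum Y a c x * blockSum Y c e x ∂P =
      ∫ x, blockSum Y a c' x * blockSum Y c e x ∂P +
      ∫ x, blockSum Y c e x * blockSum Y c' c x ∂P := by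
    rw [← integral_add (h.integrable_blockSum_mul _ _ _ _) (h.integrable_blockSum_mul _ _ _ _)]
    congr 1
    funext x
    rw [blockSum_add Y hac' hc'c]
    ring
  have k4 := abs_add_le (∫ x, blockSum Y a c' x * blockSum Y c e x ∂P)
    (∫ x, blockSum Y c e x * blockSum Y c' c x ∂P)
  rw [← k3] at k4
  rw [show ∀ A B C : ℝ, A + B + 2 * C - A - B = 2 * C from fun A B C => by ring, abs_mul, abs_two]
  unfold blockVar
  linarith

lemma blockVar_le_of_subset (h : CoordSystem P m δ b Y) {a c e i n : ℕ} (h₁ : a ≤ i) (h₂ : i ≤ c)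
    (h₃ : c ≤ e) (hn : e ≤ n) :
    blockVar P Y i c ≤ blockVar P Y a e + 2 * ((m * b) ^ 2 + 2 * ((n * b) ^ 2 * δ)) := by
  have k1 := (abs_le.1 (h.abs_blockVar_sub_left h₁ (h₂.trans h₃) hn)).1
  have k2 := (abs_le.1 (h.abs_blockVar_sub_right h₂ h₃ hn)).1
  have s1 := Real.sq_sqrt (blockVar_nonneg P Y a i)
  have s2 := Real.sq_sqrt (blockVar_nonneg P Y c e)
  nlinarith [sq_nonneg (√(blockVar P Y a i) - m * b), sq_nonneg (√(blockVar P Y c e) - m * b)]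

end CoordSystem

lemma Decoupled.measureReal_inter_le {P : Measure (ℕ → ℝ)} [IsProbabilityMeasure P] {m : ℕ}
    {δ : ℝ} (hm : 1 ≤ m) (h : Decoupled P m δ) (t : ℕ) {E G : Set (ℕ → ℝ)}
    (hE : MeasurableSet E) (hG : MeasurableSet G)
    (hdE : DependsOn (fun x => x ∈ E) (Set.Icc 1 t))
    (hdG : DependsOn (fun x => x ∈ G) (Set.Ici (t + m))) :
    P.real (E ∩ G) ≤ P.real E * P.real G + δ := by
  have hb : ∀ (A : Set (ℕ → ℝ)) x, |A.indicator (fun _ => (1 : ℝ)) x| ≤ 1 := fun A x => by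
    by_cases hx : x ∈ A <;> simp [hx]
  have key := h.abs_integral_mul_sub_le hm t (ξ := E.indicator fun _ => 1)
    (η := G.indicator fun _ => 1) (measurable_const.indicator hE) (measurable_const.indicator hG)
    (hb E) (hb G)
    (fun x y hxy => by
      have : (x ∈ E) ↔ (y ∈ E) := iff_of_eq (hdE hxy)
      by_cases hx : x ∈ E
      · simp [hx, this.1 hx]
      · simp [hx, mt this.2 hx])
    (fun x y hxy => by
      have : (x ∈ G) ↔ (y ∈ G) := iff_of_eq (hdG hxy)
      by_cases hx : x ∈ G
      · simp [hx, this.1 hx]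
      · simp [hx, mt this.2 hx])
  have e : ∀ x, E.indicator (fun _ => (1 : ℝ)) x * G.indicator (fun _ => 1) x =
      (E ∩ G).indicator (fun _ => 1) x := fun x => by
    by_cases h1 : x ∈ E <;> by_cases h2 : x ∈ G <;> simp [h1, h2]
  simp only [e] at key
  rw [integral_indicator hE, integral_indicator hG, integral_indicator (hE.inter hG)] at key
  simp only [integral_const, measureReal_restrict_apply_univ, smul_eq_mul, mul_one, one_mul] at key
  linarith [(abs_le.1 key).2]

/-- The paths for which `|S a k|` exceeds `y` at `k`, and not before. -/
def firstPassage (Y : ℕ → (ℕ → ℝ) → ℝ) (a : ℕ) (y : ℝ) (k : ℕ) : Set (ℕ → ℝ) :=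
  {ω | y < |blockSum Y a k ω| ∧ ∀ i ∈ Finset.Ioo a k, |blockSum Y a i ω| ≤ y}

/-- The paths for which `|S a k|` exceeds `y` for some `a < k ≤ c`. -/
def maxExceeds (Y : ℕ → (ℕ → ℝ) → ℝ) (a c : ℕ) (y : ℝ) : Set (ℕ → ℝ) :=
  ⋃ k ∈ Finset.Ioc a c, firstPassage Y a y k

lemma mem_maxExceeds {Y : ℕ → (ℕ → ℝ) → ℝ} {a c k : ℕ} {y : ℝ} {ω : ℕ → ℝ}
    (hk : k ∈ Finset.Ioc a c) (h : y < |blockSum Y a k ω|) : ω ∈ maxExceeds Y a c y := by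
  classical
  have hex : ∃ k, k ∈ Finset.Ioc a c ∧ y < |blockSum Y a k ω| := ⟨k, hk, h⟩
  have h1 := Nat.find_spec hex
  refine Set.mem_biUnion (x := Nat.find hex) h1.1 ⟨h1.2, fun i hi => ?_⟩
  have hi := Finset.mem_Ioo.1 hi
  have h2 := Nat.find_min hex hi.2
  by_contra hcon
  exact h2 ⟨Finset.mem_Ioc.2 ⟨hi.1, hi.2.le.trans (Finset.mem_Ioc.1 h1.1).2⟩, not_le.1 hcon⟩

lemma disjoint_firstPassage (Y : ℕ → (ℕ → ℝ) → ℝ) (a c : ℕ) (y : ℝ) :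
    Set.PairwiseDisjoint (Finset.Ioc a c : Set ℕ) (firstPassage Y a y) := by
  have key : ∀ k ∈ Finset.Ioc a c, ∀ l ∈ Finset.Ioc a c, k < l →
      Disjoint (firstPassage Y a y k) (firstPassage Y a y l) := by
    intro k hk l hl hkl
    rw [Set.disjoint_left]
    intro ω h1 h2
    exact absurd (h2.2 k (Finset.mem_Ioo.2 ⟨(Finset.mem_Ioc.1 hk).1, hkl⟩)) (not_le.2 h1.1)
  intro k hk l hl hkl
  rcases lt_or_gt_of_ne hkl with h | h
  · exact key k hk l hl h
  · exact (key l hl k hk h).symm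

namespace CoordSystem

variable {P : Measure (ℕ → ℝ)} {m : ℕ} {δ b : ℝ} {Y : ℕ → (ℕ → ℝ) → ℝ}

lemma measurableSet_lt_abs_blockSum (h : CoordSystem P m δ b Y) (a k : ℕ) (y : ℝ) :
    MeasurableSet {ω | y < |blockSum Y a k ω|} :=
  measurableSet_lt measurable_const (h.measurable_blockSum a k).abs

lemma measurableSet_firstPassage (h : CoordSystem P m δ b Y) (a k : ℕ) (y : ℝ) :
    MeasurableSet (firstPassage Y a y k) := by
  have : firstPassage Y a y k = {ω | y < |blockSum Y a k ω|} ∩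
      ⋂ i ∈ Finset.Ioo a k, {ω | |blockSum Y a i ω| ≤ y} := by
    ext ω; simp [firstPassage]
  rw [this]
  exact (h.measurableSet_lt_abs_blockSum a k y).inter (Finset.measurableSet_biInter _ fun i _ =>
    measurableSet_le (h.measurable_blockSum a i).abs measurable_const)

lemma dependsOn_firstPassage (h : CoordSystem P m δ b Y) (a k : ℕ) (y : ℝ) :
    DependsOn (fun ω => ω ∈ firstPassage Y a y k) (Set.Icc 1 k) := by
  intro ω ω' hω
  have e : ∀ i ≤ k, blockSum Y a i ω = blockSum Y a i ω' := fun i hi =>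
    h.dependsOn_blockSum_left hi hω
  simp only [firstPassage, Set.mem_ofPred_eq, e k le_rfl]
  congr 1
  refine propext (forall₂_congr fun i hi => ?_)
  rw [e i (Finset.mem_Ioo.1 hi).2.le]

variable [IsProbabilityMeasure P]

lemma measureReal_lt_abs_blockSum_le (h : CoordSystem P m δ b Y) (a c : ℕ) {x : ℝ} (hx : 0 < x) :
    P.real {ω | x < |blockSum Y a c ω|} ≤ blockVar P Y a c / x ^ 2 := by
  have h1 : Integrable (fun ω => blockSum Y a c ω ^ 2) P := by
    simpa only [sq] using h.integrable_blockSum_mul a c a c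
  have := mul_meas_ge_le_integral_of_nonneg (μ := P) (.of_forall fun ω => sq_nonneg _) h1 (x ^ 2)
  rw [le_div_iff₀ (by positivity), mul_comm]
  refine le_trans ?_ this
  refine mul_le_mul_of_nonneg_left (measureReal_mono fun ω hω => ?_) (sq_nonneg x)
  have hω : x < |blockSum Y a c ω| := hω
  change x ^ 2 ≤ blockSum Y a c ω ^ 2
  rw [← sq_abs (blockSum Y a c ω)]
  gcongr

lemma measureReal_maxExceeds_inter_le (h : CoordSystem P m δ b Y) {a c n : ℕ} (hn : c ≤ n)
    {w x y : ℝ} (hx : 0 < x) (hw0 : 0 ≤ w) (hw : ∀ k, a ≤ k → k ≤ c → blockVar P Y k c ≤ w)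
    {H : Set (ℕ → ℝ)} (hH : ∀ k ∈ Finset.Ioc a c, ∀ ω ∈ firstPassage Y a y k, ω ∈ H →
      x < |blockSum Y (k + m) c ω|) :
    P.real (maxExceeds Y a c y ∩ H) ≤ w / x ^ 2 * P.real (maxExceeds Y a c y) + n * δ := by
  have hterm : ∀ k ∈ Finset.Ioc a c,
      P.real (firstPassage Y a y k ∩ {ω | x < |blockSum Y (k + m) c ω|}) ≤
        w / x ^ 2 * P.real (firstPassage Y a y k) + δ := by
    intro k hk
    refine (h.decoupled.measureReal_inter_le h.one_le k (h.measurableSet_firstPassage a k y)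
      (h.measurableSet_lt_abs_blockSum _ _ x) (h.dependsOn_firstPassage a k y)
      (fun ω ω' hω => ?_)).trans ?_
    · have := h.dependsOn_blockSum_right (a := k + m) (c := c) (Nat.le_succ _) hω
      simp only [Set.mem_ofPred_eq, this]
    · rw [mul_comm]
      gcongr
      refine (h.measureReal_lt_abs_blockSum_le _ _ hx).trans ?_
      gcongr
      rcases le_total (k + m) c with h1 | h1
      · exact hw _ (by have := (Finset.mem_Ioc.1 hk).1; omega) h1
      · simpa [blockVar, blockSum_of_le Y h1] using hw0
  calc P.real (maxExceeds Y a c y ∩ H)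
      ≤ P.real (⋃ k ∈ Finset.Ioc a c,
          firstPassage Y a y k ∩ {ω | x < |blockSum Y (k + m) c ω|}) := by
        refine measureReal_mono ?_ (measure_ne_top _ _)
        rintro ω ⟨h1, h2⟩
        obtain ⟨k, hk, h3⟩ := Set.mem_iUnion₂.1 h1
        exact Set.mem_iUnion₂.2 ⟨k, hk, h3, hH k hk ω h3 h2⟩
    _ ≤ ∑ k ∈ Finset.Ioc a c, P.real (firstPassage Y a y k ∩ {ω | x < |blockSum Y (k + m) c ω|}) :=
        measureReal_biUnion_finset_le _ _
    _ ≤ ∑ k ∈ Finset.Ioc a c, (w / x ^ 2 * P.real (firstPassage Y a y k) + δ) :=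
        Finset.sum_le_sum hterm
    _ = w / x ^ 2 * P.real (maxExceeds Y a c y) + (c - a : ℕ) * δ := by
        rw [Finset.sum_add_distrib, ← Finset.mul_sum, maxExceeds,
          measureReal_biUnion_finset (disjoint_firstPassage Y a c y)
            fun k _ => h.measurableSet_firstPassage a k y]
        simp
    _ ≤ _ := by
        have := h.nonneg
        gcongr
        omega

lemma measureReal_maxExceeds_le (h : CoordSystem P m δ b Y) {a c n : ℕ} (hn : c ≤ n)
    {w x y : ℝ} (hx : 0 < x) (hw : ∀ k, a ≤ k → k ≤ c → blockVar P Y k c ≤ w) (hw0 : 0 ≤ w)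
    (hwx : w / x ^ 2 ≤ 1 / 4) (hmb : m * b ≤ x) :
    P.real (maxExceeds Y a c (y + 2 * x)) ≤
      2 * P.real {ω | y < |blockSum Y a c ω|} + 2 * (n * δ) := by
  set M := maxExceeds Y a c (y + 2 * x)
  set G := {ω | y < |blockSum Y a c ω|}
  have h1 := h.measureReal_maxExceeds_inter_le hn hx hw0 hw (y := y + 2 * x) (H := Gᶜ) (by
    rintro k hk ω ⟨h1, -⟩ h2
    have h2 : |blockSum Y a c ω| ≤ y := not_lt.1 h2
    obtain ⟨k1, k2⟩ := Finset.mem_Ioc.1 hk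
    have h3 := abs_le.1 (h.abs_blockSum_sub_le k c ω)
    have h4 := blockSum_add Y k1.le k2 ω
    have h5 := abs_sub (blockSum Y a c ω) (blockSum Y k c ω)
    have h6 : |blockSum Y a k ω| = |blockSum Y a c ω - blockSum Y k c ω| := by
      rw [h4, add_sub_cancel_right]
    have h7 := abs_add_le (blockSum Y k c ω - blockSum Y (k + m) c ω) (blockSum Y (k + m) c ω)
    have h8 := h.abs_blockSum_sub_le k c ω
    rw [sub_add_cancel] at h7
    linarith)
  have h2 : P.real M ≤ P.real (M ∩ Gᶜ) + P.real G := by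
    refine (measureReal_mono (fun ω hω => ?_)).trans (measureReal_union_le (M ∩ Gᶜ) G)
    by_cases hG : ω ∈ G
    · exact Or.inr hG
    · exact Or.inl ⟨hω, hG⟩
  have h3 : w / x ^ 2 * P.real M ≤ 1 / 4 * P.real M := by gcongr
  have h4 : 0 ≤ n * δ := mul_nonneg (Nat.cast_nonneg _) h.nonneg
  have h5 : 0 ≤ P.real G := measureReal_nonneg
  linarith

lemma measureReal_lt_abs_le_maxExceeds (h : CoordSystem P m δ b Y) {a c n : ℕ} (hn : c ≤ n)
    {w x y : ℝ} (hx : 0 < x) (hy : 0 ≤ y) (hw : ∀ k, a ≤ k → k ≤ c → blockVar P Y k c ≤ w)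
    (hw0 : 0 ≤ w) (hmb : m * b ≤ x) :
    P.real {ω | y + 3 * x < |blockSum Y a c ω|} ≤
      w / x ^ 2 * P.real (maxExceeds Y a c y) + n * δ := by
  have hbx : b ≤ x := by
    refine le_trans ?_ hmb
    exact le_mul_of_one_le_left h.b_nonneg (by exact_mod_cast h.one_le)
  have h1 := h.measureReal_maxExceeds_inter_le hn hx hw0 hw (y := y)
    (H := {ω | y + 3 * x < |blockSum Y a c ω|}) (by
    rintro k hk ω ⟨-, h1⟩ h2
    have h2 : y + 3 * x < |blockSum Y a c ω| := h2
    obtain ⟨k1, k2⟩ := Finset.mem_Ioc.1 hk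
    have h3 : |blockSum Y a (k - 1) ω| ≤ y := by
      rcases Nat.eq_or_lt_of_le (Nat.le_sub_one_of_lt k1) with h4 | h4
      · rw [← h4, blockSum_of_le Y le_rfl, abs_zero]; exact hy
      · exact h1 _ (Finset.mem_Ioo.2 ⟨h4, by omega⟩)
    have h4 := blockSum_add Y k1.le k2 ω
    have h5 := blockSum_add Y (Nat.le_sub_one_of_lt k1) (Nat.sub_le k 1) ω
    have h6 := h.abs_blockSum_le (a := k - 1) (c := k) (k := 1) (by omega) ω
    have h7 := abs_add_le (blockSum Y k c ω - blockSum Y (k + m) c ω) (blockSum Y (k + m) c ω)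
    have h8 := h.abs_blockSum_sub_le k c ω
    rw [sub_add_cancel] at h7
    have h9 := abs_add_le (blockSum Y a k ω) (blockSum Y k c ω)
    have h10 := abs_add_le (blockSum Y a (k - 1) ω) (blockSum Y (k - 1) k ω)
    rw [← h4] at h9
    rw [← h5] at h10
    push_cast at h6
    linarith)
  refine le_trans (measureReal_mono ?_ (measure_ne_top _ _)) h1
  intro ω hω
  refine ⟨?_, hω⟩
  have hω : y + 3 * x < |blockSum Y a c ω| := hω
  rcases lt_or_ge a c with hac | hac
  · exact mem_maxExceeds (Finset.mem_Ioc.2 ⟨hac, le_rfl⟩) (by linarith)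
  · rw [blockSum_of_le Y hac, abs_zero] at hω
    linarith

lemma measureReal_tail_le (h : CoordSystem P m δ b Y) {a c n : ℕ} (hn : c ≤ n)
    {w x : ℝ} (hx : 0 < x) (hw : ∀ k, a ≤ k → k ≤ c → blockVar P Y k c ≤ w) (hw0 : 0 ≤ w)
    (hwx : w / x ^ 2 ≤ 1 / 4) (hmb : m * b ≤ x) (k : ℕ) :
    P.real {ω | 5 * k * x < |blockSum Y a c ω|} ≤ (1 / 2) ^ k + 3 * (n * δ) := by
  have hnδ : 0 ≤ n * δ := mul_nonneg (Nat.cast_nonneg _) h.nonneg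
  induction k with
  | zero =>
    have : P.real {ω | 5 * (0 : ℕ) * x < |blockSum Y a c ω|} ≤ 1 := measureReal_le_one
    rw [pow_zero]
    linarith
  | succ k ih =>
    have h1 := h.measureReal_maxExceeds_le (y := 5 * k * x) hn hx hw hw0 hwx hmb
    have h2 := h.measureReal_lt_abs_le_maxExceeds (y := 5 * k * x + 2 * x) hn hx (by positivity)
      hw hw0 hmb
    have h3 : w / x ^ 2 * P.real (maxExceeds Y a c (5 * k * x + 2 * x)) ≤
        1 / 4 * P.real (maxExceeds Y a c (5 * k * x + 2 * x)) := by gcongr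
    have e : 5 * ((k + 1 : ℕ) : ℝ) * x = 5 * k * x + 2 * x + 3 * x := by push_cast; ring
    rw [e, pow_succ]
    linarith

/-- Moment bound for block sums, from the exponential decay of the tails. -/
lemma integral_abs_blockSum_pow_le (h : CoordSystem P m δ b Y) {a c n : ℕ} (hn : c ≤ n)
    {w x : ℝ} (hx : 0 < x) (hw : ∀ k, a ≤ k → k ≤ c → blockVar P Y k c ≤ w) (hw0 : 0 ≤ w)
    (hwx : w / x ^ 2 ≤ 1 / 4) (hmb : m * b ≤ x) {q : ℕ} (hq : q ≠ 0) (K : ℕ) :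
    ∫ ω, |blockSum Y a c ω| ^ q ∂P ≤
      ∑ k ∈ Finset.range K, (5 * (k + 1) * x) ^ q * ((1 / 2) ^ k + 3 * (n * δ)) +
        (n * b) ^ q * ((1 / 2) ^ K + 3 * (n * δ)) := by
  set A : ℕ → Set (ℕ → ℝ) := fun k => {ω | 5 * k * x < |blockSum Y a c ω|} with hA
  have hAm : ∀ k, MeasurableSet (A k) := fun k => h.measurableSet_lt_abs_blockSum _ _ _
  have hB : ∀ ω, |blockSum Y a c ω| ≤ n * b := fun ω => h.abs_blockSum_le (by omega) ω
  have hB0 : 0 ≤ n * b := mul_nonneg (Nat.cast_nonneg _) h.b_nonneg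
  have hpt : ∀ ω, |blockSum Y a c ω| ^ q ≤
      ∑ k ∈ Finset.range K, (A k).indicator (fun _ => (5 * (k + 1) * x) ^ q) ω +
        (A K).indicator (fun _ => (n * b) ^ q) ω := by
    intro ω
    have hnn : ∀ k ∈ Finset.range K, 0 ≤ (A k).indicator (fun _ => (5 * (k + 1) * x) ^ q) ω :=
      fun k _ => Set.indicator_nonneg (fun _ _ => by positivity) _
    by_cases hK : ω ∈ A K
    · rw [Set.indicator_of_mem hK]
      have := Finset.sum_nonneg hnn
      have : |blockSum Y a c ω| ^ q ≤ (n * b) ^ q := by gcongr; exact hB ω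
      linarith
    · rw [Set.indicator_of_notMem hK, add_zero]
      by_cases h0 : |blockSum Y a c ω| = 0
      · rw [h0, zero_pow hq]; exact Finset.sum_nonneg hnn
      · have hpos : ω ∈ A 0 := by simpa [hA] using h0
        classical
        have hex : ∃ k, ω ∉ A k := ⟨K, hK⟩
        obtain ⟨k, hk⟩ : ∃ k, Nat.find hex = k + 1 := by
          refine Nat.exists_eq_succ_of_ne_zero fun h1 => ?_
          exact (h1 ▸ Nat.find_spec hex) hpos
        have h1 : ω ∉ A (k + 1) := hk ▸ Nat.find_spec hex
        have h2 : ω ∈ A k := not_not.1 (Nat.find_min hex (by omega))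
        have h3 : Nat.find hex ≤ K := Nat.find_min' hex hK
        refine le_trans ?_ (Finset.single_le_sum hnn (Finset.mem_range.2 (by omega : k < K)))
        rw [Set.indicator_of_mem h2]
        have h4 : |blockSum Y a c ω| ≤ 5 * (k + 1 : ℕ) * x := not_lt.1 h1
        push_cast at h4
        gcongr
  have hi : ∀ (k : ℕ) (C : ℝ), Integrable ((A k).indicator fun _ => C) P := fun k C =>
    (integrable_const C).indicator (hAm k)
  have hint : ∀ (k : ℕ) (C : ℝ), ∫ ω, (A k).indicator (fun _ => C) ω ∂P = C * P.real (A k) := by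
    intro k C
    rw [integral_indicator (hAm k)]
    simp [mul_comm]
  calc ∫ ω, |blockSum Y a c ω| ^ q ∂P
      ≤ ∫ ω, (∑ k ∈ Finset.range K, (A k).indicator (fun _ => (5 * (k + 1) * x) ^ q) ω +
        (A K).indicator (fun _ => (n * b) ^ q) ω) ∂P := by
        refine integral_mono_of_nonneg (.of_forall fun ω => by positivity) ?_ (.of_forall hpt)
        exact (integrable_finsetSum _ fun k _ => hi k _).add (hi K _)
    _ = ∑ k ∈ Finset.range K, (5 * (k + 1) * x) ^ q * P.real (A k) +
        (n * b) ^ q * P.real (A K) := by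
        rw [integral_add (integrable_finsetSum _ fun k _ => hi k _) (hi K _),
          integral_finsetSum _ fun k _ => hi k _]
        simp only [hint]
    _ ≤ _ := by
        gcongr with k
        · exact h.measureReal_tail_le hn hx hw hw0 hwx hmb k
        · exact h.measureReal_tail_le hn hx hw hw0 hwx hmb K

end CoordSystem

/-- The constant in the moment bound for block sums. -/
def tailConst (q : ℕ) : ℝ := ∑' k : ℕ, (5 * ((k : ℝ) + 1)) ^ q * (1 / 2) ^ k

lemma summable_tailConst (q : ℕ) : Summable fun k : ℕ => (5 * ((k : ℝ) + 1)) ^ q * (1 / 2) ^ k := by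
  have h := (summable_nat_add_iff 1).2
    (summable_pow_mul_geometric_of_norm_lt_one q (r := (1 / 2 : ℝ)) (by norm_num [abs_of_pos]))
  refine (h.mul_left (5 ^ q * 2)).congr fun k => ?_
  rw [mul_pow, pow_succ]
  push_cast
  ring

lemma norm_exp_ofReal_mul_I_sub_taylor_le (x : ℝ) :
    ‖Complex.exp (x * Complex.I) - (1 + x * Complex.I - x ^ 2 / 2)‖ ≤ 4 * |x| ^ 3 := by
  rcases le_total |x| 1 with hx | hx
  · have h := Complex.exp_bound (x := x * Complex.I) (by simpa using hx) (n := 3) (by norm_num)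
    have e : ∑ k ∈ Finset.range 3, ((x : ℂ) * Complex.I) ^ k / (k.factorial : ℂ) =
        1 + x * Complex.I - x ^ 2 / 2 := by
      simp only [Finset.sum_range_succ, Finset.sum_range_zero, mul_pow, Complex.I_sq]
      norm_num [Nat.factorial]
      ring
    rw [e] at h
    refine h.trans ?_
    rw [norm_mul, Complex.norm_I, mul_one, Complex.norm_real, Real.norm_eq_abs, mul_comm]
    gcongr
    norm_num [Nat.factorial]
  · refine (norm_sub_le _ _).trans ?_
    rw [Complex.norm_exp_ofReal_mul_I]
    have h1 : ‖(1 : ℂ) + x * Complex.I - x ^ 2 / 2‖ ≤ 1 + |x| + |x| ^ 2 / 2 := by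
      refine (norm_sub_le _ _).trans (add_le_add ((norm_add_le _ _).trans ?_) ?_)
      · simp
      · simp
    have h2 : |x| ≤ |x| ^ 3 := le_self_pow₀ hx (by norm_num)
    have h3 : |x| ^ 2 ≤ |x| ^ 3 := pow_le_pow_right₀ hx (by norm_num)
    linarith

lemma norm_exp_ofReal_mul_I_sub_exp_le (x y : ℝ) :
    ‖Complex.exp (x * Complex.I) - Complex.exp (y * Complex.I)‖ ≤ |x - y| := by
  have e : Complex.exp (x * Complex.I) - Complex.exp (y * Complex.I) =
      Complex.exp (y * Complex.I) * (Complex.exp (Complex.I * (x - y : ℝ)) - 1) := by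
    rw [mul_sub, ← Complex.exp_add, mul_one]
    congr 2
    push_cast
    ring
  rw [e, norm_mul, Complex.norm_exp_ofReal_mul_I, one_mul]
  exact Real.norm_exp_I_mul_ofReal_sub_one_le

/-- The characteristic function of `blockSum Y a c`. -/
def blockChar (P : Measure (ℕ → ℝ)) (Y : ℕ → (ℕ → ℝ) → ℝ) (θ : ℝ) (a c : ℕ) : ℂ :=
  ∫ x, Complex.exp ((θ * blockSum Y a c x : ℝ) * Complex.I) ∂P

/-- A bound for the jumps of `blockVar P Y 0` and for its deviation from additivity. -/
def varError (m n : ℕ) (b δ v : ℝ) : ℝ :=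
  (m * b) ^ 2 + 2 * (√(v + 2 * ((m * b) ^ 2 + 2 * ((n * b) ^ 2 * δ))) * (m * b)) +
    2 * ((n * b) ^ 2 * δ)

namespace CoordSystem

variable {P : Measure (ℕ → ℝ)} {m : ℕ} {δ b : ℝ} {Y : ℕ → (ℕ → ℝ) → ℝ}
lemma measurable_exp_blockSum (h : CoordSystem P m δ b Y) (θ : ℝ) (a c : ℕ) :
    Measurable fun x => Complex.exp ((θ * blockSum Y a c x : ℝ) * Complex.I) := by
  have := h.measurable_blockSum a c
  fun_prop

variable [IsProbabilityMeasure P]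

lemma integral_abs_blockSum_pow_le_tailConst (h : CoordSystem P m δ b Y) {a c n : ℕ} (hn : c ≤ n)
    {w x : ℝ} (hx : 0 < x) (hw : ∀ k, a ≤ k → k ≤ c → blockVar P Y k c ≤ w) (hw0 : 0 ≤ w)
    (hwx : w / x ^ 2 ≤ 1 / 4) (hmb : m * b ≤ x) {q : ℕ} (hq : q ≠ 0) :
    ∫ ω, |blockSum Y a c ω| ^ q ∂P ≤ tailConst q * x ^ q +
      (n * ((5 * n * x) ^ q * (3 * (n * δ))) + (n * b) ^ q * ((1 / 2) ^ n + 3 * (n * δ))) := by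
  refine (h.integral_abs_blockSum_pow_le hn hx hw hw0 hwx hmb hq n).trans ?_
  rw [← add_assoc]
  gcongr ?_ + _
  simp only [mul_add, Finset.sum_add_distrib]
  have hδ := h.nonneg
  refine add_le_add ?_ ?_
  · have := (summable_tailConst q).sum_le_tsum (Finset.range n) fun k _ => by positivity
    calc _ = (∑ k ∈ Finset.range n, (5 * ((k : ℝ) + 1)) ^ q * (1 / 2) ^ k) * x ^ q := by
          rw [Finset.sum_mul]
          refine Finset.sum_congr rfl fun k _ => ?_
          rw [mul_pow (_ + _) x]
          ring
      _ ≤ _ := by gcongr; exact this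
  · refine (Finset.sum_le_card_nsmul _ _ ((5 * n * x) ^ q * (3 * (n * δ))) fun k hk => ?_).trans
      (by simp)
    gcongr
    have : (k : ℝ) + 1 ≤ n := by exact_mod_cast Finset.mem_range.1 hk
    linarith

lemma integrable_exp_blockSum (h : CoordSystem P m δ b Y) (θ : ℝ) (a c : ℕ) :
    Integrable (fun x => Complex.exp ((θ * blockSum Y a c x : ℝ) * Complex.I)) P :=
  Integrable.of_bound (h.measurable_exp_blockSum θ a c).aestronglyMeasurable 1
    (.of_forall fun _ => (Complex.norm_exp_ofReal_mul_I _).le)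

lemma norm_blockChar_sub_le (h : CoordSystem P m δ b Y) (θ : ℝ) (a c : ℕ) :
    ‖blockChar P Y θ a c - (1 - θ ^ 2 * blockVar P Y a c / 2 : ℝ)‖ ≤
      4 * |θ| ^ 3 * ∫ x, |blockSum Y a c x| ^ 3 ∂P := by
  have hm := h.measurable_blockSum a c
  have hb := h.abs_blockSum_le' a c
  have i1 : Integrable (fun x => blockSum Y a c x) P := integrable_of_abs_le hm hb
  have i2 : Integrable (fun x => blockSum Y a c x ^ 2) P := by
    simpa only [sq] using h.integrable_blockSum_mul a c a c
  have i3 : Integrable (fun x => |blockSum Y a c x| ^ 3) P :=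
    integrable_of_abs_le (M := ((c - a : ℕ) * b) ^ 3) (by fun_prop) fun x => by
      rw [abs_pow, abs_abs]; exact pow_le_pow_left₀ (abs_nonneg _) (hb x) 3
  have i4 : Integrable (fun x => 1 - θ ^ 2 / 2 * blockSum Y a c x ^ 2) P :=
    (integrable_const _).sub (i2.const_mul _)
  have e1 : ∫ x, (1 - θ ^ 2 / 2 * blockSum Y a c x ^ 2) ∂P = 1 - θ ^ 2 * blockVar P Y a c / 2 := by
    rw [integral_sub (integrable_const _) (i2.const_mul _), integral_const_mul]
    simp only [integral_const, probReal_univ, smul_eq_mul, one_mul, blockVar]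
    ring
  have e2 : ∫ x, θ * blockSum Y a c x ∂P = 0 := by
    rw [integral_const_mul, h.integral_blockSum, mul_zero]
  have j1 : Integrable (fun x => ((1 - θ ^ 2 / 2 * blockSum Y a c x ^ 2 : ℝ) : ℂ)) P := i4.ofReal
  have j2 : Integrable (fun x => ((θ * blockSum Y a c x : ℝ) : ℂ) * Complex.I) P :=
    (Integrable.ofReal (i1.const_mul θ)).mul_const _
  have j3 : Integrable (fun x => ((1 - θ ^ 2 / 2 * blockSum Y a c x ^ 2 : ℝ) : ℂ) +
      ((θ * blockSum Y a c x : ℝ) : ℂ) * Complex.I) P := j1.add j2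
  have e3 : ∫ x, (((1 - θ ^ 2 / 2 * blockSum Y a c x ^ 2 : ℝ) : ℂ) +
      ((θ * blockSum Y a c x : ℝ) : ℂ) * Complex.I) ∂P =
      (1 - θ ^ 2 * blockVar P Y a c / 2 : ℝ) := by
    rw [integral_add j1 j2, integral_complex_ofReal, e1, integral_mul_const, integral_complex_ofReal, e2]
    simp
  rw [← e3, blockChar, ← integral_sub (h.integrable_exp_blockSum θ a c) j3, ← integral_const_mul]
  refine norm_integral_le_of_norm_le (i3.const_mul _) (.of_forall fun x => ?_)
  have := norm_exp_ofReal_mul_I_sub_taylor_le (θ * blockSum Y a c x)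
  rw [abs_mul, mul_pow, ← mul_assoc] at this
  refine le_trans (le_of_eq ?_) this
  congr 2
  push_cast
  ring

lemma norm_blockChar_add_sub_mul_le (h : CoordSystem P m δ b Y) (θ : ℝ) {a c e : ℕ} (h₁ : a ≤ c)
    (h₂ : c ≤ e) :
    ‖blockChar P Y θ a e - blockChar P Y θ a c * blockChar P Y θ c e‖ ≤
      2 * (|θ| * (m * b)) + 4 * δ := by
  have hint : Integrable (fun x => Complex.exp ((θ * blockSum Y a c x : ℝ) * Complex.I) *
      Complex.exp ((θ * blockSum Y (c + m) e x : ℝ) * Complex.I)) P :=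
    Integrable.of_bound ((h.measurable_exp_blockSum θ a c).mul
      (h.measurable_exp_blockSum θ (c + m) e)).aestronglyMeasurable 1
      (.of_forall fun x => by simp [Complex.norm_exp_ofReal_mul_I, -Complex.ofReal_mul])
  have hexp : ∀ x, ‖Complex.exp ((θ * blockSum Y c e x : ℝ) * Complex.I) -
      Complex.exp ((θ * blockSum Y (c + m) e x : ℝ) * Complex.I)‖ ≤ |θ| * (m * b) := fun x => by
    refine (norm_exp_ofReal_mul_I_sub_exp_le _ _).trans ?_
    rw [← mul_sub, abs_mul]
    gcongr
    exact h.abs_blockSum_sub_le c e x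
  have k1 : ‖blockChar P Y θ a e - ∫ x, Complex.exp ((θ * blockSum Y a c x : ℝ) * Complex.I) *
      Complex.exp ((θ * blockSum Y (c + m) e x : ℝ) * Complex.I) ∂P‖ ≤ |θ| * (m * b) := by
    rw [blockChar, ← integral_sub (h.integrable_exp_blockSum θ a e) hint]
    refine (norm_integral_le_of_norm_le_const (.of_forall fun x => ?_)).trans_eq
      (by rw [probReal_univ, mul_one])
    have : Complex.exp ((θ * blockSum Y a e x : ℝ) * Complex.I) =
        Complex.exp ((θ * blockSum Y a c x : ℝ) * Complex.I) *
        Complex.exp ((θ * blockSum Y c e x : ℝ) * Complex.I) := by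
      rw [blockSum_add Y h₁ h₂, ← Complex.exp_add, ← add_mul]
      push_cast
      ring_nf
    rw [this, ← mul_sub, norm_mul, Complex.norm_exp_ofReal_mul_I, one_mul]
    exact hexp x
  have k2 := h.decoupled.norm_integral_mul_sub_le h.one_le c (h.measurable_exp_blockSum θ a c)
    (h.measurable_exp_blockSum θ (c + m) e) (fun x => (Complex.norm_exp_ofReal_mul_I _).le)
    (fun x => (Complex.norm_exp_ofReal_mul_I _).le)
    (fun x y hxy => by simp only [h.dependsOn_blockSum_left le_rfl hxy])
    (fun x y hxy => by simp only [h.dependsOn_blockSum_right (Nat.le_succ _) hxy])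
  have k3 : ‖blockChar P Y θ c e - blockChar P Y θ (c + m) e‖ ≤ |θ| * (m * b) := by
    rw [blockChar, blockChar, ← integral_sub (h.integrable_exp_blockSum θ c e)
      (h.integrable_exp_blockSum θ (c + m) e)]
    exact (norm_integral_le_of_norm_le_const (.of_forall hexp)).trans_eq
      (by rw [probReal_univ, mul_one])
  have k4 : ‖blockChar P Y θ a c‖ ≤ 1 :=
    (norm_integral_le_of_norm_le_const (.of_forall fun x =>
      (Complex.norm_exp_ofReal_mul_I _).le)).trans_eq (by rw [probReal_univ, mul_one])
  change ‖_ - blockChar P Y θ a c * blockChar P Y θ (c + m) e‖ ≤ _ at k2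
  have k5 : ‖blockChar P Y θ a c * (blockChar P Y θ c e - blockChar P Y θ (c + m) e)‖ ≤
      |θ| * (m * b) := by
    rw [norm_mul]
    calc _ ≤ 1 * (|θ| * (m * b)) := by gcongr
      _ = _ := one_mul _
  set I := ∫ x, Complex.exp ((θ * blockSum Y a c x : ℝ) * Complex.I) *
      Complex.exp ((θ * blockSum Y (c + m) e x : ℝ) * Complex.I) ∂P
  calc _ = ‖(blockChar P Y θ a e - I) + (I - blockChar P Y θ a c * blockChar P Y θ (c + m) e) -
        blockChar P Y θ a c * (blockChar P Y θ c e - blockChar P Y θ (c + m) e)‖ := by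
        congr 1; ring
    _ ≤ _ := by
        refine (norm_sub_le _ _).trans ?_
        have := norm_add_le (blockChar P Y θ a e - I)
          (I - blockChar P Y θ a c * blockChar P Y θ (c + m) e)
        linarith

lemma abs_blockVar_sub_le_varError (h : CoordSystem P m δ b Y) {c e n : ℕ} (h₁ : c ≤ e)
    (h₂ : e ≤ n) :
    |blockVar P Y 0 e - blockVar P Y 0 c - blockVar P Y c e| + (m * b) ^ 2 ≤
      varError m n b δ (blockVar P Y 0 n) := by
  have k := h.abs_blockVar_sub_left (Nat.zero_le c) h₁ h₂
  have hb := h.b_nonneg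
  have : √(blockVar P Y 0 c) * (m * b) ≤
      √(blockVar P Y 0 n + 2 * ((m * b) ^ 2 + 2 * ((n * b) ^ 2 * δ))) * (m * b) := by
    gcongr
    exact h.blockVar_le_of_subset le_rfl (Nat.zero_le c) (h₁.trans h₂) le_rfl
  unfold varError
  linarith

lemma exists_partition (h : CoordSystem P m δ b Y) (n : ℕ) {N : ℕ} (hN : 1 ≤ N) :
    ∃ t : ℕ → ℕ, Monotone t ∧ t 0 = 0 ∧ t N = n ∧ (∀ j, t j ≤ n) ∧ ∀ j ≤ N,
      |blockVar P Y 0 (t j) - j / N * blockVar P Y 0 n| ≤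
        varError m n b δ (blockVar P Y 0 n) := by
  classical
  set v := blockVar P Y 0 n with hv
  have hv0 : 0 ≤ v := blockVar_nonneg _ _ _ _
  have hN0 : (0 : ℝ) < N := by exact_mod_cast hN
  have hex : ∀ j : ℕ, ∃ t, t = n ∨ (j < N ∧ (j : ℝ) / N * v ≤ blockVar P Y 0 t) :=
    fun j => ⟨n, Or.inl rfl⟩
  have hle : ∀ j, Nat.find (hex j) ≤ n := fun j => Nat.find_min' _ (Or.inl rfl)
  have hJ0 : 0 ≤ varError m n b δ v := by
    have := h.abs_blockVar_sub_le_varError (le_refl n) le_rfl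
    have := abs_nonneg (blockVar P Y 0 n - blockVar P Y 0 n - blockVar P Y n n)
    nlinarith [sq_nonneg (m * b)]
  have hzero : blockVar P Y 0 0 = 0 := by simp [blockVar, blockSum_of_le]
  have hNn : Nat.find (hex N) = n := by
    rcases Nat.find_spec (hex N) with h1 | h1
    · exact h1
    · exact absurd h1.1 (lt_irrefl _)
  refine ⟨fun j => Nat.find (hex j), fun i j hij => Nat.find_min' _ ?_, ?_, hNn, hle, ?_⟩
  · rcases Nat.find_spec (hex j) with h1 | h1
    · exact Or.inl h1
    · refine Or.inr ⟨hij.trans_lt h1.1, le_trans ?_ h1.2⟩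
      gcongr
  · rw [Nat.find_eq_zero]
    exact Or.inr ⟨hN, by simp [hzero]⟩
  · intro j hj
    dsimp only
    rcases hj.lt_or_eq with hj | rfl
    · have hjN : (j : ℝ) / N * v ≤ v := by
        refine mul_le_of_le_one_left hv0 ?_
        rw [div_le_one hN0]
        exact_mod_cast hj.le
      have h1 : (j : ℝ) / N * v ≤ blockVar P Y 0 (Nat.find (hex j)) := by
        rcases Nat.find_spec (hex j) with h1 | h1
        · rw [h1]; exact hjN
        · exact h1.2
      rcases Nat.eq_zero_or_pos (Nat.find (hex j)) with h0 | h0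
      · rw [h0, hzero] at h1 ⊢
        have : 0 ≤ (j : ℝ) / N * v := by positivity
        rw [le_antisymm h1 this]
        simpa using hJ0
      · have h2 := Nat.find_min (hex j) (Nat.sub_lt h0 one_pos)
        have h3 : blockVar P Y 0 (Nat.find (hex j) - 1) ≤ (j : ℝ) / N * v := by
          by_contra hcon
          exact h2 (Or.inr ⟨hj, (not_le.1 hcon).le⟩)
        have h4 := h.abs_blockVar_sub_le_varError (Nat.sub_le (Nat.find (hex j)) 1) (hle j)
        have h5 : blockVar P Y (Nat.find (hex j) - 1) (Nat.find (hex j)) ≤ (m * b) ^ 2 := by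
          have hb : b ≤ m * b := le_mul_of_one_le_left h.b_nonneg (by exact_mod_cast h.one_le)
          have := integral_mono (μ := P)
            (f := fun x => blockSum Y (Nat.find (hex j) - 1) (Nat.find (hex j)) x ^ 2)
            (g := fun _ => (m * b) ^ 2)
            (by simpa only [sq] using h.integrable_blockSum_mul _ _ _ _) (integrable_const _)
            fun x => by
              have h6 := h.abs_blockSum_le (a := Nat.find (hex j) - 1) (c := Nat.find (hex j))
                (k := 1) (by omega) x
              dsimp only
              rw [← sq_abs]
              push_cast at h6
              gcongr
              linarith
          simpa [blockVar] using this
        have h6 := abs_le.1 (le_refl |blockVar P Y 0 (Nat.find (hex j)) -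
          blockVar P Y 0 (Nat.find (hex j) - 1) -
            blockVar P Y (Nat.find (hex j) - 1) (Nat.find (hex j))|)
        rw [abs_le]
        constructor <;> linarith [h6.1, h6.2]
    · rw [hNn, div_self hN0.ne', one_mul, ← hv, sub_self, abs_zero]
      exact hJ0

lemma abs_blockVar_partition_sub_le (h : CoordSystem P m δ b Y) {n N : ℕ} {t : ℕ → ℕ}
    (hmono : Monotone t) (hle : ∀ j, t j ≤ n)
    (ht : ∀ j ≤ N, |blockVar P Y 0 (t j) - j / N * blockVar P Y 0 n| ≤
      varError m n b δ (blockVar P Y 0 n)) {j : ℕ} (hj : j < N) :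
    |blockVar P Y (t j) (t (j + 1)) - blockVar P Y 0 n / N| ≤
      3 * varError m n b δ (blockVar P Y 0 n) := by
  have h1 := abs_le.1 (ht j hj.le)
  have h2 := abs_le.1 (ht (j + 1) hj)
  have h3 := h.abs_blockVar_sub_le_varError (hmono (Nat.le_succ j)) (hle (j + 1))
  have h4 := abs_le.1 (le_refl |blockVar P Y 0 (t (j + 1)) - blockVar P Y 0 (t j) -
    blockVar P Y (t j) (t (j + 1))|)
  have h5 := sq_nonneg (m * b)
  have e : ((j + 1 : ℕ) : ℝ) / N * blockVar P Y 0 n =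
      j / N * blockVar P Y 0 n + blockVar P Y 0 n / N := by
    push_cast; ring
  rw [e] at h2
  rw [abs_le]
  constructor <;> linarith [h1.1, h1.2, h2.1, h2.2, h4.1, h4.2]

/-- Comparison of the characteristic function with a product, from a bound on the third moments of
blocks and on their variances. -/
lemma norm_blockChar_sub_pow_le (h : CoordSystem P m δ b Y) (θ : ℝ) {N : ℕ} {t : ℕ → ℕ}
    (hmono : Monotone t) (h0 : t 0 = 0) {V e T : ℝ} (hV : 0 ≤ V) (hθ : θ ^ 2 * V ≤ 4)
    (hvar : ∀ j < N, |blockVar P Y (t j) (t (j + 1)) - V| ≤ e)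
    (hthird : ∀ j < N, ∫ x, |blockSum Y (t j) (t (j + 1)) x| ^ 3 ∂P ≤ T) {j : ℕ} (hj : j ≤ N) :
    ‖blockChar P Y θ 0 (t j) - ((1 - θ ^ 2 * V / 2 : ℝ) : ℂ) ^ j‖ ≤
      j * (2 * (|θ| * (m * b)) + 4 * δ + 4 * |θ| ^ 3 * T + θ ^ 2 * e / 2) := by
  set ρ : ℂ := ((1 - θ ^ 2 * V / 2 : ℝ) : ℂ) with hρ
  have hρ1 : ‖ρ‖ ≤ 1 := by
    rw [hρ, Complex.norm_real, Real.norm_eq_abs, abs_le]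
    have : 0 ≤ θ ^ 2 * V := by positivity
    constructor <;> linarith
  induction j with
  | zero => simp [blockChar, h0, blockSum_of_le]
  | succ j ih =>
    have ih := ih (by omega)
    have k1 := h.norm_blockChar_add_sub_mul_le θ (Nat.zero_le (t j)) (hmono (Nat.le_succ j))
    have k2 := h.norm_blockChar_sub_le θ (t j) (t (j + 1))
    have k3 : 4 * |θ| ^ 3 * ∫ x, |blockSum Y (t j) (t (j + 1)) x| ^ 3 ∂P ≤ 4 * |θ| ^ 3 * T := by
      gcongr
      exact hthird j hj
    have k4 : ‖((1 - θ ^ 2 * blockVar P Y (t j) (t (j + 1)) / 2 : ℝ) : ℂ) - ρ‖ ≤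
        θ ^ 2 * e / 2 := by
      rw [hρ, ← Complex.ofReal_sub, Complex.norm_real, Real.norm_eq_abs]
      calc _ = θ ^ 2 / 2 * |blockVar P Y (t j) (t (j + 1)) - V| := by
            rw [show ∀ u : ℝ, 1 - θ ^ 2 * u / 2 - (1 - θ ^ 2 * V / 2) = -(θ ^ 2 / 2 * (u - V)) from
              fun u => by ring, abs_neg, abs_mul, abs_of_nonneg (by positivity : 0 ≤ θ ^ 2 / 2)]
        _ ≤ θ ^ 2 / 2 * e := by gcongr; exact hvar j hj
        _ = _ := by ring
    have k5 : ‖blockChar P Y θ 0 (t j)‖ ≤ 1 :=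
      (norm_integral_le_of_norm_le_const (.of_forall fun x =>
        (Complex.norm_exp_ofReal_mul_I _).le)).trans_eq (by rw [probReal_univ, mul_one])
    set A := blockChar P Y θ 0 (t j)
    set B := blockChar P Y θ (t j) (t (j + 1))
    set D : ℂ := ((1 - θ ^ 2 * blockVar P Y (t j) (t (j + 1)) / 2 : ℝ) : ℂ)
    have k6 : ‖A * (B - ρ)‖ ≤ 4 * |θ| ^ 3 * T + θ ^ 2 * e / 2 := by
      rw [norm_mul]
      calc ‖A‖ * ‖B - ρ‖ ≤ 1 * ‖B - ρ‖ := by gcongr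
        _ = ‖(B - D) + (D - ρ)‖ := by rw [one_mul, sub_add_sub_cancel]
        _ ≤ _ := (norm_add_le _ _).trans (by linarith)
    have k7 : ‖(A - ρ ^ j) * ρ‖ ≤ ‖A - ρ ^ j‖ := by
      rw [norm_mul]
      exact mul_le_of_le_one_right (norm_nonneg _) hρ1
    calc _ = ‖(blockChar P Y θ 0 (t (j + 1)) - A * B) + (A * (B - ρ) + (A - ρ ^ j) * ρ)‖ := by
          congr 1; ring
      _ ≤ ‖blockChar P Y θ 0 (t (j + 1)) - A * B‖ + (‖A * (B - ρ)‖ + ‖(A - ρ ^ j) * ρ‖) :=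
          (norm_add_le _ _).trans (by gcongr; exact norm_add_le _ _)
      _ ≤ _ := by push_cast; linarith

end CoordSystem

/-- A triangular array of coordinate systems, negligible at the scale of the gaps, with rapidly
decreasing dependence and asymptotically unit variance. -/
structure CoordArray (P : ℕ → Measure (ℕ → ℝ)) (m : ℕ → ℕ) (δ b : ℕ → ℝ)
    (Y : ℕ → ℕ → (ℕ → ℝ) → ℝ) : Prop where
  system : ∀ᶠ n in atTop, CoordSystem (P n) (m n) (δ n) (b n) (Y n)
  small : Tendsto (fun n => m n * b n) atTop (nhds 0)
  fast : ∀ A : ℕ, Tendsto (fun n : ℕ => (n : ℝ) ^ A * δ n) atTop (nhds 0)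
  var : Tendsto (fun n => blockVar (P n) (Y n) 0 n) atTop (nhds 1)

namespace CoordArray

variable {P : ℕ → Measure (ℕ → ℝ)} {m : ℕ → ℕ} {δ b : ℕ → ℝ} {Y : ℕ → ℕ → (ℕ → ℝ) → ℝ}

lemma tendsto_bound (h : CoordArray P m δ b Y) : Tendsto b atTop (nhds 0) := by
  refine tendsto_of_tendsto_of_tendsto_of_le_of_le' tendsto_const_nhds h.small ?_ ?_
  · filter_upwards [h.system] with n hn using hn.b_nonneg
  · filter_upwards [h.system] with n hn
    exact le_mul_of_one_le_left hn.b_nonneg (by exact_mod_cast hn.one_le)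

lemma tendsto_sq_mul (h : CoordArray P m δ b Y) :
    Tendsto (fun n : ℕ => (n * b n) ^ 2 * δ n) atTop (nhds 0) := by
  have := (h.tendsto_bound.pow 2).mul (h.fast 2)
  simp only [ne_eq, OfNat.ofNat_ne_zero, not_false_eq_true, zero_pow, mul_zero] at this
  refine this.congr fun n => ?_
  ring

lemma tendsto_slack (h : CoordArray P m δ b Y) :
    Tendsto (fun n : ℕ => 2 * ((m n * b n) ^ 2 + 2 * ((n * b n) ^ 2 * δ n))) atTop (nhds 0) := by
  have := ((h.small.pow 2).add (h.tendsto_sq_mul.const_mul 2)).const_mul 2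
  simpa using this

lemma tendsto_varError (h : CoordArray P m δ b Y) :
    Tendsto (fun n => varError (m n) n (b n) (δ n) (blockVar (P n) (Y n) 0 n)) atTop (nhds 0) := by
  have h1 := (h.var.add h.tendsto_slack).sqrt
  have := ((h.small.pow 2).add ((h1.mul h.small).const_mul 2)).add (h.tendsto_sq_mul.const_mul 2)
  simpa [varError] using this

lemma tendsto_momentError (h : CoordArray P m δ b Y) (x : ℝ) (q : ℕ) :
    Tendsto (fun n : ℕ => n * ((5 * n * x) ^ q * (3 * (n * δ n))) +
      (n * b n) ^ q * ((1 / 2) ^ n + 3 * (n * δ n))) atTop (nhds 0) := by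
  have h1 := (h.fast (q + 2)).const_mul (3 * (5 * x) ^ q)
  have h2 := (h.tendsto_bound.pow q).mul
    (tendsto_pow_const_mul_const_pow_of_lt_one q (r := (1 / 2 : ℝ)) (by norm_num) (by norm_num))
  have h3 := ((h.tendsto_bound.pow q).mul (h.fast (q + 1))).const_mul 3
  have := (h1.add h2).add h3
  simp only [mul_zero, add_zero] at this
  refine this.congr fun n => ?_
  simp only [mul_pow, pow_succ]
  ring

variable [∀ n, IsProbabilityMeasure (P n)]

lemma exists_integral_abs_blockSum_pow_le (h : CoordArray P m δ b Y) {q : ℕ} (hq : q ≠ 0) :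
    ∃ C, ∀ᶠ n in atTop, ∫ ω, |blockSum (Y n) 0 n ω| ^ q ∂P n ≤ C := by
  refine ⟨tailConst q * 3 ^ q + 1, ?_⟩
  have h1 := h.var.add h.tendsto_slack
  rw [add_zero] at h1
  filter_upwards [h.system, h1.eventually_le_const (by norm_num : (1 : ℝ) < 2),
    h.small.eventually_le_const (by norm_num : (0 : ℝ) < 3),
    (h.tendsto_momentError 3 q).eventually_le_const one_pos] with n hn hv hs he
  refine (hn.integral_abs_blockSum_pow_le_tailConst le_rfl (w := 2) (x := 3) (by norm_num) ?_
    (by norm_num) (by norm_num) hs hq).trans (by linarith)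
  exact fun k _ hk => (hn.blockVar_le_of_subset (Nat.zero_le k) hk le_rfl le_rfl).trans hv

lemma eventually_norm_blockChar_sub_le (h : CoordArray P m δ b Y) (θ : ℝ) {N : ℕ} (hN : 1 ≤ N)
    (hθ : θ ^ 2 * (1 / N) ≤ 4) {η : ℝ} (hη : 0 < η) :
    ∀ᶠ n in atTop, ‖blockChar (P n) (Y n) θ 0 n - ((1 - θ ^ 2 * (1 / N) / 2 : ℝ) : ℂ) ^ N‖ ≤
      N * (4 * |θ| ^ 3 * (tailConst 3 * √(8 / N) ^ 3)) + η := by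
  have hN0 : (0 : ℝ) < N := by exact_mod_cast hN
  have hx : 0 < √(8 / N) := Real.sqrt_pos.2 (by positivity)
  have hx2 : √(8 / (N : ℝ)) ^ 2 = 8 / N := Real.sq_sqrt (by positivity)
  have t1 : Tendsto (fun n : ℕ => blockVar (P n) (Y n) 0 n / N +
      3 * varError (m n) n (b n) (δ n) (blockVar (P n) (Y n) 0 n) +
      2 * ((m n * b n) ^ 2 + 2 * ((n * b n) ^ 2 * δ n))) atTop (nhds (1 / (N : ℝ))) := by
    simpa using ((h.var.div_const (N : ℝ)).add (h.tendsto_varError.const_mul 3)).add h.tendsto_slack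
  have t2 := (h.var.div_const (N : ℝ)).sub_const (1 / N)
  rw [sub_self] at t2
  have t3 := (h.tendsto_varError.const_mul 3).add t2.abs
  have t4 := (((h.small.const_mul |θ|).const_mul 2).add ((h.fast 0).const_mul 4)).add
    ((((h.tendsto_momentError √(8 / N) 3).const_add
      (tailConst 3 * √(8 / N) ^ 3)).const_mul (4 * |θ| ^ 3)))
  have t5 := ((t4.add ((t3.const_mul (θ ^ 2)).div_const 2))).const_mul (N : ℝ)
  simp only [abs_zero, mul_zero, add_zero, zero_add, zero_div] at t5
  filter_upwards [h.system, t1.eventually_le_const (by gcongr; norm_num : 1 / (N : ℝ) < 2 / N),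
    h.small.eventually_le_const hx, t5.eventually_le_const (lt_add_of_pos_right _ hη)]
    with n hn hv hs he
  obtain ⟨t, hmono, h0, htN, hle, ht⟩ := hn.exists_partition n hN
  have hvar : ∀ j < N, |blockVar (P n) (Y n) (t j) (t (j + 1)) - 1 / N| ≤
      3 * varError (m n) n (b n) (δ n) (blockVar (P n) (Y n) 0 n) +
        |blockVar (P n) (Y n) 0 n / N - 1 / N| := fun j hj =>
    (abs_sub_le _ _ _).trans
      (add_le_add (hn.abs_blockVar_partition_sub_le hmono hle ht hj) le_rfl)
  have hthird : ∀ j < N, ∫ x, |blockSum (Y n) (t j) (t (j + 1)) x| ^ 3 ∂P n ≤ _ := fun j hj =>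
    hn.integral_abs_blockSum_pow_le_tailConst (hle (j + 1)) (w := 2 / N) hx (fun k hk1 hk2 => by
      have k1 := hn.blockVar_le_of_subset hk1 hk2 le_rfl (hle (j + 1))
      have k2 := (abs_le.1 (hn.abs_blockVar_partition_sub_le hmono hle ht hj)).2
      linarith) (by positivity) (by rw [hx2]; field_simp; norm_num) hs three_ne_zero
  have key := hn.norm_blockChar_sub_pow_le θ hmono h0 (by positivity) hθ hvar hthird le_rfl
  rw [htN] at key
  refine key.trans (le_trans (le_of_eq ?_) he)
  simp only [pow_zero, one_mul]

lemma tendsto_blockChar (h : CoordArray P m δ b Y) (θ : ℝ) :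
    Tendsto (fun n => blockChar (P n) (Y n) θ 0 n) atTop
      (nhds (Complex.exp (-(θ : ℂ) ^ 2 / 2))) := by
  have s1 : Tendsto (fun N : ℕ => θ ^ 2 * (1 / (N : ℝ))) atTop (nhds 0) := by
    simpa using tendsto_one_div_atTop_nhds_zero_nat.const_mul (θ ^ 2)
  have s2 : Tendsto (fun N : ℕ => (N : ℝ) * (4 * |θ| ^ 3 * (tailConst 3 * √(8 / N) ^ 3))) atTop
      (nhds 0) := by
    have : Tendsto (fun N : ℕ => 4 * |θ| ^ 3 * tailConst 3 * 8 * √(8 / N)) atTop (nhds 0) := by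
      have := ((tendsto_const_div_atTop_nhds_zero_nat (8 : ℝ)).sqrt).const_mul
        (4 * |θ| ^ 3 * tailConst 3 * 8)
      simpa using this
    refine this.congr' ?_
    filter_upwards [eventually_gt_atTop 0] with N hN
    have hN0 : (0 : ℝ) < N := by exact_mod_cast hN
    rw [pow_succ √(8 / (N : ℝ)), Real.sq_sqrt (by positivity)]
    field_simp
  have s3 : Tendsto (fun N : ℕ => ((1 - θ ^ 2 * (1 / N) / 2 : ℝ) : ℂ) ^ N) atTop
      (nhds (Complex.exp (-(θ : ℂ) ^ 2 / 2))) := by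
    have := (Complex.continuous_ofReal.tendsto _).comp
      (Real.tendsto_one_add_div_pow_exp (-(θ ^ 2 / 2)))
    have e : ((Real.exp (-(θ ^ 2 / 2)) : ℝ) : ℂ) = Complex.exp (-(θ : ℂ) ^ 2 / 2) := by
      push_cast; congr 1; ring
    rw [← e]
    refine this.congr fun N => ?_
    simp only [Function.comp, Complex.ofReal_pow]
    congr 2
    ring
  rw [Metric.tendsto_atTop']
  intro ε hε
  obtain ⟨N, hN1, hN2, hN3, hN4⟩ := ((eventually_ge_atTop 1).and
    ((s1.eventually_le_const (by norm_num : (0 : ℝ) < 4)).and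
    ((s2.eventually_lt_const (by positivity : 0 < ε / 3)).and
    (Metric.tendsto_nhds.1 s3 (ε / 3) (by positivity))))).exists
  have := h.eventually_norm_blockChar_sub_le θ hN1 hN2 (by positivity : 0 < ε / 3)
  obtain ⟨n0, hn0⟩ := eventually_atTop.1 this
  refine ⟨n0, fun n hn => ?_⟩
  have h1 := hn0 n hn.le
  rw [dist_eq_norm] at hN4 ⊢
  have := norm_sub_le_norm_sub_add_norm_sub (blockChar (P n) (Y n) θ 0 n)
    (((1 - θ ^ 2 * (1 / N) / 2 : ℝ) : ℂ) ^ N) (Complex.exp (-(θ : ℂ) ^ 2 / 2))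
  linarith

end CoordArray

/-- Truncation of a real number to the interval `[-L, L]`. -/
def truncate (L x : ℝ) : ℝ := max (-L) (min L x)

lemma continuous_truncate (L : ℝ) : Continuous (truncate L) := by
  unfold truncate; fun_prop

lemma abs_truncate_le {L : ℝ} (hL : 0 ≤ L) (x : ℝ) : |truncate L x| ≤ L :=
  abs_le.2 ⟨le_max_left _ _, max_le (by linarith) (min_le_left _ _)⟩

lemma truncate_eq_self {L x : ℝ} (h : |x| ≤ L) : truncate L x = x := by
  obtain ⟨h1, h2⟩ := abs_le.1 h
  rw [truncate, min_eq_right h2, max_eq_right h1]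

lemma abs_pow_sub_truncate_pow_le {L : ℝ} (hL : 0 < L) (k : ℕ) (x : ℝ) :
    |x ^ k - truncate L x ^ k| ≤ 2 / L * (1 + x ^ (2 * (k + 1))) := by
  have hpos : 0 ≤ x ^ (2 * (k + 1)) := by rw [pow_mul]; positivity
  rcases le_or_gt |x| L with h | h
  · rw [truncate_eq_self h, sub_self, abs_zero]
    positivity
  · have h1 : |truncate L x| ^ k ≤ |x| ^ k :=
      pow_le_pow_left₀ (abs_nonneg _) ((abs_truncate_le hL.le x).trans h.le) k
    have h2 := abs_sub (x ^ k) (truncate L x ^ k)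
    rw [abs_pow, abs_pow] at h2
    have h3 : |x| ^ k * L ≤ |x| ^ (k + 1) := by rw [pow_succ]; gcongr
    have h4 : |x| ^ (k + 1) ≤ 1 + x ^ (2 * (k + 1)) := by
      have : x ^ (2 * (k + 1)) = (|x| ^ (k + 1)) ^ 2 := by
        rw [← pow_mul, mul_comm (k + 1), ← (even_two_mul (k + 1)).pow_abs x]
      rw [this]
      nlinarith [sq_nonneg (|x| ^ (k + 1) - 1)]
    rw [div_mul_eq_mul_div, le_div_iff₀ hL]
    nlinarith

lemma abs_integral_pow_sub_truncate_le (ν : Measure ℝ) [IsProbabilityMeasure ν]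
    (hint : ∀ k : ℕ, Integrable (fun x => x ^ k) ν) {L : ℝ} (hL : 0 < L) (k : ℕ) :
    |∫ x, x ^ k ∂ν - ∫ x, truncate L x ^ k ∂ν| ≤ 2 / L * (1 + ∫ x, x ^ (2 * (k + 1)) ∂ν) := by
  have hc := continuous_truncate L
  have i1 : Integrable (fun x => truncate L x ^ k) ν :=
    Integrable.of_bound (C := L ^ k) (by fun_prop : Measurable fun x => truncate L x ^ k).aestronglyMeasurable
      (.of_forall fun x => by
        rw [Real.norm_eq_abs, abs_pow]
        exact pow_le_pow_left₀ (abs_nonneg _) (abs_truncate_le hL.le x) k)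
  have i2 : Integrable (fun x : ℝ => 1 + x ^ (2 * (k + 1))) ν :=
    (integrable_const 1).add (hint (2 * (k + 1)))
  rw [← integral_sub (hint k) i1]
  refine abs_integral_le_integral_abs.trans ?_
  refine (integral_mono ((hint k).sub i1).abs (i2.const_mul (2 / L))
    fun x => abs_pow_sub_truncate_pow_le hL k x).trans_eq ?_
  rw [integral_const_mul, integral_add (integrable_const 1) (hint (2 * (k + 1)))]
  simp

lemma integrable_pow_gaussianReal (k : ℕ) : Integrable (fun x : ℝ => x ^ k) (gaussianReal 0 1) := by
  rcases eq_or_ne k 0 with rfl | hk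
  · simp
  · have h := (memLp_id_gaussianReal (μ := 0) (v := 1) k).integrable_norm_pow (p := k) hk
    refine (integrable_norm_iff (by fun_prop)).1 ?_
    simpa using h

/-- Convergence of characteristic functions to the standard normal one, together with boundedness
of the even moments, yields convergence of moments. -/
lemma tendsto_integral_pow_of_charFun {ν : ℕ → ProbabilityMeasure ℝ}
    (hchar : ∀ θ : ℝ, Tendsto (fun n => charFun (ν n : Measure ℝ) θ) atTop
      (nhds (Complex.exp (-(θ : ℂ) ^ 2 / 2))))
    (hint : ∀ᶠ n in atTop, ∀ k : ℕ, Integrable (fun x : ℝ => x ^ k) (ν n : Measure ℝ))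
    (hbdd : ∀ k : ℕ, ∃ C, ∀ᶠ n in atTop, ∫ x, x ^ (2 * (k + 1)) ∂(ν n : Measure ℝ) ≤ C) :
    (∀ k : ℕ, Tendsto (fun n => ∫ x, x ^ k ∂(ν n : Measure ℝ)) atTop
      (nhds (∫ x, x ^ k ∂gaussianReal 0 1))) ∧
    ∀ x : ℝ, Tendsto (fun n => (ν n : Measure ℝ).real (Set.Iic x)) atTop
      (nhds ((gaussianReal 0 1).real (Set.Iic x))) := by
  obtain ⟨γ, hγ⟩ : ∃ γ : ProbabilityMeasure ℝ, (γ : Measure ℝ) = gaussianReal 0 1 :=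
    ⟨⟨gaussianReal 0 1, inferInstance⟩, rfl⟩
  have hlim : Tendsto ν atTop (nhds γ) := by
    rw [ProbabilityMeasure.tendsto_iff_tendsto_charFun, hγ]
    intro θ
    convert hchar θ using 2
    simp [charFun_gaussianReal, neg_div]
  refine ⟨fun k => ?_, fun x => ?_⟩
  · obtain ⟨C, hC⟩ := hbdd k
    set G := ∫ x, x ^ (2 * (k + 1)) ∂gaussianReal 0 1
    rw [Metric.tendsto_nhds]
    intro ε hε
    have hto : Tendsto (fun L : ℝ => 2 / L * (1 + max C G)) atTop (nhds 0) := by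
      simpa using (tendsto_const_nhds (x := (2 : ℝ)).div_atTop tendsto_id).mul_const (1 + max C G)
    obtain ⟨L, hL1, hL2⟩ := ((eventually_gt_atTop (0 : ℝ)).and
      (hto.eventually_lt_const (by positivity : 0 < ε / 3))).exists
    have hf := (ProbabilityMeasure.tendsto_iff_forall_integral_tendsto.1 hlim)
      (BoundedContinuousFunction.ofNormedAddCommGroup (fun x => truncate L x ^ k)
        ((continuous_truncate L).pow k) (L ^ k) fun x => by
          rw [Real.norm_eq_abs, abs_pow]
          exact pow_le_pow_left₀ (abs_nonneg _) (abs_truncate_le hL1.le x) k)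
    filter_upwards [hC, hint, Metric.tendsto_nhds.1 hf (ε / 3) (by positivity)] with n h1 h2 h3
    have k1 := abs_integral_pow_sub_truncate_le (ν n : Measure ℝ) h2 hL1 k
    have k2 := abs_integral_pow_sub_truncate_le (gaussianReal 0 1) integrable_pow_gaussianReal hL1 k
    have k3 : 2 / L * (1 + ∫ x, x ^ (2 * (k + 1)) ∂(ν n : Measure ℝ)) ≤ 2 / L * (1 + max C G) := by
      gcongr
      exact h1.trans (le_max_left _ _)
    have k4 : 2 / L * (1 + G) ≤ 2 / L * (1 + max C G) := by
      gcongr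
      exact le_max_right _ _
    rw [Real.dist_eq] at h3 ⊢
    simp only [BoundedContinuousFunction.coe_ofNormedAddCommGroup, hγ] at h3
    have k1 := abs_le.1 (k1.trans k3)
    have k2 := abs_le.1 (k2.trans k4)
    have h3 := abs_lt.1 h3
    rw [abs_lt]
    constructor <;> linarith [k1.1, k1.2, k2.1, k2.2, h3.1, h3.2]
  · have hna : NullSingletonClass (gaussianReal 0 1) := nullSingletonClass_gaussianReal one_ne_zero
    have h1 := ProbabilityMeasure.tendsto_measure_of_null_frontier_of_tendsto' hlim
      (E := Set.Iic x) (by rw [frontier_Iic, hγ]; exact measure_singleton x)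
    rw [hγ] at h1
    exact (ENNReal.tendsto_toReal (measure_ne_top _ _)).comp h1

lemma abs_integral_sq_sub_one_le {P : Measure (ℕ → ℝ)} [IsProbabilityMeasure P]
    {W S : (ℕ → ℝ) → ℝ} {B : ℝ} (hW : Measurable W) (hS : Measurable S) (hWb : ∀ x, |W x| ≤ B)
    (hSb : ∀ x, |S x| ≤ B) (h1 : ∫ x, W x ^ 2 ∂P = 1) {s : ℝ} (hs : 0 < s) :
    |∫ x, S x ^ 2 ∂P - 1| ≤ s + (1 / s + 1) * ∫ x, (W x - S x) ^ 2 ∂P := by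
  have iW : Integrable (fun x => W x ^ 2) P :=
    integrable_of_abs_le (M := B ^ 2) (by fun_prop) fun x => by
      rw [abs_pow]; exact pow_le_pow_left₀ (abs_nonneg _) (hWb x) 2
  have iS : Integrable (fun x => S x ^ 2) P :=
    integrable_of_abs_le (M := B ^ 2) (by fun_prop) fun x => by
      rw [abs_pow]; exact pow_le_pow_left₀ (abs_nonneg _) (hSb x) 2
  have iR : Integrable (fun x => (W x - S x) ^ 2) P :=
    integrable_of_abs_le (M := (B + B) ^ 2) (by fun_prop) fun x => by
      rw [abs_pow]
      exact pow_le_pow_left₀ (abs_nonneg _)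
        ((abs_sub _ _).trans (add_le_add (hWb x) (hSb x))) 2
  rw [← h1, ← integral_sub iS iW]
  have i2 : Integrable (fun x => s * W x ^ 2 + (1 / s + 1) * (W x - S x) ^ 2) P :=
    (iW.const_mul s).add (iR.const_mul _)
  refine abs_integral_le_integral_abs.trans
    ((integral_mono (iS.sub iW).abs i2 fun x => ?_).trans_eq ?_)
  · have e : S x ^ 2 - W x ^ 2 = (W x - S x) ^ 2 - 2 * (W x * (W x - S x)) := by ring
    have k : |2 * (W x * (W x - S x))| ≤ s * W x ^ 2 + 1 / s * (W x - S x) ^ 2 := by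
      have hs' := hs.ne'
      have e1 : s * W x ^ 2 + 1 / s * (W x - S x) ^ 2 - 2 * (W x * (W x - S x)) =
          s * (W x - 1 / s * (W x - S x)) ^ 2 := by field_simp; ring
      have e2 : s * W x ^ 2 + 1 / s * (W x - S x) ^ 2 + 2 * (W x * (W x - S x)) =
          s * (W x + 1 / s * (W x - S x)) ^ 2 := by field_simp; ring
      have p1 : 0 ≤ s * (W x - 1 / s * (W x - S x)) ^ 2 := by positivity
      have p2 : 0 ≤ s * (W x + 1 / s * (W x - S x)) ^ 2 := by positivity
      rw [abs_le]
      constructor <;> linarith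
    change |S x ^ 2 - W x ^ 2| ≤ _
    rw [e]
    refine (abs_sub _ _).trans ?_
    rw [abs_of_nonneg (sq_nonneg (W x - S x))]
    linarith
  · rw [integral_add (iW.const_mul s) (iR.const_mul _), integral_const_mul, integral_const_mul, h1,
      mul_one]

/-- Asymptotic normality of a normalised functional which is close in all moments to a sum of
functions of single coordinates. -/
theorem tendsto_gaussian_of_approx {P : ℕ → Measure (ℕ → ℝ)} {m : ℕ → ℕ} {δ b : ℕ → ℝ}
    {Y : ℕ → ℕ → (ℕ → ℝ) → ℝ} [∀ n, IsProbabilityMeasure (P n)]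
    (system : ∀ᶠ n in atTop, CoordSystem (P n) (m n) (δ n) (b n) (Y n))
    (small : Tendsto (fun n => m n * b n) atTop (nhds 0))
    (fast : ∀ A : ℕ, Tendsto (fun n : ℕ => (n : ℝ) ^ A * δ n) atTop (nhds 0))
    {W : ℕ → (ℕ → ℝ) → ℝ} (hW : ∀ n, Measurable (W n))
    (hWb : ∀ᶠ n in atTop, ∃ B, ∀ x, |W n x| ≤ B)
    (hW2 : ∀ᶠ n in atTop, ∫ x, W n x ^ 2 ∂P n = 1)
    (hR : ∀ q : ℕ, Tendsto (fun n => ∫ x, (W n x - blockSum (Y n) 0 n x) ^ (2 * (q + 1)) ∂P n)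
      atTop (nhds 0)) :
    (∀ k : ℕ, Tendsto (fun n => ∫ x, W n x ^ k ∂P n) atTop
      (nhds (∫ x, x ^ k ∂gaussianReal 0 1))) ∧
    ∀ y : ℝ, Tendsto (fun n => (P n).real {x | W n x ≤ y}) atTop
      (nhds ((gaussianReal 0 1).real (Set.Iic y))) := by
  have bounds : ∀ᶠ n in atTop, ∃ B, (∀ x, |W n x| ≤ B) ∧ ∀ x, |blockSum (Y n) 0 n x| ≤ B := by
    filter_upwards [hWb, system] with n ⟨B, hB⟩ hn
    exact ⟨max B ((n - 0 : ℕ) * b n), fun x => (hB x).trans (le_max_left _ _),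
      fun x => (hn.abs_blockSum_le' 0 n x).trans (le_max_right _ _)⟩
  have var : Tendsto (fun n => blockVar (P n) (Y n) 0 n) atTop (nhds 1) := by
    rw [Metric.tendsto_nhds]
    intro ε hε
    have h0 := (hR 0).const_mul (1 / (ε / 2) + 1)
    rw [mul_zero] at h0
    filter_upwards [bounds, system, hW2, h0.eventually_lt_const (by positivity : 0 < ε / 2)]
      with n ⟨B, hB1, hB2⟩ hn h2 h3
    rw [Real.dist_eq]
    refine (abs_integral_sq_sub_one_le (hW n) (hn.measurable_blockSum 0 n) hB1 hB2 h2
      (by positivity : 0 < ε / 2)).trans_lt ?_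
    norm_num at h3 ⊢
    linarith
  have harr : CoordArray P m δ b Y := ⟨system, small, fast, var⟩
  set ν : ℕ → ProbabilityMeasure ℝ := fun n =>
    ⟨(P n).map (W n), Measure.isProbabilityMeasure_map (hW n).aemeasurable⟩
  have hν : ∀ n, (ν n : Measure ℝ) = (P n).map (W n) := fun n => rfl
  have hpow : ∀ n k, ∫ x, x ^ k ∂(ν n : Measure ℝ) = ∫ x, W n x ^ k ∂P n := fun n k => by
    rw [hν, integral_map (hW n).aemeasurable (by fun_prop)]
  have main := tendsto_integral_pow_of_charFun (ν := ν) ?_ ?_ ?_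
  · refine ⟨fun k => ?_, fun y => ?_⟩
    · simpa only [hpow] using main.1 k
    · refine (main.2 y).congr fun n => ?_
      rw [hν, map_measureReal_apply (hW n) measurableSet_Iic]
      rfl
  · intro θ
    have h0 : Tendsto (fun n => |θ| * √(∫ x, (W n x - blockSum (Y n) 0 n x) ^ 2 ∂P n)) atTop
        (nhds 0) := by
      simpa using ((hR 0).sqrt).const_mul |θ|
    refine (harr.tendsto_blockChar θ).congr_dist
      (squeeze_zero' (.of_forall fun _ => dist_nonneg) ?_ h0)
    filter_upwards [bounds, system] with n ⟨B, hB1, hB2⟩ hn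
    have hmW : Measurable fun x => Complex.exp ((θ * W n x : ℝ) * Complex.I) := by
      have := hW n
      fun_prop
    have hmR : Measurable fun x => W n x - blockSum (Y n) 0 n x :=
      (hW n).sub (hn.measurable_blockSum 0 n)
    have hbR : ∀ x, |W n x - blockSum (Y n) 0 n x| ≤ B + B := fun x =>
      (abs_sub _ _).trans (add_le_add (hB1 x) (hB2 x))
    have e : charFun (ν n : Measure ℝ) θ =
        ∫ x, Complex.exp ((θ * W n x : ℝ) * Complex.I) ∂P n := by
      rw [charFun_apply_real, hν, integral_map (hW n).aemeasurable (by fun_prop)]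
      simp only [Complex.ofReal_mul]
    rw [dist_comm, dist_eq_norm, e, blockChar, ← integral_sub
      (Integrable.of_bound hmW.aestronglyMeasurable 1
        (.of_forall fun _ => (Complex.norm_exp_ofReal_mul_I _).le))
      (hn.integrable_exp_blockSum θ 0 n)]
    refine (norm_integral_le_of_norm_le (g := fun x => |θ| * |W n x - blockSum (Y n) 0 n x|)
      ((integrable_of_abs_le hmR hbR).abs.const_mul _) (.of_forall fun x => ?_)).trans ?_
    · refine (norm_exp_ofReal_mul_I_sub_exp_le _ _).trans ?_
      rw [← mul_sub, abs_mul]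
    · rw [integral_const_mul]
      gcongr
      exact integral_abs_le_sqrt hmR hbR
  · filter_upwards [bounds] with n ⟨B, hB1, _⟩ k
    rw [hν]
    refine (integrable_map_measure (by fun_prop) (hW n).aemeasurable).2 ?_
    refine integrable_of_abs_le (M := B ^ k) ((hW n).pow_const k) fun x => ?_
    rw [Function.comp, abs_pow]
    exact pow_le_pow_left₀ (abs_nonneg _) (hB1 x) k
  · intro k
    obtain ⟨C, hC⟩ := harr.exists_integral_abs_blockSum_pow_le (q := 2 * (k + 1)) (by omega)
    refine ⟨2 ^ (2 * (k + 1) - 1) * (C + 1), ?_⟩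
    filter_upwards [bounds, system, hC, (hR k).eventually_le_const one_pos]
      with n ⟨B, hB1, hB2⟩ hn h1 h2
    have hmS := hn.measurable_blockSum 0 n
    have hmR : Measurable fun x => W n x - blockSum (Y n) 0 n x := (hW n).sub hmS
    have iS : Integrable (fun x => |blockSum (Y n) 0 n x| ^ (2 * (k + 1))) (P n) :=
      integrable_of_abs_le (M := B ^ (2 * (k + 1))) (by fun_prop) fun x => by
        rw [abs_pow, abs_abs]; exact pow_le_pow_left₀ (abs_nonneg _) (hB2 x) _
    have iR : Integrable (fun x => (W n x - blockSum (Y n) 0 n x) ^ (2 * (k + 1))) (P n) :=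
      integrable_of_abs_le (M := (B + B) ^ (2 * (k + 1))) (by fun_prop) fun x => by
        rw [abs_pow]
        exact pow_le_pow_left₀ (abs_nonneg _)
          ((abs_sub _ _).trans (add_le_add (hB1 x) (hB2 x))) _
    have iSR : Integrable (fun x => 2 ^ (2 * (k + 1) - 1) * (|blockSum (Y n) 0 n x| ^ (2 * (k + 1)) +
        (W n x - blockSum (Y n) 0 n x) ^ (2 * (k + 1)))) (P n) := (iS.add iR).const_mul _
    rw [hpow]
    refine (integral_mono_of_nonneg (.of_forall fun x => ?_) iSR (.of_forall fun x => ?_)).trans ?_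
    · rw [pow_mul]; positivity
    · have h3 := add_pow_le (abs_nonneg (blockSum (Y n) 0 n x))
        (abs_nonneg (W n x - blockSum (Y n) 0 n x)) (2 * (k + 1))
      rw [(even_two_mul (k + 1)).pow_abs (W n x - blockSum (Y n) 0 n x)] at h3
      refine le_trans ?_ h3
      rw [← (even_two_mul (k + 1)).pow_abs (W n x)]
      gcongr
      have := abs_add_le (blockSum (Y n) 0 n x) (W n x - blockSum (Y n) 0 n x)
      rwa [add_sub_cancel] at this
    · rw [integral_const_mul, integral_add iS iR]
      gcongr

lemma Decoupled.nonneg {P : Measure (ℕ → ℝ)} {m : ℕ} {δ : ℝ} (h : Decoupled P m δ) : 0 ≤ δ :=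
  (abs_nonneg _).trans (h 0 0 measurable_zero (fun _ => by simp) fun _ _ _ => rfl)

lemma integral_sub_integral_pow_le {S : Type*} [MeasurableSpace S] {ρ : Measure S}
    [IsProbabilityMeasure ρ] {R : S → ℝ} (hR : Measurable R) {B : ℝ} (hb : ∀ x, |R x| ≤ B) (q : ℕ) :
    ∫ x, (R x - ∫ y, R y ∂ρ) ^ (2 * (q + 1)) ∂ρ ≤
      2 ^ (2 * (q + 1)) * ∫ x, R x ^ (2 * (q + 1)) ∂ρ := by
  set p := 2 * (q + 1) with hp
  have hev : Even p := ⟨q + 1, by omega⟩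
  have iR : Integrable R ρ := integrable_of_abs_le hR hb
  have hbp : ∀ x, |R x ^ p| ≤ B ^ p := fun x => by
    rw [abs_pow]; exact pow_le_pow_left₀ (abs_nonneg _) (hb x) _
  have iRp : Integrable (fun x => R x ^ p) ρ := integrable_of_abs_le (hR.pow_const p) hbp
  have jensen : (∫ x, R x ∂ρ) ^ p ≤ ∫ x, R x ^ p ∂ρ :=
    (hev.convexOn_pow (𝕜 := ℝ)).map_integral_le (continuous_pow p).continuousOn isClosed_univ
      (.of_forall fun _ => Set.mem_univ _) iR iRp
  have hpt : ∀ x, (R x - ∫ y, R y ∂ρ) ^ p ≤ 2 ^ (p - 1) * (R x ^ p + (∫ y, R y ∂ρ) ^ p) := by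
    intro x
    have := hev.add_pow_le (a := R x) (b := -∫ y, R y ∂ρ)
    rwa [← sub_eq_add_neg, hev.neg_pow] at this
  have iL : Integrable (fun x => (R x - ∫ y, R y ∂ρ) ^ p) ρ :=
    integrable_of_abs_le (M := (B + |∫ y, R y ∂ρ|) ^ p) ((hR.sub_const _).pow_const p) fun x => by
      rw [abs_pow]
      refine pow_le_pow_left₀ (abs_nonneg _) ((abs_sub _ _).trans ?_) _
      linarith [hb x]
  have iR' : Integrable (fun x => 2 ^ (p - 1) * (R x ^ p + (∫ y, R y ∂ρ) ^ p)) ρ :=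
    (iRp.add (integrable_const _)).const_mul _
  have h1 := integral_mono iL iR' hpt
  rw [integral_const_mul, integral_add iRp (integrable_const _), integral_const, probReal_univ,
    one_smul] at h1
  refine h1.trans ?_
  have e : (2 : ℝ) ^ p = 2 ^ (p - 1) * 2 := by rw [← pow_succ]; congr 1
  rw [e, mul_assoc]
  gcongr
  linarith

/-- The part of the sum of the kernels `F j` that is linear in the coordinate `t`. -/
def linearPart (P : Measure (ℕ → ℝ)) {r : ℕ} (n : ℕ) (F : (Fin r → ℕ) → (ℕ → ℝ) → ℝ) (t : ℕ)
    (x : ℕ → ℝ) : ℝ :=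
  ∑ j ∈ Fintype.piFinset (fun _ : Fin r => Finset.Icc 1 n) with t ∈ Finset.univ.image j,
    proj P (F j) t x

lemma card_families_through_le (r n t : ℕ) :
    ((Fintype.piFinset (fun _ : Fin r => Finset.Icc 1 n)).filter
      fun j => t ∈ Finset.univ.image j).card ≤ r * n ^ (r - 1) := by
  have hsub : ((Fintype.piFinset (fun _ : Fin r => Finset.Icc 1 n)).filter
      fun j => t ∈ Finset.univ.image j) ⊆ Finset.univ.biUnion fun k : Fin r =>
        Fintype.piFinset (Function.update (fun _ : Fin r => Finset.Icc 1 n) k {t}) := by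
    intro j hj
    obtain ⟨h1, h2⟩ := Finset.mem_filter.1 hj
    obtain ⟨k, -, hk⟩ := Finset.mem_image.1 h2
    refine Finset.mem_biUnion.2 ⟨k, Finset.mem_univ _, Fintype.mem_piFinset.2 fun i => ?_⟩
    by_cases hik : i = k
    · subst hik; simp [hk]
    · rw [Function.update_of_ne hik]; exact Fintype.mem_piFinset.1 h1 i
  refine (Finset.card_le_card hsub).trans (Finset.card_biUnion_le.trans ?_)
  have : ∀ k : Fin r, (Fintype.piFinset
      (Function.update (fun _ : Fin r => Finset.Icc 1 n) k {t})).card = n ^ (r - 1) := by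
    intro k
    rw [Fintype.card_piFinset, ← Finset.mul_prod_erase _ _ (Finset.mem_univ k),
      Function.update_self, Finset.card_singleton, one_mul, Finset.prod_congr rfl fun i hi => by
        rw [Function.update_of_ne (Finset.ne_of_mem_erase hi)]]
    simp
  simp [this]

section LinearPart

variable {P : Measure (ℕ → ℝ)} {r n : ℕ} {F : (Fin r → ℕ) → (ℕ → ℝ) → ℝ} {M : ℝ}

lemma sum_eq_blockSum_linearPart_add (x : ℕ → ℝ) :
    ∑ j ∈ Fintype.piFinset (fun _ : Fin r => Finset.Icc 1 n), F j x =
      blockSum (linearPart P n F) 0 n x +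
        ∑ j ∈ Fintype.piFinset (fun _ : Fin r => Finset.Icc 1 n),
          projResid P (F j) (Finset.univ.image j) x +
        ∑ j ∈ Fintype.piFinset (fun _ : Fin r => Finset.Icc 1 n), ∫ y, F j y ∂indepLaw P := by
  have h1 : blockSum (linearPart P n F) 0 n x =
      ∑ j ∈ Fintype.piFinset (fun _ : Fin r => Finset.Icc 1 n),
        ∑ s ∈ Finset.univ.image j, proj P (F j) s x := by
    simp only [blockSum, linearPart, Finset.sum_filter]
    rw [Finset.sum_comm]
    refine Finset.sum_congr rfl fun j hj => ?_
    rw [← Finset.sum_filter]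
    refine Finset.sum_congr ?_ fun _ _ => rfl
    ext s
    simp only [Finset.mem_filter, and_iff_right_iff_imp]
    intro hs
    obtain ⟨k, _, rfl⟩ := Finset.mem_image.1 hs
    have := Finset.mem_Icc.1 (Fintype.mem_piFinset.1 hj k)
    exact Finset.mem_Ioc.2 ⟨by omega, this.2⟩
  rw [h1, ← Finset.sum_add_distrib, ← Finset.sum_add_distrib]
  refine Finset.sum_congr rfl fun j _ => ?_
  rw [projResid]
  ring

variable [IsProbabilityMeasure P]

lemma measurable_linearPart (hF : ∀ j, Measurable (F j)) (t : ℕ) :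
    Measurable (linearPart P n F t) :=
  Finset.measurable_sum _ fun j _ => measurable_proj (hF j) t

lemma abs_linearPart_le (hb : ∀ j x, |F j x| ≤ M) (t : ℕ) (x : ℕ → ℝ) :
    |linearPart P n F t x| ≤ r * n ^ (r - 1) * (2 * M) := by
  have hM : 0 ≤ M := (abs_nonneg _).trans (hb 0 0)
  refine (Finset.abs_sum_le_sum_abs _ _).trans
    ((Finset.sum_le_card_nsmul _ _ (2 * M) fun j _ => abs_proj_le (hb j) t x).trans ?_)
  rw [nsmul_eq_mul]
  gcongr
  exact_mod_cast card_families_through_le r n t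

lemma integral_linearPart (hF : ∀ j, Measurable (F j)) (hb : ∀ j x, |F j x| ≤ M) (t : ℕ) :
    ∫ x, linearPart P n F t x ∂P = 0 := by
  unfold linearPart
  rw [integral_finsetSum _ fun j _ =>
    integrable_of_abs_le (measurable_proj (hF j) t) fun x => abs_proj_le (hb j) t x]
  exact Finset.sum_eq_zero fun j _ => integral_proj (hF j) (hb j) t

lemma coordSystem_linearPart {m : ℕ} {δ : ℝ} (hm : 1 ≤ m) (h : Decoupled P m δ)
    (hF : ∀ j, Measurable (F j)) (hb : ∀ j x, |F j x| ≤ M) {σ b : ℝ} (hσ : 0 < σ)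
    (hle : r * n ^ (r - 1) * (2 * M) / σ ≤ b) :
    CoordSystem P m δ b fun t x => linearPart P n F t x / σ where
  one_le := hm
  nonneg := h.nonneg
  decoupled := h
  measurable t := (measurable_linearPart hF t).div_const σ
  dependsOn t x y hxy := by
    simp only [linearPart]
    congr 1
    exact Finset.sum_congr rfl fun j _ => dependsOn_proj P (F j) t hxy
  bound t x := by
    rw [abs_div, abs_of_pos hσ]
    exact (div_le_div_of_nonneg_right (abs_linearPart_le hb t x) hσ.le).trans hle
  integral_eq t := by rw [integral_div, integral_linearPart hF hb t, zero_div]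

/-- Moments of the distance between the normalized sum of the kernels and its linear part. -/
lemma integral_pow_sub_blockSum_le {m : ℕ} {δ : ℝ} (hm : 1 ≤ m) (h : Decoupled P m δ) (hr : 1 ≤ r)
    (hn : 1 ≤ n) (hF : ∀ j, Measurable (F j)) (hb : ∀ j x, |F j x| ≤ M)
    (hdep : ∀ j, DependsOn (F j) (Finset.univ.image j : Finset ℕ)) {σ : ℝ} (q : ℕ) :
    ∫ x, ((∑ j ∈ Fintype.piFinset (fun _ : Fin r => Finset.Icc 1 n), F j x -
          ∫ y, ∑ j ∈ Fintype.piFinset (fun _ : Fin r => Finset.Icc 1 n), F j y ∂P) / σ -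
        blockSum (fun t x => linearPart P n F t x / σ) 0 n x) ^ (2 * (q + 1)) ∂P ≤
      2 ^ (2 * (q + 1)) * ((2 * M * (r + 1)) ^ (2 * (q + 1)) *
        ((2 * (q + 1) * r : ℕ) ^ (2 * (q + 1) * r) *
            (n ^ (2 * (q + 1) * r - 2 * (q + 1)) * (2 * m) ^ (2 * (q + 1) * r)) +
          n ^ (2 * (q + 1) * r) * (3 * r * δ))) / σ ^ (2 * (q + 1)) := by
  set I := Fintype.piFinset (fun _ : Fin r => Finset.Icc 1 n) with hI
  set R : (ℕ → ℝ) → ℝ := fun x => ∑ j ∈ I, projResid P (F j) (Finset.univ.image j) x with hRdef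
  have hR : Measurable R := Finset.measurable_sum _ fun j _ => measurable_projResid (hF j) _
  have hRb : ∀ x, |R x| ≤ ∑ j ∈ I, 2 * M * ((Finset.univ.image j).card + 1) := fun x =>
    (Finset.abs_sum_le_sum_abs _ _).trans
      (Finset.sum_le_sum fun j _ => abs_projResid_le (hb j) _ x)
  have hL : Measurable (blockSum (linearPart P n F) 0 n) :=
    Finset.measurable_sum _ fun t _ => measurable_linearPart hF t
  have hLb : ∀ x, |blockSum (linearPart P n F) 0 n x| ≤
      ∑ t ∈ Finset.Ioc 0 n, r * n ^ (r - 1) * (2 * M) := fun x =>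
    (Finset.abs_sum_le_sum_abs _ _).trans (Finset.sum_le_sum fun t _ => abs_linearPart_le hb t x)
  have iL := integrable_of_abs_le (ρ := P) hL hLb
  have iR := integrable_of_abs_le (ρ := P) hR hRb
  have hL0 : ∫ x, blockSum (linearPart P n F) 0 n x ∂P = 0 := by
    unfold blockSum
    rw [integral_finsetSum _ fun t _ =>
      integrable_of_abs_le (measurable_linearPart hF t) fun x => abs_linearPart_le hb t x]
    exact Finset.sum_eq_zero fun t _ => integral_linearPart hF hb t
  have hmean : ∫ y, ∑ j ∈ I, F j y ∂P = ∫ y, R y ∂P + ∑ j ∈ I, ∫ y, F j y ∂indepLaw P := by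
    have e : ∀ y, ∑ j ∈ I, F j y = blockSum (linearPart P n F) 0 n y + R y +
      ∑ j ∈ I, ∫ y, F j y ∂indepLaw P := fun y => sum_eq_blockSum_linearPart_add y
    simp only [e]
    have i1 : Integrable (fun y => blockSum (linearPart P n F) 0 n y + R y) P := iL.add iR
    rw [integral_add i1 (integrable_const _), integral_add iL iR, hL0, integral_const,
      probReal_univ, one_smul, zero_add]
  have hpt : ∀ x, ((∑ j ∈ I, F j x - ∫ y, ∑ j ∈ I, F j y ∂P) / σ -
        blockSum (fun t x => linearPart P n F t x / σ) 0 n x) ^ (2 * (q + 1)) =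
      (R x - ∫ y, R y ∂P) ^ (2 * (q + 1)) / σ ^ (2 * (q + 1)) := by
    intro x
    have e1 : blockSum (fun t x => linearPart P n F t x / σ) 0 n x =
        blockSum (linearPart P n F) 0 n x / σ := by
      simp only [blockSum, Finset.sum_div]
    rw [hmean, hI, sum_eq_blockSum_linearPart_add (P := P) x, ← hI, e1, ← div_pow, ← sub_div]
    congr 2
    simp only [hRdef]
    ring
  have hσ : 0 ≤ σ ^ (2 * (q + 1)) := (even_two_mul _).pow_nonneg σ
  simp only [hpt]
  rw [integral_div]
  refine div_le_div_of_nonneg_right ((integral_sub_integral_pow_le hR hRb q).trans ?_) hσ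
  refine mul_le_mul_of_nonneg_left ?_ (by positivity)
  exact (le_abs_self _).trans (h.abs_integral_pow_sum_projResid_le hm h.nonneg hr hn hF hb hdep _)

end LinearPart

/-- A gap length that is a small power of `n`, and at which the mixing coefficients are smaller
than any power of `n`. -/
lemma exists_gap {h : ℕ → ℝ} (hh : Tendsto h atTop atTop) {γ : ℝ} (hγ : 0 < γ) :
    ∃ m : ℕ → ℕ, (∀ n, 1 ≤ m n) ∧
      Tendsto (fun n : ℕ => (m n : ℝ) * (n : ℝ) ^ (-γ)) atTop (nhds 0) ∧
      ∀ A : ℕ, Tendsto (fun n : ℕ => (n : ℝ) ^ A * (m n : ℝ) ^ (-(h (m n)))) atTop (nhds 0) := by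
  have hpow : Tendsto (fun n : ℕ => (n : ℝ) ^ (γ / 2)) atTop atTop :=
    (tendsto_rpow_atTop (half_pos hγ)).comp tendsto_natCast_atTop_atTop
  have hneg : ∀ {a : ℝ}, 0 < a → Tendsto (fun n : ℕ => (n : ℝ) ^ (-a)) atTop (nhds 0) :=
    fun ha => (tendsto_rpow_neg_atTop ha).comp tendsto_natCast_atTop_atTop
  set m : ℕ → ℕ := fun n => ⌊(n : ℝ) ^ (γ / 2)⌋₊ + 1 with hm
  have hm_lower : ∀ n : ℕ, (n : ℝ) ^ (γ / 2) ≤ m n := fun n => by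
    have := (Nat.lt_floor_add_one ((n : ℝ) ^ (γ / 2))).le
    simpa [hm] using this
  have hm_top : Tendsto m atTop atTop :=
    tendsto_natCast_atTop_iff.1 (tendsto_atTop_mono hm_lower hpow)
  refine ⟨m, fun n => Nat.le_add_left _ _, ?_, fun A => ?_⟩
  · have hlim : Tendsto (fun n : ℕ => (n : ℝ) ^ (-(γ / 2)) + (n : ℝ) ^ (-γ)) atTop (nhds 0) := by
      simpa using (hneg (half_pos hγ)).add (hneg hγ)
    refine squeeze_zero' (.of_forall fun n => by positivity) ?_ hlim
    filter_upwards [eventually_gt_atTop 0] with n hn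
    have hn' : (0 : ℝ) < n := by exact_mod_cast hn
    have h1 : (m n : ℝ) ≤ (n : ℝ) ^ (γ / 2) + 1 := by
      have := Nat.floor_le (a := (n : ℝ) ^ (γ / 2)) (by positivity)
      simpa [hm] using this
    calc (m n : ℝ) * (n : ℝ) ^ (-γ) ≤ ((n : ℝ) ^ (γ / 2) + 1) * (n : ℝ) ^ (-γ) := by gcongr
      _ = _ := by
        rw [add_mul, one_mul, ← Real.rpow_add hn']
        congr 2
        ring
  · refine squeeze_zero' (.of_forall fun n => by positivity) ?_ (hneg one_pos)
    have hh' : ∀ᶠ n in atTop, 2 * ((A : ℝ) + 1) / γ ≤ h (m n) :=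
      (hh.comp hm_top).eventually_ge_atTop _
    filter_upwards [eventually_gt_atTop 0, hh'] with n hn hhn
    have hn' : (0 : ℝ) < n := by exact_mod_cast hn
    have hn1 : (1 : ℝ) ≤ n := by exact_mod_cast hn
    have hh0 : 0 ≤ h (m n) := le_trans (by positivity) hhn
    calc (n : ℝ) ^ A * (m n : ℝ) ^ (-(h (m n)))
        ≤ (n : ℝ) ^ A * ((n : ℝ) ^ (γ / 2)) ^ (-(h (m n))) := by
          refine mul_le_mul_of_nonneg_left ?_ (by positivity)
          exact Real.rpow_le_rpow_of_nonpos (by positivity) (hm_lower n) (neg_nonpos.2 hh0)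
      _ = (n : ℝ) ^ ((A : ℝ) + γ / 2 * (-(h (m n)))) := by
          rw [← Real.rpow_mul hn'.le, Real.rpow_add hn', Real.rpow_natCast]
      _ ≤ (n : ℝ) ^ (-1 : ℝ) := by
          refine Real.rpow_le_rpow_of_exponent_le hn1 ?_
          rw [div_le_iff₀ hγ] at hhn
          linarith

/-- Normal approximation for a sum of kernels under decoupling: the statement in terms of the laws
`P n` of the paths. -/
theorem tendsto_gaussian_of_kernels {P : ℕ → Measure (ℕ → ℝ)} [∀ n, IsProbabilityMeasure (P n)]
    {r : ℕ} (hr : 1 ≤ r) {F : ℕ → (Fin r → ℕ) → (ℕ → ℝ) → ℝ} (hF : ∀ n j, Measurable (F n j))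
    {M : ℝ} (hb : ∀ᶠ n in atTop, ∀ j x, |F n j x| ≤ M)
    (hdep : ∀ n j, DependsOn (F n j) (Finset.univ.image j : Finset ℕ)) {V : ℕ → (ℕ → ℝ) → ℝ}
    (hV : ∀ n x, V n x = ∑ j ∈ Fintype.piFinset (fun _ : Fin r => Finset.Icc 1 n), F n j x)
    {C κ : ℝ} (hC : 0 < C) (hκ : 0 < κ)
    (hvar : ∀ n : ℕ, C * (n : ℝ) ^ (2 * ((r : ℝ) - 1) + κ) ≤ variance (V n) (P n))
    {m : ℕ → ℕ} {δ : ℕ → ℝ} (hm : ∀ n, 1 ≤ m n) (hδ : ∀ n, Decoupled (P n) (m n) (δ n))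
    (hsmall : Tendsto (fun n : ℕ => (m n : ℝ) * (n : ℝ) ^ (-(κ / (2 * r)))) atTop (nhds 0))
    (hfast : ∀ A : ℕ, Tendsto (fun n : ℕ => (n : ℝ) ^ A * δ n) atTop (nhds 0)) :
    (∀ k : ℕ, Tendsto (fun n =>
      ∫ x, ((V n x - ∫ y, V n y ∂P n) / √(variance (V n) (P n))) ^ k ∂P n) atTop
        (nhds (∫ x, x ^ k ∂gaussianReal 0 1))) ∧
    ∀ y : ℝ, Tendsto (fun n =>
      (P n).real {x | (V n x - ∫ y, V n y ∂P n) / √(variance (V n) (P n)) ≤ y}) atTop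
        (nhds ((gaussianReal 0 1).real (Set.Iic y))) := by
  have hr' : (1 : ℝ) ≤ r := by exact_mod_cast hr
  have hr0 : (0 : ℝ) < r := by linarith
  have hM : 0 ≤ M := by
    obtain ⟨n, hn⟩ := hb.exists
    exact (abs_nonneg _).trans (hn 0 0)
  have hVm : ∀ n, Measurable (V n) := fun n => by
    have : V n = fun x => ∑ j ∈ Fintype.piFinset (fun _ : Fin r => Finset.Icc 1 n), F n j x :=
      funext (hV n)
    rw [this]
    exact Finset.measurable_sum _ fun j _ => hF n j
  set σ : ℕ → ℝ := fun n => √(variance (V n) (P n)) with hσdef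
  have hσ2 : ∀ n, σ n ^ 2 = variance (V n) (P n) := fun n => Real.sq_sqrt (variance_nonneg _ _)
  have hpowsplit : ∀ n : ℕ, 0 < n → (n : ℝ) ^ (2 * ((r : ℝ) - 1) + κ) =
      ((n : ℝ) ^ (r - 1)) ^ 2 * ((n : ℝ) ^ (κ / 2)) ^ 2 := by
    intro n hn
    have hn' : (0 : ℝ) < n := by exact_mod_cast hn
    rw [Real.rpow_add hn', ← pow_mul, ← Real.rpow_natCast, ← Real.rpow_natCast, ← Real.rpow_mul hn'.le]
    congr 2
    · push_cast [Nat.cast_sub hr]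
      ring
    · push_cast
      ring
  have hσ_ge : ∀ n : ℕ, 0 < n → √C * (n : ℝ) ^ (r - 1) * (n : ℝ) ^ (κ / 2) ≤ σ n := by
    intro n hn
    refine Real.le_sqrt_of_sq_le (le_trans (le_of_eq ?_) (hvar n))
    rw [hpowsplit n hn, mul_pow, mul_pow, Real.sq_sqrt hC.le]
    ring
  have hσ_pos : ∀ n : ℕ, 0 < n → 0 < σ n := fun n hn =>
    lt_of_lt_of_le (by have : (0 : ℝ) < n := by exact_mod_cast hn
                       positivity) (hσ_ge n hn)
  set c : ℝ := r * (2 * M) / √C with hc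
  have hpos : ∀ᶠ n : ℕ in atTop, 0 < n := eventually_gt_atTop 0
  refine tendsto_gaussian_of_approx (m := m) (δ := δ) (b := fun n : ℕ => c * (n : ℝ) ^ (-(κ / 2)))
    (Y := fun n t x => linearPart (P n) n (F n) t x / σ n) ?_ ?_ hfast
    (W := fun n x => (V n x - ∫ y, V n y ∂P n) / σ n) (fun n => ((hVm n).sub_const _).div_const _)
    ?_ ?_ ?_
  · filter_upwards [hpos, hb] with n hn hbn
    have hn' : (0 : ℝ) < n := by exact_mod_cast hn
    refine coordSystem_linearPart (hm n) (hδ n) (hF n) hbn (hσ_pos n hn) ?_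
    have hsC := Real.sqrt_pos.2 hC
    calc r * n ^ (r - 1) * (2 * M) / σ n
        ≤ r * n ^ (r - 1) * (2 * M) / (√C * (n : ℝ) ^ (r - 1) * (n : ℝ) ^ (κ / 2)) := by
          gcongr
          exact hσ_ge n hn
      _ = c * (n : ℝ) ^ (-(κ / 2)) := by
          rw [hc, Real.rpow_neg hn'.le]
          field_simp
  · have hlim := hsmall.const_mul c
    rw [mul_zero] at hlim
    refine squeeze_zero' (.of_forall fun n => by positivity) ?_ hlim
    filter_upwards [hpos] with n hn
    have hn1 : (1 : ℝ) ≤ n := by exact_mod_cast hn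
    have : (n : ℝ) ^ (-(κ / 2)) ≤ (n : ℝ) ^ (-(κ / (2 * r))) := by
      refine Real.rpow_le_rpow_of_exponent_le hn1 (neg_le_neg ?_)
      gcongr
      linarith
    have hc0 : 0 ≤ c := by positivity
    calc (m n : ℝ) * (c * (n : ℝ) ^ (-(κ / 2))) = c * (m n * (n : ℝ) ^ (-(κ / 2))) := by ring
      _ ≤ _ := by gcongr
  · filter_upwards [hb] with n hbn
    refine ⟨(∑ j ∈ Fintype.piFinset (fun _ : Fin r => Finset.Icc 1 n), M + |∫ y, V n y ∂P n|) /
      |σ n|, fun x => ?_⟩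
    rw [abs_div]
    refine div_le_div_of_nonneg_right ((abs_sub _ _).trans ?_) (abs_nonneg _)
    rw [hV n x]
    gcongr
    exact (Finset.abs_sum_le_sum_abs _ _).trans (Finset.sum_le_sum fun j _ => hbn j x)
  · filter_upwards [hpos] with n hn
    have := (hσ_pos n hn).ne'
    simp only [div_pow]
    rw [integral_div, hσ2, variance_eq_integral (hVm n).aemeasurable, div_self]
    rw [← variance_eq_integral (hVm n).aemeasurable, ← hσ2]
    positivity
  · intro q
    set p := 2 * (q + 1) with hp
    set K : ℝ := 2 ^ p * (2 * M * (r + 1)) ^ p / C ^ (q + 1) with hK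
    have hlim : Tendsto (fun n : ℕ => K * ((p * r : ℕ) ^ (p * r) * 2 ^ (p * r) *
        ((m n : ℝ) * (n : ℝ) ^ (-(κ / (2 * r)))) ^ (p * r) + 3 * r * ((n : ℝ) ^ (p * r) * δ n)))
        atTop (nhds 0) := by
      have h1 := (hsmall.pow (p * r)).const_mul (((p * r : ℕ) : ℝ) ^ (p * r) * 2 ^ (p * r))
      have h2 := (hfast (p * r)).const_mul (3 * (r : ℝ))
      have hpr : p * r ≠ 0 := by positivity
      have := (h1.add h2).const_mul K
      simpa [zero_pow hpr] using this
    refine squeeze_zero' (.of_forall fun n => integral_nonneg fun x =>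
      (even_two_mul _).pow_nonneg _) ?_ hlim
    filter_upwards [hpos, hb] with n hn hbn
    have hn' : (0 : ℝ) < n := by exact_mod_cast hn
    have hn1 : (1 : ℝ) ≤ n := by exact_mod_cast hn
    have hσn := hσ_pos n hn
    have hδ0 := (hδ n).nonneg
    simp only [hV]
    refine (integral_pow_sub_blockSum_le (hm n) (hδ n) hr hn (hF n) hbn (hdep n) q).trans ?_
    rw [← hp]
    have hσp : C ^ (q + 1) * ((n : ℝ) ^ (p * r - p) * ((n : ℝ) ^ (κ / 2)) ^ p) ≤ σ n ^ p := by
      have := pow_le_pow_left₀ (by positivity) (hvar n) (q + 1)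
      rw [← hσ2, ← pow_mul, ← hp, mul_pow, hpowsplit n hn] at this
      refine le_trans (le_of_eq ?_) this
      rw [mul_pow, ← pow_mul, ← pow_mul, ← pow_mul, ← hp, ← Nat.mul_sub_one]
      congr 3
      rw [hp]
      ring
    have hκp : ((n : ℝ) ^ (-(κ / (2 * r)))) ^ (p * r) = (((n : ℝ) ^ (κ / 2)) ^ p)⁻¹ := by
      rw [← inv_pow, ← Real.rpow_neg hn'.le, mul_comm p, pow_mul, ← Real.rpow_mul_natCast hn'.le]
      congr 2
      field_simp
    set N : ℝ := ((n : ℝ) ^ (κ / 2)) ^ p with hN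
    have hN1 : 1 ≤ N := one_le_pow₀ (Real.one_le_rpow hn1 (by positivity))
    set D : ℝ := (n : ℝ) ^ (p * r - p) with hD
    have hD1 : 1 ≤ D := one_le_pow₀ hn1
    have hND : 1 ≤ D * N := one_le_mul_of_one_le_of_one_le hD1 hN1
    rw [mul_pow (m n : ℝ), hκp]
    have hCq : 0 < C ^ (q + 1) := by positivity
    calc _ ≤ 2 ^ p * ((2 * M * (r + 1)) ^ p * ((p * r : ℕ) ^ (p * r) * (D * (2 * m n) ^ (p * r)) +
            n ^ (p * r) * (3 * r * δ n))) / (C ^ (q + 1) * (D * N)) := by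
          gcongr
      _ = K * ((p * r : ℕ) ^ (p * r) * 2 ^ (p * r) * ((m n : ℝ) ^ (p * r) * N⁻¹) +
            3 * r * (n ^ (p * r) * δ n) / (D * N)) := by
          rw [hK, mul_pow 2 (m n : ℝ)]
          field_simp
      _ ≤ _ := by
          gcongr
          exact div_le_self (by positivity) hND

/-- Theorem 4: asymptotic normality of `V`-statistics when the absolute
regularity coefficient decreases faster than any power of `t`. -/
theorem normal_approximation_V_statistic_fast_mixing
    (Ω : ℕ → Type*) (mΩ : ∀ n, MeasurableSpace (Ω n)) (μ : ∀ n, Measure (Ω n))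
    (hprob : ∀ n, IsProbabilityMeasure (μ n))
    (r : ℕ) (hr : 1 ≤ r)
    (X : ∀ n, ℕ → Ω n → ℝ)
    (hXmeas : ∀ n t, Measurable (X n t))
    (hstat : ∀ n, IsStrictlyStationary (μ n) (X n))
    -- absolute regularity: `β_n(m) ↓ 0` as `m → ∞`
    (hmixmono : ∀ n, Antitone (fun m => betaMixing (μ n) (X n) m))
    (hmix : ∀ n, Tendsto (fun m => betaMixing (μ n) (X n) m) atTop (nhds 0))
    -- the kernels, measurable and bounded by `F n`
    (f : ℕ → (Fin r → ℕ) → (Fin r → ℝ) → ℝ)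
    (hfmeas : ∀ n j, Measurable (f n j))
    -- the bound `F` on the kernels is a fixed number starting at some value of `n`
    (F : ℝ) (hfbound : ∀ᶠ n in atTop, ∀ j x, |f n j x| < F)
    -- the mixing coefficients decrease faster than any power:
    -- `β_n(t) ≤ t^{-h(t)}` with `h(t) → ∞`
    (h : ℕ → ℝ) (hhpos : ∀ t, 0 < h t) (hh : Tendsto h atTop atTop)
    (hbeta : ∀ (n t : ℕ), 1 ≤ t → betaMixing (μ n) (X n) t ≤ (t : ℝ) ^ (-(h t)))
    -- lower bound on the variance: `Var U_n ≥ C n^{2(r-1)+κ}`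
    (C κ : ℝ) (hC : 0 < C) (hκ : 0 < κ)
    (hvar : ∀ n : ℕ, C * (n : ℝ) ^ (2 * ((r : ℝ) - 1) + κ) ≤
      variance (Vstat r n (f n) (X n)) (μ n)) :
    -- convergence of all moments of `U_n*` to the standard normal moments
    (∀ k : ℕ,
      Tendsto (fun n : ℕ =>
          ∫ ω, ((Vstat r n (f n) (X n) ω - ∫ ω', Vstat r n (f n) (X n) ω' ∂μ n) /
              Real.sqrt (variance (Vstat r n (f n) (X n)) (μ n))) ^ k ∂μ n)
        atTop (nhds (∫ x, x ^ k ∂gaussianReal 0 1))) ∧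
    -- pointwise convergence of the distribution function of `U_n*` to the standard normal one
    (∀ x : ℝ,
      Tendsto (fun n : ℕ =>
          (μ n {ω | (Vstat r n (f n) (X n) ω - ∫ ω', Vstat r n (f n) (X n) ω' ∂μ n) /
              Real.sqrt (variance (Vstat r n (f n) (X n)) (μ n)) ≤ x}).toReal)
        atTop (nhds ((gaussianReal 0 1 (Set.Iic x)).toReal))) := by
  have hXm : ∀ n, Measurable fun ω t => X n t ω := fun n => measurable_pi_lambda _ (hXmeas n)
  set P : ℕ → Measure (ℕ → ℝ) := fun n => (μ n).map fun ω t => X n t ω with hP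
  have hPprob : ∀ n, IsProbabilityMeasure (P n) := fun n =>
    Measure.isProbabilityMeasure_map (hXm n).aemeasurable
  set G : ℕ → (Fin r → ℕ) → (ℕ → ℝ) → ℝ := fun n j x => f n j fun k => x (j k) with hG
  have hGm : ∀ n j, Measurable (G n j) := fun n j =>
    (hfmeas n j).comp (measurable_pi_lambda _ fun k => measurable_pi_apply (j k))
  have hGdep : ∀ n j, DependsOn (G n j) (Finset.univ.image j : Finset ℕ) := by
    intro n j x y hxy
    simp only [hG]
    congr 1
    funext k
    exact hxy _ (Finset.mem_coe.2 (Finset.mem_image_of_mem j (Finset.mem_univ k)))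
  set V : ℕ → (ℕ → ℝ) → ℝ :=
    fun n x => ∑ j ∈ Fintype.piFinset (fun _ : Fin r => Finset.Icc 1 n), G n j x with hVdef
  have hVm : ∀ n, Measurable (V n) := fun n => Finset.measurable_sum _ fun j _ => hGm n j
  have hVstat : ∀ n, Vstat r n (f n) (X n) = V n ∘ fun ω t => X n t ω := fun n => rfl
  have hmean : ∀ n, ∫ ω, Vstat r n (f n) (X n) ω ∂μ n = ∫ x, V n x ∂P n := fun n =>
    (integral_map (hXm n).aemeasurable (hVm n).aestronglyMeasurable).symm
  have hvar_eq : ∀ n, variance (Vstat r n (f n) (X n)) (μ n) = variance (V n) (P n) := fun n =>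
    (variance_map (hVm n).aemeasurable (hXm n).aemeasurable).symm
  obtain ⟨m, hm, hsmall, hfast⟩ := exists_gap hh (γ := κ / (2 * r)) (by positivity)
  have hδ : ∀ n, Decoupled (P n) (m n) (4 * betaMixing (μ n) (X n) (m n)) := fun n =>
    decoupled_betaMixing (μ n) (hXmeas n) (hm n)
  have key := tendsto_gaussian_of_kernels (P := P) hr hGm (M := F)
    (hfbound.mono fun n hn j x => (hn j _).le) hGdep (V := V) (fun n x => rfl) hC hκ
    (fun n => (hvar n).trans_eq (hvar_eq n)) hm hδ hsmall fun A => by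
      have hlim := (hfast A).const_mul 4
      rw [mul_zero] at hlim
      refine squeeze_zero (fun n => mul_nonneg (by positivity) (hδ n).nonneg) (fun n => ?_) hlim
      have := hbeta n (m n) (hm n)
      calc (n : ℝ) ^ A * (4 * betaMixing (μ n) (X n) (m n))
          ≤ (n : ℝ) ^ A * (4 * (m n : ℝ) ^ (-(h (m n)))) := by gcongr
        _ = 4 * ((n : ℝ) ^ A * (m n : ℝ) ^ (-(h (m n)))) := by ring
  have hWm : ∀ n, Measurable fun x => (V n x - ∫ y, V n y ∂P n) / √(variance (V n) (P n)) :=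
    fun n => ((hVm n).sub_const _).div_const _
  simp only [hmean, hvar_eq]
  refine ⟨fun k => (key.1 k).congr fun n => ?_, fun y => (key.2 y).congr fun n => ?_⟩
  · exact integral_map (hXm n).aemeasurable ((hWm n).pow_const k).aestronglyMeasurable
  · rw [measureReal_def, hP, Measure.map_apply (hXm n) (measurableSet_le (hWm n) measurable_const)]
    rfl
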